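/- Let Σ_Γ be a subshift of finite type without isolated points or empty cones, let E ⊆ Σ_Γ be a nonempty clopen set, and let G ≤ R_{Γ,E} be a rational similarity group that is contracting and is full as a group of homeomorphisms of E. Then G is finitely presented. -/

import Mathlib

open scoped Classical

noncomputable section

/-- A finite directed graph (loops and parallel edges are allowed). -/
structure FinDigraph : Type 1 where
  V : Type
  E : Type
  [fintypeV : Fintype V]
  [fintypeE : Fintype E]
  o : E → V
  t : E → V

attribute [instance] FinDigraph.fintypeV FinDigraph.fintypeE

instance (Γ : FinDigraph) : TopologicalSpace Γ.E := ⊥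
instance (Γ : FinDigraph) : DiscreteTopology Γ.E := ⟨rfl⟩

namespace FinDigraph

variable (Γ : FinDigraph)

/-- The subshift of finite type `Σ_Γ`: the set of all infinite directed paths in `Γ`,
viewed as a subset of the product space of all edge sequences (each edge's terminus is
the origin of the next edge). -/
def shift : Set (ℕ → Γ.E) := {x | ∀ i, Γ.t (x i) = Γ.o (x (i + 1))}

/-- Validity of a finite directed path starting at a given node. -/
def pathOk : Γ.V → List Γ.E → Prop
  | _, [] => True
  | v, e :: l => Γ.o e = v ∧ pathOk (Γ.t e) l

/-- A finite directed path in `Γ` (a node together with a compatible list of edges;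
a path with no edges is a node, regarded as a path of length `0`). -/
structure FinPath where
  start : Γ.V
  edges : List Γ.E
  ok : Γ.pathOk start edges

/-- Terminus of a list of edges starting at a given node. -/
def pathEndAux : Γ.V → List Γ.E → Γ.V
  | v, [] => v
  | _, e :: l => pathEndAux (Γ.t e) l

/-- The terminus `t(α)` of a finite directed path. -/
def pathEnd (α : Γ.FinPath) : Γ.V := Γ.pathEndAux α.start α.edges

/-- The length-0 path at a node `v`. -/
def trivPath (v : Γ.V) : Γ.FinPath := ⟨v, [], by simp [pathOk]⟩

/-- The cone `C_α ⊆ Σ_Γ` of all infinite directed paths having `α` as a prefix. -/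
def cone (α : Γ.FinPath) : Set (ℕ → Γ.E) :=
  {x | x ∈ Γ.shift ∧ Γ.o (x 0) = α.start ∧
    ∀ (i : ℕ) (h : i < α.edges.length), x i = α.edges.get ⟨i, h⟩}

/-- The canonical similarity `C_α → C_β` (for `t(α) = t(β)`) on the level of edge
sequences: delete the prefix `α` and attach the prefix `β`. -/
def splice (α β : Γ.FinPath) (x : ℕ → Γ.E) : ℕ → Γ.E := fun i =>
  if h : i < β.edges.length then β.edges.get ⟨i, h⟩
  else x (i - β.edges.length + α.edges.length)

/-- Concatenation `α · ω` of a finite path with an infinite path (on sequences). -/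
def catPath (α : Γ.FinPath) (x : ℕ → Γ.E) : ℕ → Γ.E :=
  Γ.splice (Γ.trivPath (Γ.pathEnd α)) α x

/-- The length of the path `f̄(α)`, i.e. of the greatest common prefix of all points
of `f(C_α)`. -/
def barLen (f : (ℕ → Γ.E) → ℕ → Γ.E) (α : Γ.FinPath) : ℕ :=
  sSup {n | ∀ x ∈ Γ.cone α, ∀ y ∈ Γ.cone α, ∀ i < n, f x i = f y i}

/-- The local action `f|_α : C_{t(α)} → C_{t(f̄(α))}`, determined by
`f(α·ω) = f̄(α)·(f|_α)(ω)`.  It is recorded together with the node `t(α)`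
(the node of its domain cone), and is extended by the identity off the cone
`C_{t(α)}`. -/
def localAction (f : (ℕ → Γ.E) → ℕ → Γ.E) (α : Γ.FinPath) :
    Γ.V × ((ℕ → Γ.E) → ℕ → Γ.E) :=
  (Γ.pathEnd α, fun w =>
    if w ∈ Γ.cone (Γ.trivPath (Γ.pathEnd α)) then
      fun i => f (Γ.catPath α w) (i + Γ.barLen f α)
    else w)

/-- A map is rational (on a domain `D`) if it has only finitely many distinct local
actions at cones contained in `D`. -/
def RationalOn (f : (ℕ → Γ.E) → ℕ → Γ.E) (D : Set (ℕ → Γ.E)) : Prop :=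
  (Γ.localAction f '' {α : Γ.FinPath | Γ.cone α ⊆ D}).Finite

/-- The nucleus `𝒩_f` of a map: the set of local actions `f|_α` that occur for
infinitely many finite paths `α` with `C_α` contained in the domain. -/
def nucleusOf (f : (ℕ → Γ.E) → ℕ → Γ.E) (D : Set (ℕ → Γ.E)) :
    Set (Γ.V × ((ℕ → Γ.E) → ℕ → Γ.E)) :=
  {p | {α : Γ.FinPath | Γ.cone α ⊆ D ∧ Γ.localAction f α = p}.Infinite}

/-- A nondegenerate map on `Σ_Γ` with domain `D`: it takes values in `Σ_Γ` and maps no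
cone contained in `D` to a single point. -/
def Nondegenerate (f : (ℕ → Γ.E) → ℕ → Γ.E) (D : Set (ℕ → Γ.E)) : Prop :=
  (∀ x ∈ D, f x ∈ Γ.shift) ∧
  ∀ α : Γ.FinPath, Γ.cone α ⊆ D → ¬∃ p, ∀ x ∈ Γ.cone α, f x = p

/-- Extension of a map `E → E'` between subsets of the sequence space to a globally
defined map (by the identity off `E`). -/
def homExt (E E' : Set (ℕ → Γ.E)) (f : ↥E → ↥E') : (ℕ → Γ.E) → ℕ → Γ.E :=
  fun x => if h : x ∈ E then ↑(f ⟨x, h⟩) else x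

/-- Extension of a permutation of `E` to a globally defined map. -/
def permExt (E : Set (ℕ → Γ.E)) (g : Equiv.Perm ↥E) : (ℕ → Γ.E) → ℕ → Γ.E :=
  Γ.homExt E E ⇑g

/-- `E` is a clopen subset of the subshift `Σ_Γ`. -/
def ClopenIn (E : Set (ℕ → Γ.E)) : Prop :=
  IsClopen {x : ↥Γ.shift | (x : ℕ → Γ.E) ∈ E}

/-- `U ⊆ Σ_Γ` is open in the subshift. -/
def OpenInShift (U : Set (ℕ → Γ.E)) : Prop :=
  IsOpen {x : ↥Γ.shift | (x : ℕ → Γ.E) ∈ U}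

/-- The subshift `Σ_Γ` has no isolated points. -/
def NoIsolatedPoints : Prop := ∀ x : ↥Γ.shift, ¬IsOpen ({x} : Set ↥Γ.shift)

/-- The subshift `Σ_Γ` has no empty cones. -/
def NoEmptyCones : Prop := ∀ α : Γ.FinPath, (Γ.cone α).Nonempty

/-- A permutation of `E` which is a homeomorphism and is a rational map:
an element of the rational group `R_{Γ,E}`. -/
def IsRatHomeo (E : Set (ℕ → Γ.E)) (g : Equiv.Perm ↥E) : Prop :=
  Continuous ⇑g ∧ Continuous ⇑g.symm ∧ Γ.RationalOn (Γ.permExt E g) E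

/-- `g` maps the cone `C_α` to the cone `C_β` by the canonical similarity
`α·ω ↦ β·ω`. -/
def RealizesCanonSim (E : Set (ℕ → Γ.E)) (g : Equiv.Perm ↥E) (α β : Γ.FinPath) : Prop :=
  ∀ x, ∀ hx : x ∈ E, x ∈ Γ.cone α → ↑(g ⟨x, hx⟩) = Γ.splice α β x

/-- A rational similarity group (RSG): a subgroup of the rational group `R_{Γ,E}` that
realizes the canonical similarity between any two cones `C_α, C_β ⊊ E` with
`t(α) = t(β)`. -/
def IsRSG (E : Set (ℕ → Γ.E)) (G : Subgroup (Equiv.Perm ↥E)) : Prop :=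
  (∀ g ∈ G, Γ.IsRatHomeo E g) ∧
  ∀ α β : Γ.FinPath, Γ.pathEnd α = Γ.pathEnd β → Γ.cone α ⊂ E → Γ.cone β ⊂ E →
    ∃ g ∈ G, Γ.RealizesCanonSim E g α β

/-- `h` locally agrees with the group `G`: every point has an open neighborhood on
which `h` coincides with some element of `G`. -/
def LocallyAgrees (E : Set (ℕ → Γ.E)) (G : Subgroup (Equiv.Perm ↥E))
    (h : Equiv.Perm ↥E) : Prop :=
  ∀ x : ↥E, ∃ U : Set ↥E, IsOpen U ∧ x ∈ U ∧ ∃ g ∈ G, ∀ u ∈ U, h u = g u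

/-- `G` is full as a group of homeomorphisms of `E`: every homeomorphism of `E` that
locally agrees with `G` already belongs to `G`. -/
def IsFullOn (E : Set (ℕ → Γ.E)) (G : Subgroup (Equiv.Perm ↥E)) : Prop :=
  ∀ h : Equiv.Perm ↥E, Continuous ⇑h → Continuous ⇑h.symm →
    Γ.LocallyAgrees E G h → h ∈ G

/-- The nucleus `𝒩_G` of a subgroup `G ≤ R_{Γ,E}`: the union of the nuclei of its
elements. -/
def groupNucleus (E : Set (ℕ → Γ.E)) (G : Subgroup (Equiv.Perm ↥E)) :
    Set (Γ.V × ((ℕ → Γ.E) → ℕ → Γ.E)) :=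
  ⋃ g ∈ G, Γ.nucleusOf (Γ.permExt E g) E

/-- An edge of the induced subgraph on a set `W` of nodes. -/
def InducedEdge (W : Set Γ.V) (e : Γ.E) : Prop := Γ.o e ∈ W ∧ Γ.t e ∈ W

/-- A path of the induced subgraph on `W`. -/
def PathIn (W : Set Γ.V) (α : Γ.FinPath) : Prop :=
  α.start ∈ W ∧ ∀ e ∈ α.edges, Γ.InducedEdge W e

/-- The induced subgraph on `W` is strongly connected and is not a directed cycle,
i.e. `Σ_{Γ₀}` is irreducible (where `Γ₀` is the induced subgraph on `W`). -/
def IrreducibleOn (W : Set Γ.V) : Prop :=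
  (∀ v ∈ W, ∀ w ∈ W, ∃ α : Γ.FinPath,
      α.start = v ∧ Γ.pathEnd α = w ∧ α.edges ≠ [] ∧ Γ.PathIn W α) ∧
  ¬∀ v ∈ W, ∃! e : Γ.E, Γ.InducedEdge W e ∧ Γ.o e = v

/-- `Σ_Γ` has an irreducible core: an induced subgraph `Γ₀` (on a node set `W`) with
`Σ_{Γ₀}` irreducible, such that every node has a directed path to `Γ₀` and every
sufficiently long directed path ends in `Γ₀`. -/
def HasIrreducibleCore : Prop :=
  ∃ W : Set Γ.V, Γ.IrreducibleOn W ∧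
    (∀ v : Γ.V, ∃ α : Γ.FinPath, α.start = v ∧ Γ.pathEnd α ∈ W) ∧
    ∃ N : ℕ, ∀ α : Γ.FinPath, α.edges.length = N → Γ.pathEnd α ∈ W

/-- `G ≤ R_{Γ,E}` is contracting: `Σ_Γ` has an irreducible core and the nucleus `𝒩_G`
is finite. -/
def IsContracting (E : Set (ℕ → Γ.E)) (G : Subgroup (Equiv.Perm ↥E)) : Prop :=
  Γ.HasIrreducibleCore ∧ (Γ.groupNucleus E G).Finite

/-- An element of the Thompson group `V_{Γ,E}`: there are partitions of `E` into cones
`C_{α_1},…,C_{α_k}` and `C_{β_1},…,C_{β_k}` with `t(α_i) = t(β_i)` such that `g` maps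
each `C_{α_i}` to `C_{β_i}` by the canonical similarity. -/
def IsThompson (E : Set (ℕ → Γ.E)) (g : Equiv.Perm ↥E) : Prop :=
  ∃ (k : ℕ) (α β : Fin k → Γ.FinPath),
    (∀ i, Γ.pathEnd (α i) = Γ.pathEnd (β i)) ∧
    E = (⋃ i, Γ.cone (α i)) ∧
    Pairwise (fun i j => Disjoint (Γ.cone (α i)) (Γ.cone (α j))) ∧
    E = (⋃ i, Γ.cone (β i)) ∧
    Pairwise (fun i j => Disjoint (Γ.cone (β i)) (Γ.cone (β j))) ∧
    ∀ i, Γ.RealizesCanonSim E g (α i) (β i)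

/-- A rational (eventually repeating) point `σ·τ^∞` of `Σ_Γ`. -/
def IsRationalPt (x : ℕ → Γ.E) : Prop :=
  ∃ σ τ : Γ.FinPath, τ.edges ≠ [] ∧
    (∀ (i : ℕ) (h : i < σ.edges.length), x i = σ.edges.get ⟨i, h⟩) ∧
    ∀ i : ℕ, σ.edges.length ≤ i →
      ∀ h : (i - σ.edges.length) % τ.edges.length < τ.edges.length,
        x i = τ.edges.get ⟨(i - σ.edges.length) % τ.edges.length, h⟩

/-- `β = f̄(α)`: the cone `C_β` is the smallest cone containing `f(C_α)`, with `β` the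
greatest common prefix of the points of `f(C_α)`. -/
def IsBar (f : (ℕ → Γ.E) → ℕ → Γ.E) (α β : Γ.FinPath) : Prop :=
  f '' Γ.cone α ⊆ Γ.cone β ∧
  ∀ γ : Γ.FinPath, f '' Γ.cone α ⊆ Γ.cone γ →
    Γ.cone β ⊆ Γ.cone γ ∧ γ.edges.length ≤ β.edges.length

end FinDigraph
/-- A group is finitely presented if it is the quotient of a finitely generated free
group by the normal closure of finitely many relators. -/
def FinitelyPresentedGroup (G : Type) [Group G] : Prop :=
  ∃ (n : ℕ) (φ : FreeGroup (Fin n) →* G), Function.Surjective φ ∧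
    ∃ R : Set (FreeGroup (Fin n)), R.Finite ∧ φ.ker = Subgroup.normalClosure R

/-- A system of spaces `pt x`, where `x` is either a node of `W` or the base space `none`,
together with classes of injective maps from the node spaces and a self-similar
decomposition of every node space along edges. -/
structure ChartData where
  W : Type
  [fintypeW : Fintype W]
  pt : Option W → Type
  M : ∀ (w : W) (x : Option W), Set (pt (some w) → pt x)
  Ed : W → Type
  [fintypeEd : ∀ v, Fintype (Ed v)]
  tgt : ∀ {v}, Ed v → W
  ed : ∀ {v} (e : Ed v), pt (some (tgt e)) → pt (some v)
  inj : ∀ {w x} {f : pt (some w) → pt x}, f ∈ M w x → Function.Injective f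
  ne : ∀ v, Nonempty (pt (some v))
  id_mem : ∀ v, id ∈ M v (some v)
  comp_mem : ∀ {u w x} {f : pt (some w) → pt x} {g : pt (some u) → pt (some w)},
    f ∈ M w x → g ∈ M u (some w) → f ∘ g ∈ M u x
  factor : ∀ {u w x} {f : pt (some w) → pt x} {g : pt (some u) → pt x},
    f ∈ M w x → g ∈ M u x → Set.range g ⊆ Set.range f → ∃ h ∈ M u (some w), g = f ∘ h
  ed_mem : ∀ {v} (e : Ed v), ed e ∈ M (tgt e) (some v)
  ed_cover : ∀ {v} (p : pt (some v)), ∃ e, ∃ y, ed (v := v) e y = p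
  ed_disj : ∀ {v} (e e' : Ed v) y y', ed e y = ed e' y' → e = e'

namespace ChartData

attribute [instance] ChartData.fintypeW ChartData.fintypeEd ChartData.ne

variable {D : ChartData}

/-- A chart of `x`: an admissible map from a node space into `pt x`. -/
structure Chart (D : ChartData) (x : Option D.W) where
  ty : D.W
  fn : D.pt (some ty) → D.pt x
  mem : fn ∈ D.M ty x

namespace Chart

variable {x : Option D.W}

/-- Restriction of a chart along a chart of its source. -/
def comp (φ : D.Chart x) (m : D.Chart (some φ.ty)) : D.Chart x :=
  ⟨m.ty, φ.fn ∘ m.fn, D.comp_mem φ.mem m.mem⟩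

/-- The identity chart of a node. -/
def one (v : D.W) : D.Chart (some v) := ⟨v, id, D.id_mem v⟩

/-- The chart of an edge. -/
def edge {v : D.W} (e : D.Ed v) : D.Chart (some v) := ⟨D.tgt e, D.ed e, D.ed_mem e⟩

/-- The image of a chart. -/
def img (φ : D.Chart x) : Set (D.pt x) := Set.range φ.fn

theorem comp_assoc (φ : D.Chart x) (m : D.Chart (some φ.ty)) (n : D.Chart (some m.ty)) :
    (φ.comp m).comp n = φ.comp (m.comp n) := rfl

@[simp] theorem comp_one (φ : D.Chart x) : φ.comp (one φ.ty) = φ := rfl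

@[simp] theorem one_comp {v : D.W} (m : D.Chart (some v)) : (one v).comp m = m := rfl

theorem comp_injective (φ : D.Chart x) : Function.Injective φ.comp := by
  rintro ⟨w, f, hf⟩ ⟨w', f', hf'⟩ h
  simp only [comp, Chart.mk.injEq] at h
  obtain ⟨rfl, h⟩ := h
  have h := eq_of_heq h
  have : f = f' := by
    funext y
    exact D.inj φ.mem (congrFun h y)
  subst this
  rfl

theorem comp_inj {φ : D.Chart x} {m m' : D.Chart (some φ.ty)} :
    φ.comp m = φ.comp m' ↔ m = m' := φ.comp_injective.eq_iff

theorem img_comp_subset (φ : D.Chart x) (m : D.Chart (some φ.ty)) : (φ.comp m).img ⊆ φ.img := by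
  rintro _ ⟨y, rfl⟩
  exact ⟨m.fn y, rfl⟩

theorem img_nonempty (φ : D.Chart x) : φ.img.Nonempty := Set.range_nonempty _

theorem exists_comp_of_img_subset {φ χ : D.Chart x} (h : χ.img ⊆ φ.img) :
    ∃ m, χ = φ.comp m := by
  obtain ⟨g, hg, hh⟩ := D.factor φ.mem χ.mem h
  refine ⟨⟨χ.ty, g, hg⟩, ?_⟩
  cases χ
  simp only [comp, Chart.mk.injEq, heq_eq_eq, true_and]
  exact hh

end Chart

open Chart

variable {x : Option D.W}

/-- A finite partition of `pt x` into images of charts. -/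
structure IsPart (B : Finset (D.Chart x)) : Prop where
  cover : ∀ p, ∃ φ ∈ B, p ∈ φ.img
  disj : ∀ φ ∈ B, ∀ ψ ∈ B, ∀ p, p ∈ φ.img → p ∈ ψ.img → φ = ψ

namespace IsPart

theorem eq_of_img_subset {B : Finset (D.Chart x)} (hB : IsPart B) {φ ψ : D.Chart x}
    (hφ : φ ∈ B) (hψ : ψ ∈ B) (h : φ.img ⊆ ψ.img) : φ = ψ := by
  obtain ⟨p, hp⟩ := φ.img_nonempty
  exact hB.disj φ hφ ψ hψ p hp (h hp)

theorem eq_of_subset {A B : Finset (D.Chart x)} (hA : IsPart A) (hB : IsPart B) (h : A ⊆ B) :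
    A = B := by
  refine Finset.Subset.antisymm h fun φ hφ => ?_
  obtain ⟨p, hp⟩ := φ.img_nonempty
  obtain ⟨ψ, hψ, hp'⟩ := hA.cover p
  rwa [hB.disj φ hφ ψ (h hψ) p hp hp']

end IsPart

theorem isPart_one (v : D.W) : IsPart ({one v} : Finset (D.Chart (some v))) where
  cover p := ⟨one v, by simp, p, rfl⟩
  disj := by simp

/-- The partition of a node space along its edges. -/
def edges (v : D.W) : Finset (D.Chart (some v)) := Finset.univ.image edge

theorem mem_edges {v : D.W} {m : D.Chart (some v)} : m ∈ edges v ↔ ∃ e, m = edge e := by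
  simp [edges, eq_comm]

theorem isPart_edges (v : D.W) : IsPart (edges v) where
  cover p := by
    obtain ⟨e, y, h⟩ := D.ed_cover p
    exact ⟨edge e, mem_edges.2 ⟨e, rfl⟩, y, h⟩
  disj := by
    intro φ hφ ψ hψ p hp hp'
    obtain ⟨e, rfl⟩ := mem_edges.1 hφ
    obtain ⟨e', rfl⟩ := mem_edges.1 hψ
    obtain ⟨y, rfl⟩ := hp
    obtain ⟨y', h⟩ := hp'
    rw [D.ed_disj e' e _ _ h]

/-- Replacing a chart `θ` by its restrictions along `P`, in the context `R`. -/
def plug (R : Finset (D.Chart x)) (θ : D.Chart x) (P : Finset (D.Chart (some θ.ty))) :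
    Finset (D.Chart x) := R ∪ P.image θ.comp

/-- `R` completes the chart `θ` to a partition. -/
def Ctx (R : Finset (D.Chart x)) (θ : D.Chart x) : Prop := IsPart (insert θ R) ∧ θ ∉ R

theorem mem_plug {R : Finset (D.Chart x)} {θ : D.Chart x} {P : Finset (D.Chart (some θ.ty))}
    {χ : D.Chart x} : χ ∈ plug R θ P ↔ χ ∈ R ∨ ∃ m ∈ P, χ = θ.comp m := by
  simp [plug, eq_comm]

@[simp] theorem plug_one (R : Finset (D.Chart x)) (θ : D.Chart x) :
    plug R θ {one θ.ty} = insert θ R := by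
  ext χ
  simp [mem_plug, or_comm]

theorem plug_plug (R : Finset (D.Chart x)) (θ : D.Chart x) (S : Finset (D.Chart (some θ.ty)))
    (m : D.Chart (some θ.ty)) (P : Finset (D.Chart (some m.ty))) :
    plug (plug R θ S) (θ.comp m) P = plug R θ (plug S m P) := by
  ext χ
  constructor
  · intro h
    rcases mem_plug.1 h with h1 | ⟨a, h1, rfl⟩
    · rcases mem_plug.1 h1 with h2 | ⟨a, h2, rfl⟩
      · exact mem_plug.2 (Or.inl h2)
      · exact mem_plug.2 (Or.inr ⟨a, mem_plug.2 (Or.inl h2), rfl⟩)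
    · exact mem_plug.2 (Or.inr ⟨m.comp a, mem_plug.2 (Or.inr ⟨a, h1, rfl⟩), rfl⟩)
  · intro h
    rcases mem_plug.1 h with h1 | ⟨a, h1, rfl⟩
    · exact mem_plug.2 (Or.inl (mem_plug.2 (Or.inl h1)))
    · rcases mem_plug.1 h1 with h2 | ⟨b, h2, rfl⟩
      · exact mem_plug.2 (Or.inl (mem_plug.2 (Or.inr ⟨a, h2, rfl⟩)))
      · exact mem_plug.2 (Or.inr ⟨b, h2, rfl⟩)

theorem insert_plug (R : Finset (D.Chart x)) (θ : D.Chart x) (S : Finset (D.Chart (some θ.ty)))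
    (m : D.Chart (some θ.ty)) : insert (θ.comp m) (plug R θ S) = plug R θ (insert m S) := by
  ext χ
  simp only [mem_plug, Finset.mem_insert]
  constructor
  · rintro (rfl | h | ⟨a, h, rfl⟩)
    · exact Or.inr ⟨m, Or.inl rfl, rfl⟩
    · exact Or.inl h
    · exact Or.inr ⟨a, Or.inr h, rfl⟩
  · rintro (h | ⟨a, (rfl | h), rfl⟩)
    · exact Or.inr (Or.inl h)
    · exact Or.inl rfl
    · exact Or.inr (Or.inr ⟨a, h, rfl⟩)

theorem Ctx.notMem_img {R : Finset (D.Chart x)} {θ : D.Chart x} (h : Ctx R θ) {χ : D.Chart x}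
    (hχ : χ ∈ R) {p} (hp : p ∈ χ.img) : p ∉ θ.img := by
  intro hp'
  have := h.1.disj χ (Finset.mem_insert_of_mem hχ) θ (Finset.mem_insert_self _ _) p hp hp'
  exact h.2 (this ▸ hχ)

theorem Ctx.comp_notMem {R : Finset (D.Chart x)} {θ : D.Chart x} (h : Ctx R θ)
    (m : D.Chart (some θ.ty)) : θ.comp m ∉ R := by
  intro hm
  obtain ⟨p, hp⟩ := (θ.comp m).img_nonempty
  exact h.notMem_img hm hp (img_comp_subset _ _ hp)

theorem Ctx.isPart_plug {R : Finset (D.Chart x)} {θ : D.Chart x} (h : Ctx R θ)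
    {P : Finset (D.Chart (some θ.ty))} (hP : IsPart P) : IsPart (plug R θ P) where
  cover p := by
    obtain ⟨φ, hφ, hp⟩ := h.1.cover p
    rcases Finset.mem_insert.1 hφ with rfl | hφ
    · obtain ⟨q, rfl⟩ := hp
      obtain ⟨m, hm, y, rfl⟩ := hP.cover q
      exact ⟨φ.comp m, mem_plug.2 (Or.inr ⟨m, hm, rfl⟩), y, rfl⟩
    · exact ⟨φ, mem_plug.2 (Or.inl hφ), hp⟩
  disj := by
    intro φ hφ ψ hψ p hp hp'
    rcases mem_plug.1 hφ with hφ | ⟨m, hm, rfl⟩ <;> rcases mem_plug.1 hψ with hψ | ⟨n, hn, rfl⟩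
    · exact h.1.disj φ (Finset.mem_insert_of_mem hφ) ψ (Finset.mem_insert_of_mem hψ) p hp hp'
    · exact absurd (img_comp_subset _ _ hp') (h.notMem_img hφ hp)
    · exact absurd (img_comp_subset _ _ hp) (h.notMem_img hψ hp')
    · obtain ⟨y, rfl⟩ := hp
      obtain ⟨z, hz⟩ := hp'
      have hz : n.fn z = m.fn y := D.inj θ.mem hz
      rw [hP.disj m hm n hn (m.fn y) ⟨y, rfl⟩ ⟨z, hz⟩]

theorem ctx_erase {B : Finset (D.Chart x)} (hB : IsPart B) {θ : D.Chart x} (h : θ ∈ B) :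
    Ctx (B.erase θ) θ := by
  refine ⟨?_, by simp⟩
  rwa [Finset.insert_erase h]

theorem Ctx.plug {R : Finset (D.Chart x)} {θ : D.Chart x} (h : Ctx R θ)
    {S : Finset (D.Chart (some θ.ty))} {m : D.Chart (some θ.ty)} (hS : Ctx S m) :
    Ctx (plug R θ S) (θ.comp m) := by
  refine ⟨?_, ?_⟩
  · rw [insert_plug]
    exact h.isPart_plug hS.1
  · intro hm
    rcases mem_plug.1 hm with hm | ⟨n, hn, e⟩
    · exact h.comp_notMem m hm
    · rw [comp_inj] at e
      exact hS.2 (e ▸ hn)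

theorem Ctx.plug_disjoint {R : Finset (D.Chart x)} {θ : D.Chart x} (h : Ctx R θ)
    (P : Finset (D.Chart (some θ.ty))) : Disjoint R (P.image θ.comp) := by
  rw [Finset.disjoint_right]
  intro χ hχ
  obtain ⟨m, -, rfl⟩ := Finset.mem_image.1 hχ
  exact h.comp_notMem m

theorem Ctx.card_plug {R : Finset (D.Chart x)} {θ : D.Chart x} (h : Ctx R θ)
    (P : Finset (D.Chart (some θ.ty))) : (ChartData.plug R θ P).card = R.card + P.card := by
  rw [ChartData.plug, Finset.card_union_of_disjoint (h.plug_disjoint P),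
    Finset.card_image_of_injective _ θ.comp_injective]

/-- `n` successive edge restrictions lead from the first chart to the second. -/
def reach : ℕ → D.Chart x → D.Chart x → Prop
  | 0, φ, χ => χ = φ
  | n + 1, φ, χ => ∃ e, reach n (φ.comp (edge e)) χ

theorem reach.comp_left (φ : D.Chart x) {n : ℕ} : ∀ {a b : D.Chart (some φ.ty)},
    reach n a b → reach n (φ.comp a) (φ.comp b) := by
  induction n with
  | zero => rintro a b rfl; rfl
  | succ n ih =>
    rintro a b ⟨e, h⟩
    exact ⟨e, ih h⟩

theorem reach.exists_path {n : ℕ} : ∀ {φ χ : D.Chart x}, reach n φ χ →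
    ∃ β, reach n (one φ.ty) β ∧ χ = φ.comp β := by
  induction n with
  | zero => rintro φ _ rfl; exact ⟨one _, rfl, rfl⟩
  | succ n ih =>
    rintro φ χ ⟨e, h⟩
    obtain ⟨β, hβ, rfl⟩ := ih h
    exact ⟨(edge e).comp β, ⟨e, hβ.comp_left (edge e)⟩, rfl⟩

theorem reach.trans {n k : ℕ} : ∀ {φ χ ψ : D.Chart x}, reach n φ χ → reach k χ ψ →
    reach (n + k) φ ψ := by
  induction n with
  | zero => rintro φ χ ψ rfl h; simpa using h
  | succ n ih =>
    rintro φ χ ψ ⟨e, h⟩ h'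
    rw [Nat.succ_add]
    exact ⟨e, ih h h'⟩

theorem reach.split {n k : ℕ} : ∀ {φ ψ : D.Chart x}, reach (n + k) φ ψ →
    ∃ χ, reach n φ χ ∧ reach k χ ψ := by
  induction n with
  | zero => intro φ ψ h; exact ⟨φ, rfl, by simpa using h⟩
  | succ n ih =>
    intro φ ψ h
    rw [Nat.succ_add] at h
    obtain ⟨e, h⟩ := h
    obtain ⟨χ, h1, h2⟩ := ih h
    exact ⟨χ, ⟨e, h1⟩, h2⟩

theorem reach.img_subset {n : ℕ} : ∀ {φ χ : D.Chart x}, reach n φ χ → χ.img ⊆ φ.img := by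
  intro φ χ h
  obtain ⟨β, -, rfl⟩ := h.exists_path
  exact img_comp_subset _ _

theorem finite_reach (n : ℕ) : ∀ (φ : D.Chart x), {χ | reach n φ χ}.Finite := by
  induction n with
  | zero => intro φ; exact Set.finite_singleton φ
  | succ n ih =>
    intro φ
    have : {χ | reach (n + 1) φ χ} = ⋃ e, {χ | reach n (φ.comp (edge e)) χ} := by
      ext χ; simp [reach]
    rw [this]
    exact Set.finite_iUnion fun e => ih _

/-- Every sufficiently long edge path starting at the chart meets `R`. -/
inductive Bar (R : D.Chart x → Prop) : D.Chart x → Prop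
  | here {ψ} : R ψ → Bar R ψ
  | expand {ψ} : (∀ e, Bar R (ψ.comp (edge e))) → Bar R ψ

theorem Bar.mono {R R' : D.Chart x → Prop} (hR : ∀ χ, R χ → R' χ) {ψ : D.Chart x}
    (h : Bar R ψ) : Bar R' ψ := by
  induction h with
  | here h => exact .here (hR _ h)
  | expand _ ih => exact .expand ih

theorem Bar.bind {R R' : D.Chart x → Prop} (hR : ∀ χ, R χ → Bar R' χ) {ψ : D.Chart x}
    (h : Bar R ψ) : Bar R' ψ := by
  induction h with
  | here h => exact hR _ h
  | expand _ ih => exact .expand ih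

theorem Bar.comp_left (φ : D.Chart x) {R : D.Chart (some φ.ty) → Prop} {R' : D.Chart x → Prop}
    (hR : ∀ χ, R χ → R' (φ.comp χ)) {ψ : D.Chart (some φ.ty)} (h : Bar R ψ) :
    Bar R' (φ.comp ψ) := by
  induction h with
  | here h => exact .here (hR _ h)
  | expand _ ih => exact .expand ih

theorem Bar.exists_bound {R : ℕ → D.Chart x → Prop} {ψ : D.Chart x}
    (h : Bar (fun χ => ∃ j, R j χ) ψ) : ∃ n, Bar (fun χ => ∃ j ≤ n, R j χ) ψ := by
  induction h with
  | here h =>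
    obtain ⟨j, h⟩ := h
    exact ⟨j, .here ⟨j, le_rfl, h⟩⟩
  | expand _ ih =>
    choose n hn using ih
    refine ⟨Finset.univ.sup n, .expand fun e => (hn e).mono ?_⟩
    rintro χ ⟨j, hj, h⟩
    exact ⟨j, hj.trans (Finset.le_sup (Finset.mem_univ e)), h⟩

/-- The hypotheses on a system of charts used in the proof of finite presentability. -/
structure Good (D : ChartData) : Prop where
  nocycle : ∀ (n : ℕ) (v : D.W), ¬ reach (n + 1) (one v) (one v)
  glue : ∀ {x x' : Option D.W} {P : Finset (D.Chart x)} (T : D.pt x → D.pt x'),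
    Function.Injective T → IsPart P → (∀ φ ∈ P, T ∘ φ.fn ∈ D.M φ.ty x') →
    ∀ χ : D.Chart x, T ∘ χ.fn ∈ D.M χ.ty _
  leb : ∀ {x : Option D.W} {B : Finset (D.Chart x)}, IsPart B → ∀ ψ : D.Chart x,
    Bar (fun χ => ∃ φ ∈ B, χ.img ⊆ φ.img) ψ
  contraction : ∃ N : ∀ v, Set (D.Chart (some v)), (∀ v, (N v).Finite) ∧
    ∀ v (m : D.Chart (some v)), Bar (fun χ => ∃ k β, reach (k + 1) (one v) β ∧
      ∃ n ∈ N β.ty, χ = β.comp n) m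
  mix : ∀ v w : D.W, ∃ Q : Finset (D.Chart (some v)), IsPart Q ∧
    ∃ a ∈ Q, ∃ b ∈ Q, a ≠ b ∧ a.ty = w
  base : ∃ B : Finset (D.Chart none), IsPart B

end ChartData

namespace ChartData

open Chart

variable {D : ChartData} {x : Option D.W}

theorem reach.eq_of_overlap {n : ℕ} : ∀ {φ a b : D.Chart x} {p}, reach n φ a → reach n φ b →
    p ∈ a.img → p ∈ b.img → a = b := by
  induction n with
  | zero => rintro φ a b p rfl h - -; exact h.symm
  | succ n ih =>
    rintro φ a b p ⟨e, ha⟩ ⟨e', hb⟩ hp hp'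
    have : e = e' := by
      obtain ⟨y, hy⟩ := ha.img_subset hp
      obtain ⟨z, hz⟩ := hb.img_subset hp'
      exact D.ed_disj _ _ y z (D.inj φ.mem (hy.trans hz.symm))
    subst this
    exact ih ha hb hp hp'

theorem reach.sub {n k : ℕ} {φ a b : D.Chart x} {p} (ha : reach n φ a) (hb : reach k φ b)
    (hp : p ∈ a.img) (hp' : p ∈ b.img) (h : n ≤ k) : reach (k - n) a b := by
  rw [← Nat.add_sub_of_le h] at hb
  obtain ⟨χ, h1, h2⟩ := hb.split
  rwa [ha.eq_of_overlap h1 hp (h2.img_subset hp')]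

theorem Good.not_reach_self (hD : D.Good) {n : ℕ} {φ : D.Chart x} : ¬ reach (n + 1) φ φ := by
  intro h
  obtain ⟨β, hβ, e⟩ := h.exists_path
  have : one φ.ty = β := φ.comp_injective e
  subst this
  exact hD.nocycle n _ hβ

theorem Good.reach_unique (hD : D.Good) {n k : ℕ} {φ χ : D.Chart x} (h : reach n φ χ)
    (h' : reach k φ χ) : n = k := by
  obtain ⟨p, hp⟩ := χ.img_nonempty
  have key : ∀ {n k : ℕ}, reach n φ χ → reach k φ χ → ¬ n < k := by
    intro n k h h' hlt
    have := h.sub h' hp hp hlt.le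
    obtain ⟨d, hd⟩ : ∃ d, k - n = d + 1 := ⟨k - n - 1, by omega⟩
    rw [hd] at this
    exact hD.not_reach_self this
  exact ge_antisymm (not_lt.1 (key h h')) (not_lt.1 (key h' h))

/-- The second chart is obtained from the first by edge restrictions. -/
def Below (φ χ : D.Chart x) : Prop := ∃ n, reach n φ χ

theorem Below.refl (φ : D.Chart x) : Below φ φ := ⟨0, rfl⟩

theorem Below.trans {φ χ ψ : D.Chart x} : Below φ χ → Below χ ψ → Below φ ψ :=
  fun ⟨_, h⟩ ⟨_, h'⟩ => ⟨_, h.trans h'⟩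

theorem Below.img_subset {φ χ : D.Chart x} : Below φ χ → χ.img ⊆ φ.img :=
  fun ⟨_, h⟩ => h.img_subset

theorem Below.comp_left (φ : D.Chart x) {a b : D.Chart (some φ.ty)} :
    Below a b → Below (φ.comp a) (φ.comp b) := fun ⟨n, h⟩ => ⟨n, h.comp_left φ⟩

theorem below_edge (φ : D.Chart x) (e : D.Ed φ.ty) : Below φ (φ.comp (edge e)) :=
  ⟨1, e, rfl⟩

theorem Below.of_comp {φ : D.Chart x} {a : D.Chart (some φ.ty)} {χ : D.Chart x}
    (h : Below (φ.comp a) χ) : ∃ b, Below a b ∧ χ = φ.comp b := by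
  obtain ⟨n, h⟩ := h
  obtain ⟨β, hβ, rfl⟩ := h.exists_path
  exact ⟨a.comp β, ⟨n, hβ.comp_left a⟩, rfl⟩

theorem Below.comp_cancel {φ : D.Chart x} {a b : D.Chart (some φ.ty)}
    (h : Below (φ.comp a) (φ.comp b)) : Below a b := by
  obtain ⟨b', h, e⟩ := h.of_comp
  rwa [comp_inj.1 e]

theorem Good.below_antisymm (hD : D.Good) {φ χ : D.Chart x} :
    Below φ χ → Below χ φ → φ = χ := by
  rintro ⟨n, h⟩ ⟨k, h'⟩
  have := h.trans h'
  rcases Nat.eq_zero_or_pos (n + k) with h0 | h0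
  · have : n = 0 := by omega
    subst this
    exact h.symm
  · obtain ⟨d, hd⟩ : ∃ d, n + k = d + 1 := ⟨n + k - 1, by omega⟩
    rw [hd] at this
    exact absurd this hD.not_reach_self

/-- The charts lying between two charts of `T`. -/
def between (T : Set (D.Chart x)) : Set (D.Chart x) :=
  {ψ | ∃ a ∈ T, ∃ b ∈ T, Below a ψ ∧ Below ψ b}

theorem subset_between (T : Set (D.Chart x)) : T ⊆ between T :=
  fun a ha => ⟨a, ha, a, ha, .refl a, .refl a⟩

theorem Good.finite_between (hD : D.Good) {T : Set (D.Chart x)} (hT : T.Finite) :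
    (between T).Finite := by
  have : between T ⊆ ⋃ a ∈ T, ⋃ b ∈ T, {ψ | Below a ψ ∧ Below ψ b} := by
    rintro ψ ⟨a, ha, b, hb, h⟩
    simp only [Set.mem_iUnion]
    exact ⟨a, ha, b, hb, h⟩
  refine (hT.biUnion fun a _ => hT.biUnion fun b _ => ?_).subset this
  by_cases hab : Below a b
  · obtain ⟨n, hn⟩ := hab
    refine (Set.Finite.biUnion (Set.finite_Iic n) fun k _ => finite_reach k a).subset ?_
    rintro ψ ⟨⟨k, hk⟩, ⟨l, hl⟩⟩
    have := hD.reach_unique (hk.trans hl) hn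
    exact Set.mem_biUnion (show k ∈ Set.Iic n by simp; omega) hk
  · convert Set.finite_empty
    ext ψ
    simp only [Set.mem_ofPred_eq, Set.mem_empty_iff_false, iff_false]
    exact fun h => hab (h.1.trans h.2)

theorem bar_reach (n : ℕ) : ∀ φ : D.Chart x, Bar (reach n φ) φ := by
  induction n with
  | zero => exact fun φ => .here rfl
  | succ n ih =>
    intro φ
    exact .expand fun e => (ih _).mono fun χ h => ⟨e, h⟩

/-- Expansion of a partition at one chart. -/
def expand (B : Finset (D.Chart x)) (φ : D.Chart x) : Finset (D.Chart x) :=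
  plug (B.erase φ) φ (edges φ.ty)

theorem mem_expand {B : Finset (D.Chart x)} {φ χ : D.Chart x} :
    χ ∈ expand B φ ↔ (χ ≠ φ ∧ χ ∈ B) ∨ ∃ e, χ = φ.comp (edge e) := by
  rw [expand, mem_plug, Finset.mem_erase]
  refine or_congr_right ⟨?_, ?_⟩
  · rintro ⟨m, hm, rfl⟩
    obtain ⟨e, rfl⟩ := mem_edges.1 hm
    exact ⟨e, rfl⟩
  · rintro ⟨e, rfl⟩
    exact ⟨edge e, mem_edges.2 ⟨e, rfl⟩, rfl⟩

theorem isPart_expand {B : Finset (D.Chart x)} (hB : IsPart B) {φ : D.Chart x} (h : φ ∈ B) :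
    IsPart (expand B φ) := (ctx_erase hB h).isPart_plug (isPart_edges _)

/-- `X` is an expansion of `B`. -/
def Le (B X : Finset (D.Chart x)) : Prop := ∀ χ ∈ X, ∃ φ ∈ B, Below φ χ

theorem Le.refl (B : Finset (D.Chart x)) : Le B B := fun χ h => ⟨χ, h, .refl χ⟩

theorem Le.trans {A B C : Finset (D.Chart x)} (h : Le A B) (h' : Le B C) : Le A C := by
  intro χ hχ
  obtain ⟨φ, hφ, h1⟩ := h' χ hχ
  obtain ⟨ψ, hψ, h2⟩ := h φ hφ
  exact ⟨ψ, hψ, h2.trans h1⟩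

theorem le_expand {B : Finset (D.Chart x)} {φ : D.Chart x} (h : φ ∈ B) : Le B (expand B φ) := by
  intro χ hχ
  rcases mem_expand.1 hχ with ⟨-, h'⟩ | ⟨e, rfl⟩
  · exact ⟨χ, h', .refl χ⟩
  · exact ⟨φ, h, below_edge φ e⟩

theorem Le.exists_below {B X : Finset (D.Chart x)} (h : Le B X) (hB : IsPart B) (hX : IsPart X)
    {φ : D.Chart x} (hφ : φ ∈ B) : ∃ χ ∈ X, Below φ χ := by
  obtain ⟨p, hp⟩ := φ.img_nonempty
  obtain ⟨χ, hχ, hp'⟩ := hX.cover p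
  obtain ⟨φ', hφ', h'⟩ := h χ hχ
  rw [hB.disj φ hφ φ' hφ' p hp (h'.img_subset hp')]
  exact ⟨χ, hχ, h'⟩

theorem Good.notMem_of_expand_le (hD : D.Good) {B X : Finset (D.Chart x)} (hB : IsPart B)
    {φ : D.Chart x} (hφ : φ ∈ B) (h : Le (expand B φ) X) : φ ∉ X := by
  intro hX
  obtain ⟨ψ, hψ, n, hn⟩ := h φ hX
  rcases mem_expand.1 hψ with ⟨h1, h2⟩ | ⟨e, rfl⟩
  · exact h1 (hB.eq_of_img_subset hφ h2 hn.img_subset).symm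
  · exact hD.not_reach_self (n := n) (φ := φ) ⟨e, hn⟩

theorem Le.expand_le {B X : Finset (D.Chart x)} (h : Le B X) {φ : D.Chart x}
    (hX : φ ∉ X) : Le (expand B φ) X := by
  intro χ hχ
  obtain ⟨ψ, hψ, n, hn⟩ := h χ hχ
  by_cases e : ψ = φ
  · subst e
    cases n with
    | zero => exact absurd (hn ▸ hχ) hX
    | succ n =>
      obtain ⟨e, hn⟩ := hn
      exact ⟨_, mem_expand.2 (Or.inr ⟨e, rfl⟩), n, hn⟩
  · exact ⟨ψ, mem_expand.2 (Or.inl ⟨e, hψ⟩), n, hn⟩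

theorem expand_comm {B : Finset (D.Chart x)} (hB : IsPart B) {φ ψ : D.Chart x} (hφ : φ ∈ B)
    (hψ : ψ ∈ B) (hne : φ ≠ ψ) : expand (expand B φ) ψ = expand (expand B ψ) φ := by
  have key : ∀ φ ψ : D.Chart x, φ ∈ B → ψ ∈ B → φ ≠ ψ → ∀ e, φ.comp (edge e) ≠ ψ := by
    intro φ ψ hφ hψ hne e h
    apply hne
    refine (hB.eq_of_img_subset hψ hφ ?_).symm
    rw [← h]
    exact img_comp_subset _ _
  ext χ
  simp only [mem_expand]
  constructor
  · rintro (⟨h1, ⟨h2, h3⟩ | ⟨e, rfl⟩⟩ | ⟨e, rfl⟩)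
    · exact Or.inl ⟨h2, Or.inl ⟨h1, h3⟩⟩
    · exact Or.inr ⟨e, rfl⟩
    · exact Or.inl ⟨key ψ φ hψ hφ hne.symm e, Or.inr ⟨e, rfl⟩⟩
  · rintro (⟨h1, ⟨h2, h3⟩ | ⟨e, rfl⟩⟩ | ⟨e, rfl⟩)
    · exact Or.inl ⟨h2, Or.inl ⟨h1, h3⟩⟩
    · exact Or.inr ⟨e, rfl⟩
    · exact Or.inl ⟨key φ ψ hφ hψ hne e, Or.inr ⟨e, rfl⟩⟩

/-- Expansion with a given total number of edge restrictions. -/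
def LeN (B X : Finset (D.Chart x)) (N : ℕ) : Prop :=
  ∃ len : D.Chart x → ℕ, (∀ χ ∈ X, ∃ φ ∈ B, reach (len χ) φ χ) ∧ ∑ χ ∈ X, len χ = N

theorem Le.exists_leN {B X : Finset (D.Chart x)} (h : Le B X) : ∃ N, LeN B X N := by
  have : ∀ χ, ∃ n, χ ∈ X → ∃ φ ∈ B, reach n φ χ := by
    intro χ
    by_cases hχ : χ ∈ X
    · obtain ⟨φ, hφ, n, hn⟩ := h χ hχ
      exact ⟨n, fun _ => ⟨φ, hφ, hn⟩⟩
    · exact ⟨0, fun h => absurd h hχ⟩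
  choose len hlen using this
  exact ⟨_, len, hlen, rfl⟩

theorem LeN.le {B X : Finset (D.Chart x)} {N : ℕ} : LeN B X N → Le B X := by
  rintro ⟨len, h, -⟩ χ hχ
  obtain ⟨φ, hφ, h⟩ := h χ hχ
  exact ⟨φ, hφ, _, h⟩

theorem LeN.exists_lt {B X : Finset (D.Chart x)} {N : ℕ} (h : LeN B X N) (hB : IsPart B)
    (hX : IsPart X) {φ : D.Chart x} (hφ : φ ∈ B) (hφX : φ ∉ X) :
    ∃ N' < N, LeN (expand B φ) X N' := by
  obtain ⟨χ₀, hχ₀, hb⟩ := h.le.exists_below hB hX hφ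
  obtain ⟨len, h, rfl⟩ := h
  have key : ∀ χ ∈ X, Below φ χ → reach (len χ) φ χ := by
    intro χ hχ hb
    obtain ⟨φ', hφ', h'⟩ := h χ hχ
    obtain ⟨p, hp⟩ := χ.img_nonempty
    rwa [hB.disj φ hφ φ' hφ' p (hb.img_subset hp) (h'.img_subset hp)]
  have key' : ∀ χ ∈ X, Below φ χ → ∃ n, len χ = n + 1 := by
    intro χ hχ hb
    have := key χ hχ hb
    rcases h0 : len χ with _ | n
    · rw [h0] at this
      exact absurd (this ▸ hχ) hφX
    · exact ⟨n, rfl⟩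
  refine ⟨_, ?_, fun χ => if Below φ χ then len χ - 1 else len χ, ?_, rfl⟩
  · refine Finset.sum_lt_sum (fun χ _ => ?_) ⟨χ₀, hχ₀, ?_⟩
    · split_ifs <;> omega
    · obtain ⟨n, hn⟩ := key' χ₀ hχ₀ hb
      rw [if_pos hb]
      omega
  · intro χ hχ
    by_cases hb : Below φ χ
    · obtain ⟨n, hn⟩ := key' χ hχ hb
      have := key χ hχ hb
      rw [hn] at this
      obtain ⟨e, he⟩ := this
      refine ⟨_, mem_expand.2 (Or.inr ⟨e, rfl⟩), ?_⟩
      simpa [hb, hn] using he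
    · obtain ⟨φ', hφ', h'⟩ := h χ hχ
      refine ⟨φ', mem_expand.2 (Or.inl ⟨?_, hφ'⟩), by simpa [hb] using h'⟩
      rintro rfl
      exact hb ⟨_, h'⟩

section Values

variable {L : Type*} [Group L] (c : Finset (D.Chart x) → Finset (D.Chart x) → L)

/-- There is a sequence of expansions from `B` to `X` of total value `g`. -/
inductive Up : Finset (D.Chart x) → Finset (D.Chart x) → L → Prop
  | refl (B) : Up B B 1
  | step {B X φ g} : φ ∈ B → Up (expand B φ) X g → Up B X (c B (expand B φ) * g)

variable {c}

theorem Up.le {B X : Finset (D.Chart x)} {g : L} (h : Up c B X g) : Le B X := by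
  induction h with
  | refl B => exact .refl B
  | step h _ ih => exact (le_expand h).trans ih

theorem Up.isPart {B X : Finset (D.Chart x)} {g : L} (h : Up c B X g) (hB : IsPart B) :
    IsPart X := by
  induction h with
  | refl B => exact hB
  | step h _ ih => exact ih (isPart_expand hB h)

theorem Up.trans {B X Y : Finset (D.Chart x)} {g g' : L} (h : Up c B X g) (h' : Up c X Y g') :
    Up c B Y (g * g') := by
  induction h with
  | refl B => simpa using h'
  | step h _ ih => rw [mul_assoc]; exact .step h (ih h')

theorem Up.eq_of_potential {B X : Finset (D.Chart x)} {g : L} (h : Up c B X g) (hB : IsPart B)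
    (Q : Finset (D.Chart x) → L)
    (hQ : ∀ V φ, IsPart V → φ ∈ V → Le B V → Le (expand V φ) X →
      c V (expand V φ) = (Q V)⁻¹ * Q (expand V φ)) : g = (Q B)⁻¹ * Q X := by
  induction h with
  | refl B => simp
  | @step B X φ g h h' ih =>
    rw [ih (isPart_expand hB h), hQ B φ hB h (.refl B) h'.le]
    · group
    · exact fun V ψ hV hψ h1 h2 => hQ V ψ hV hψ ((le_expand h).trans h1) h2

theorem LeN.exists_up {X : Finset (D.Chart x)} (hX : IsPart X) (N : ℕ) :
    ∀ {B : Finset (D.Chart x)}, IsPart B → LeN B X N → ∃ g, Up c B X g := by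
  induction N using Nat.strong_induction_on with
  | _ N ih =>
    intro B hB h
    by_cases hsub : B ⊆ X
    · rw [hB.eq_of_subset hX hsub]
      exact ⟨1, .refl X⟩
    · obtain ⟨φ, hφ, hφX⟩ := Finset.not_subset.1 hsub
      obtain ⟨N', hlt, h'⟩ := h.exists_lt hB hX hφ hφX
      obtain ⟨g, hg⟩ := ih N' hlt (isPart_expand hB hφ) h'
      exact ⟨_, .step hφ hg⟩

theorem Le.exists_up {B X : Finset (D.Chart x)} (h : Le B X) (hB : IsPart B) (hX : IsPart X) :
    ∃ g, Up c B X g := by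
  obtain ⟨N, hN⟩ := h.exists_leN
  exact hN.exists_up hX N hB

/-- Commuting squares of expansions have trivial value. -/
def ExpandSquares (c : Finset (D.Chart x) → Finset (D.Chart x) → L) : Prop :=
  ∀ B φ ψ, IsPart B → φ ∈ B → ψ ∈ B → φ ≠ ψ →
    c B (expand B φ) * c (expand B φ) (expand (expand B φ) ψ) =
      c B (expand B ψ) * c (expand B ψ) (expand (expand B φ) ψ)

theorem LeN.up_unique (hD : D.Good) (hsq : ExpandSquares c) {X : Finset (D.Chart x)}
    (hX : IsPart X) (N : ℕ) :
    ∀ {B : Finset (D.Chart x)} {g g' : L}, IsPart B → LeN B X N → Up c B X g → Up c B X g' →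
      g = g' := by
  induction N using Nat.strong_induction_on with
  | _ N ih =>
    intro B g g' hB hN h h'
    cases h with
    | refl =>
      cases h' with
      | refl => rfl
      | step hφ h' => exact absurd hφ (hD.notMem_of_expand_le hB hφ h'.le)
    | @step _ _ φ g hφ h =>
      have hφX := hD.notMem_of_expand_le hB hφ h.le
      cases h' with
      | refl => exact absurd hφ hφX
      | @step _ _ ψ g' hψ h' =>
        have hψX := hD.notMem_of_expand_le hB hψ h'.le
        obtain ⟨N₁, hlt₁, hN₁⟩ := hN.exists_lt hB hX hφ hφX
        obtain ⟨N₂, hlt₂, hN₂⟩ := hN.exists_lt hB hX hψ hψX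
        by_cases hne : φ = ψ
        · subst hne
          rw [ih N₁ hlt₁ (isPart_expand hB hφ) hN₁ h h']
        · have hψ' : ψ ∈ expand B φ := mem_expand.2 (Or.inl ⟨Ne.symm hne, hψ⟩)
          have hφ' : φ ∈ expand B ψ := mem_expand.2 (Or.inl ⟨hne, hφ⟩)
          have hZ := isPart_expand (isPart_expand hB hφ) hψ'
          obtain ⟨k, hk⟩ := (h.le.expand_le hψX).exists_up (c := c) hZ hX
          have hk' := hk
          rw [expand_comm hB hφ hψ hne] at hk'
          rw [ih N₁ hlt₁ (isPart_expand hB hφ) hN₁ h (.step hψ' hk),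
            ih N₂ hlt₂ (isPart_expand hB hψ) hN₂ h' (.step hφ' hk'), ← mul_assoc,
            hsq B φ ψ hB hφ hψ hne, mul_assoc, expand_comm hB hφ hψ hne]

theorem Up.unique (hD : D.Good) (hsq : ExpandSquares c) {B X : Finset (D.Chart x)} {g g' : L}
    (hB : IsPart B) (h : Up c B X g) (h' : Up c B X g') : g = g' := by
  obtain ⟨N, hN⟩ := h.le.exists_leN
  exact hN.up_unique hD hsq (h.isPart hB) N hB h h'

end Values

/-- The least common expansion of two expansions of the same partition. -/
def join (X Y : Finset (D.Chart x)) : Finset (D.Chart x) :=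
  X.filter (fun ψ => ∃ χ ∈ Y, Below χ ψ) ∪ Y.filter (fun ψ => ∃ χ ∈ X, Below χ ψ)

theorem join_subset (X Y : Finset (D.Chart x)) : join X Y ⊆ X ∪ Y :=
  Finset.union_subset_union (Finset.filter_subset _ _) (Finset.filter_subset _ _)

theorem join_comm (X Y : Finset (D.Chart x)) : join X Y = join Y X := Finset.union_comm _ _

theorem le_join (X Y : Finset (D.Chart x)) : Le X (join X Y) := by
  intro ψ hψ
  rcases Finset.mem_union.1 hψ with h | h
  · exact ⟨ψ, (Finset.mem_filter.1 h).1, .refl ψ⟩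
  · exact (Finset.mem_filter.1 h).2

theorem le_join' (X Y : Finset (D.Chart x)) : Le Y (join X Y) := by
  rw [join_comm]
  exact le_join Y X

theorem Good.isPart_join (hD : D.Good) {B X Y : Finset (D.Chart x)} (hB : IsPart B)
    (hX : IsPart X) (hY : IsPart Y) (hBX : Le B X) (hBY : Le B Y) : IsPart (join X Y) where
  cover p := by
    obtain ⟨χ, hχ, hp⟩ := hX.cover p
    obtain ⟨ψ, hψ, hp'⟩ := hY.cover p
    obtain ⟨φ, hφ, n, hn⟩ := hBX χ hχ
    obtain ⟨φ', hφ', k, hk⟩ := hBY ψ hψ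
    obtain rfl := hB.disj φ hφ φ' hφ' p (hn.img_subset hp) (hk.img_subset hp')
    rcases le_total n k with h | h
    · exact ⟨ψ, Finset.mem_union_right _
        (Finset.mem_filter.2 ⟨hψ, χ, hχ, _, hn.sub hk hp hp' h⟩), hp'⟩
    · exact ⟨χ, Finset.mem_union_left _
        (Finset.mem_filter.2 ⟨hχ, ψ, hψ, _, hk.sub hn hp' hp h⟩), hp⟩
  disj := by
    have key : ∀ X Y : Finset (D.Chart x), IsPart X → IsPart Y → ∀ φ ψ p,
        φ ∈ X.filter (fun ψ => ∃ χ ∈ Y, Below χ ψ) →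
        ψ ∈ Y.filter (fun ψ => ∃ χ ∈ X, Below χ ψ) → p ∈ φ.img → p ∈ ψ.img → φ = ψ := by
      intro X Y hX hY φ ψ p hφ hψ hp hp'
      obtain ⟨hφ, a, ha, ha'⟩ := Finset.mem_filter.1 hφ
      obtain ⟨hψ, b, hb, hb'⟩ := Finset.mem_filter.1 hψ
      obtain rfl := hY.disj a ha ψ hψ p (ha'.img_subset hp) hp'
      obtain rfl := hX.disj b hb φ hφ p (hb'.img_subset hp') hp
      exact hD.below_antisymm hb' ha'
    intro φ hφ ψ hψ p hp hp'
    rcases Finset.mem_union.1 hφ with h | h <;> rcases Finset.mem_union.1 hψ with h' | h'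
    · exact hX.disj φ (Finset.mem_filter.1 h).1 ψ (Finset.mem_filter.1 h').1 p hp hp'
    · exact key X Y hX hY φ ψ p h h' hp hp'
    · exact (key X Y hX hY ψ φ p h' h hp' hp).symm
    · exact hY.disj φ (Finset.mem_filter.1 h).1 ψ (Finset.mem_filter.1 h').1 p hp hp'

theorem exists_le_of_forall {R : D.Chart x → Prop} (A : Finset (D.Chart x))
    (hA : ∀ θ ∈ A, ∀ B : Finset (D.Chart x), IsPart B → θ ∈ B →
      ∃ X, IsPart X ∧ Le B X ∧ ∀ χ ∈ X, (χ ∈ B ∧ χ ≠ θ) ∨ R χ)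
    {T : D.Chart x → Prop} (hT : ∀ χ, R χ → T χ) :
    ∀ B : Finset (D.Chart x), IsPart B → (∀ χ ∈ B, χ ∈ A ∨ T χ) →
      ∃ X, IsPart X ∧ Le B X ∧ ∀ χ ∈ X, T χ := by
  induction A using Finset.induction_on with
  | empty => exact fun B hB h => ⟨B, hB, .refl B, fun χ hχ => by simpa using h χ hχ⟩
  | insert a A _ ih =>
    intro B hB h
    have ih := ih fun θ hθ => hA θ (Finset.mem_insert_of_mem hθ)
    by_cases ha : a ∈ B
    · obtain ⟨X, hX, hle, hR⟩ := hA a (Finset.mem_insert_self _ _) B hB ha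
      obtain ⟨Y, hY, hle', hR'⟩ := ih X hX fun χ hχ => by
        rcases hR χ hχ with ⟨h1, h2⟩ | h1
        · simpa [h2] using h χ h1
        · exact Or.inr (hT χ h1)
      exact ⟨Y, hY, hle.trans hle', hR'⟩
    · refine ih B hB fun χ hχ => ?_
      have : χ ≠ a := by rintro rfl; exact ha hχ
      simpa [this] using h χ hχ

theorem Bar.exists_le {R : D.Chart x → Prop} {θ : D.Chart x} (h : Bar R θ) :
    ∀ B : Finset (D.Chart x), IsPart B → θ ∈ B →
      ∃ X, IsPart X ∧ Le B X ∧ ∀ χ ∈ X, (χ ∈ B ∧ χ ≠ θ) ∨ R χ := by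
  induction h with
  | @here ψ h =>
    intro B hB hψ
    refine ⟨B, hB, .refl B, fun χ hχ => ?_⟩
    by_cases e : χ = ψ
    · subst e; exact Or.inr h
    · exact Or.inl ⟨hχ, e⟩
  | @expand ψ _ ih =>
    intro B hB hψ
    obtain ⟨X, hX, hle, hR⟩ := exists_le_of_forall (R := R)
      (Finset.univ.image fun e => ψ.comp (edge e))
      (by
        intro θ hθ
        obtain ⟨e, -, rfl⟩ := Finset.mem_image.1 hθ
        exact ih e)
      (T := fun χ => (χ ∈ B ∧ χ ≠ ψ) ∨ R χ) (fun χ h => Or.inr h) (ChartData.expand B ψ)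
      (isPart_expand hB hψ) (by
        intro χ hχ
        rcases mem_expand.1 hχ with ⟨h1, h2⟩ | ⟨e, rfl⟩
        · exact Or.inr (Or.inl ⟨h2, h1⟩)
        · exact Or.inl (Finset.mem_image_of_mem _ (Finset.mem_univ e)))
    exact ⟨X, hX, (le_expand hψ).trans hle, hR⟩

/-- A partition all of whose charts are barred by `R` has an expansion with all charts in `R`. -/
theorem IsPart.exists_le {B : Finset (D.Chart x)} (hB : IsPart B) {R : D.Chart x → Prop}
    (h : ∀ χ ∈ B, Bar R χ) : ∃ X, IsPart X ∧ Le B X ∧ ∀ χ ∈ X, R χ :=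
  exists_le_of_forall B (fun θ hθ => (h θ hθ).exists_le) (fun _ h => h) B hB
    fun _ hχ => Or.inl hχ

end ChartData

/-- Dickson's lemma. -/
theorem exists_finite_minorants {ι : Type*} [Finite ι] (S : Set (ι → ℕ)) :
    ∃ T ⊆ S, T.Finite ∧ ∀ s ∈ S, ∃ t ∈ T, t ≤ s := by
  refine ⟨{t | Minimal (· ∈ S) t}, fun t ht => ht.prop, ?_, fun s hs => ?_⟩
  · exact (setOfPred_minimal_antichain _).finite_of_wellQuasiOrdered wellQuasiOrdered_le
  · obtain ⟨t, ht, hm⟩ := exists_minimal_le_of_wellFoundedLT (· ∈ S) s hs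
    exact ⟨t, hm, ht⟩

namespace ChartData

open Chart

variable {D : ChartData} {x : Option D.W}

/-- The number of charts of each type. -/
def tyv (B : Finset (D.Chart x)) (w : D.W) : ℕ := (B.filter fun φ => φ.ty = w).card

theorem sum_tyv (B : Finset (D.Chart x)) : ∑ w, tyv B w = B.card :=
  (Finset.card_eq_sum_card_fiberwise (fun _ _ => Finset.mem_coe.2 (Finset.mem_univ _))).symm

theorem tyv_union {A B : Finset (D.Chart x)} (h : Disjoint A B) :
    tyv (A ∪ B) = tyv A + tyv B := by
  funext w
  simp only [tyv, Pi.add_apply, Finset.filter_union]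
  exact Finset.card_union_of_disjoint (Finset.disjoint_filter_filter h)

theorem tyv_mono {A B : Finset (D.Chart x)} (h : A ⊆ B) : tyv A ≤ tyv B :=
  fun _ => Finset.card_le_card (Finset.filter_subset_filter _ h)

theorem tyv_singleton (φ : D.Chart x) : tyv {φ} = Pi.single φ.ty 1 := by
  funext w
  simp only [tyv, Finset.filter_singleton, Pi.single_apply, eq_comm]
  split_ifs <;> simp

theorem tyv_image {x' : Option D.W} {A : Finset (D.Chart x)} {τ : D.Chart x → D.Chart x'}
    (hinj : Function.Injective τ) (hty : ∀ φ, (τ φ).ty = φ.ty) : tyv (A.image τ) = tyv A := by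
  funext w
  simp only [tyv, Finset.filter_image, hty]
  exact Finset.card_image_of_injective _ hinj

theorem tyv_image_univ {x' : Option D.W} {A : Finset (D.Chart x)} {τ : A → D.Chart x'}
    (hinj : Function.Injective τ) (hty : ∀ φ, (τ φ).ty = φ.1.ty) :
    tyv (Finset.univ.image τ) = tyv A := by
  funext w
  simp only [tyv, Finset.filter_image, hty]
  rw [Finset.card_image_of_injective _ hinj]
  refine Finset.card_bij (fun a _ => a.1) (by simp) (by simp) ?_
  intro b hb
  obtain ⟨hb, hw⟩ := Finset.mem_filter.1 hb
  exact ⟨⟨b, hb⟩, by simpa using hw, rfl⟩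

/-- A family of charts with few types embeds into a family with many. -/
theorem exists_embedding {x' : Option D.W} {A : Finset (D.Chart x)} {C : Finset (D.Chart x')}
    (h : tyv A ≤ tyv C) : ∃ τ : A → D.Chart x', Function.Injective τ ∧
      ∀ φ, τ φ ∈ C ∧ (τ φ).ty = φ.1.ty := by
  have : ∀ w, Nonempty (A.filter (fun φ => φ.ty = w) ↪ C.filter (fun φ => φ.ty = w)) :=
    fun w => Function.Embedding.nonempty_of_card_le (by simpa [tyv] using h w)
  let e := fun w => (this w).some
  have hty : ∀ w a, (e w a).1.ty = w := fun w a => (Finset.mem_filter.1 (e w a).2).2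
  let τ : A → D.Chart x' := fun φ => e φ.1.ty ⟨φ.1, Finset.mem_filter.2 ⟨φ.2, rfl⟩⟩
  refine ⟨τ, ?_, fun φ => ⟨(Finset.mem_filter.1 (e _ _).2).1, hty _ _⟩⟩
  have key : ∀ w w' a b, w = w' → (e w a).1 = (e w' b).1 → a.1 = b.1 := by
    rintro w _ a b rfl hab
    rw [(e w).injective (Subtype.ext hab)]
  intro φ ψ hφψ
  refine Subtype.ext (key _ _ _ _ ?_ hφψ)
  rw [← hty φ.1.ty ⟨φ.1, Finset.mem_filter.2 ⟨φ.2, rfl⟩⟩,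
    ← hty ψ.1.ty ⟨ψ.1, Finset.mem_filter.2 ⟨ψ.2, rfl⟩⟩]
  exact congrArg Chart.ty hφψ

/-- A map which sends charts to charts injectively. -/
structure Adm {x x' : Option D.W} (T : D.pt x → D.pt x') : Prop where
  inj : Function.Injective T
  mem : ∀ χ : D.Chart x, T ∘ χ.fn ∈ D.M χ.ty _

/-- Pushing a chart forward. -/
def Adm.push {x x' : Option D.W} {T : D.pt x → D.pt x'} (h : Adm T) (χ : D.Chart x) :
    D.Chart x' := ⟨χ.ty, T ∘ χ.fn, h.mem χ⟩

theorem Adm.push_injective {x x' : Option D.W} {T : D.pt x → D.pt x'} (h : Adm T) :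
    Function.Injective h.push := by
  rintro ⟨w, f, hf⟩ ⟨w', f', hf'⟩ e
  simp only [push, Chart.mk.injEq] at e
  obtain ⟨rfl, e⟩ := e
  have : f = f' := h.inj.comp_left (eq_of_heq e)
  subst this
  rfl

theorem Adm.img_push {x x' : Option D.W} {T : D.pt x → D.pt x'} (h : Adm T) (χ : D.Chart x) :
    (h.push χ).img = T '' χ.img :=
  Set.range_comp T χ.fn

theorem Good.exists_adm (hD : D.Good) {x x' : Option D.W} {P : Finset (D.Chart x)}
    (hP : IsPart P) (τ : P → D.Chart x') (hty : ∀ φ, (τ φ).ty = φ.1.ty)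
    (hdisj : ∀ φ ψ p, p ∈ (τ φ).img → p ∈ (τ ψ).img → φ = ψ) :
    ∃ (T : D.pt x → D.pt x') (h : Adm T), (∀ φ : P, h.push φ.1 = τ φ) ∧
      ∀ p, ∃ φ, T p ∈ (τ φ).img := by
  have hF : ∀ φ : P, ∃ (f : D.pt (some φ.1.ty) → D.pt x') (hf : f ∈ D.M φ.1.ty x'),
      (⟨φ.1.ty, f, hf⟩ : D.Chart x') = τ φ := by
    intro φ
    have h := hty φ
    revert h
    generalize τ φ = χ
    obtain ⟨w, f, hf⟩ := χ
    rintro rfl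
    exact ⟨f, hf, rfl⟩
  choose f hf hfτ using hF
  have hc : ∀ p, ∃ (φ : P) (y : D.pt (some φ.1.ty)), φ.1.fn y = p := by
    intro p
    obtain ⟨φ, hφ, y, hy⟩ := hP.cover p
    exact ⟨⟨φ, hφ⟩, y, hy⟩
  choose ch pre hpre using hc
  have himg : ∀ φ y, f φ y ∈ (τ φ).img := by
    intro φ y
    rw [← hfτ]
    exact ⟨y, rfl⟩
  have hT : ∀ (φ : P) y, f (ch (φ.1.fn y)) (pre (φ.1.fn y)) = f φ y := by
    intro φ y
    have h1 : ch (φ.1.fn y) = φ :=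
      Subtype.ext (hP.disj _ (ch _).2 _ φ.2 (φ.1.fn y) ⟨_, hpre _⟩ ⟨y, rfl⟩)
    have h2 := hpre (φ.1.fn y)
    revert h2
    generalize pre (φ.1.fn y) = z
    revert z
    rw [h1]
    intro z hz
    rw [D.inj φ.1.mem hz]
  have hinj : Function.Injective fun p => f (ch p) (pre p) := by
    intro p q hpq
    have hpq : f (ch p) (pre p) = f (ch q) (pre q) := hpq
    have h1 : ch p = ch q := hdisj _ _ _ (himg (ch p) (pre p)) (hpq ▸ himg (ch q) (pre q))
    rw [← hpre p, ← hpre q]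
    revert hpq
    generalize pre p = a
    generalize pre q = b
    revert a b
    rw [h1]
    intro a b hab
    rw [D.inj (hf _) hab]
  have hTφ : ∀ φ : P, (fun p => f (ch p) (pre p)) ∘ φ.1.fn = f φ := fun φ => funext (hT φ)
  have hadm : Adm fun p => f (ch p) (pre p) :=
    ⟨hinj, hD.glue _ hinj hP fun φ hφ => by
      rw [hTφ ⟨φ, hφ⟩]; exact hf ⟨φ, hφ⟩⟩
  refine ⟨_, hadm, fun φ => ?_, fun p => ⟨_, himg (ch p) (pre p)⟩⟩
  rw [← hfτ φ]
  simp only [Adm.push, hTφ φ]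

/-- Any two partitions of a space can be exchanged inside a partition of another one. -/
theorem Good.transfer (hD : D.Good) {x x' : Option D.W} {A B : Finset (D.Chart x)}
    {C : Finset (D.Chart x')} (hA : IsPart A) (hB : IsPart B) (hC : IsPart C) {r : D.W → ℕ}
    (h : tyv C = tyv A + r) : ∃ C' : Finset (D.Chart x'), IsPart C' ∧ tyv C' = tyv B + r := by
  obtain ⟨τ, hτ, hτC⟩ := exists_embedding (A := A) (C := C) (by
    rw [h]; exact le_self_add)
  obtain ⟨T, hT, hTτ, hTimg⟩ := hD.exists_adm hA τ (fun φ => (hτC φ).2)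
    fun φ ψ p hp hp' => hτ (hC.disj _ (hτC φ).1 _ (hτC ψ).1 p hp hp')
  set S := Finset.univ.image τ with hS
  have hSC : S ⊆ C := by
    intro χ hχ
    obtain ⟨φ, -, rfl⟩ := Finset.mem_image.1 hχ
    exact (hτC φ).1
  have hin : ∀ p, T p ∉ ⋃ χ ∈ C \ S, χ.img := by
    intro p hp
    simp only [Set.mem_iUnion] at hp
    obtain ⟨χ, hχ, hp⟩ := hp
    obtain ⟨φ, hφ⟩ := hTimg p
    obtain ⟨hχC, hχS⟩ := Finset.mem_sdiff.1 hχ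
    rw [hC.disj χ hχC _ (hτC φ).1 _ hp hφ] at hχS
    exact hχS (Finset.mem_image_of_mem _ (Finset.mem_univ _))
  have hdis : Disjoint (C \ S) (B.image hT.push) := by
    rw [Finset.disjoint_right]
    intro χ hχ hχ'
    obtain ⟨ψ, -, rfl⟩ := Finset.mem_image.1 hχ
    obtain ⟨q, hq⟩ := ψ.img_nonempty
    refine hin q ?_
    simp only [Set.mem_iUnion]
    exact ⟨_, hχ', by rw [hT.img_push]; exact ⟨q, hq, rfl⟩⟩
  refine ⟨(C \ S) ∪ B.image hT.push, ⟨fun p => ?_, ?_⟩, ?_⟩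
  · obtain ⟨χ, hχ, hp⟩ := hC.cover p
    by_cases hχS : χ ∈ S
    · obtain ⟨φ, -, rfl⟩ := Finset.mem_image.1 hχS
      rw [← hTτ, hT.img_push] at hp
      obtain ⟨q, -, rfl⟩ := hp
      obtain ⟨ψ, hψ, hq⟩ := hB.cover q
      exact ⟨hT.push ψ, Finset.mem_union_right _ (Finset.mem_image_of_mem _ hψ), by
        rw [hT.img_push]; exact ⟨q, hq, rfl⟩⟩
    · exact ⟨χ, Finset.mem_union_left _ (Finset.mem_sdiff.2 ⟨hχ, hχS⟩), hp⟩
  · intro φ hφ ψ hψ p hp hp'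
    rcases Finset.mem_union.1 hφ with h1 | h1 <;> rcases Finset.mem_union.1 hψ with h2 | h2
    · exact hC.disj φ (Finset.sdiff_subset h1) ψ (Finset.sdiff_subset h2) p hp hp'
    · obtain ⟨ψ, -, rfl⟩ := Finset.mem_image.1 h2
      rw [hT.img_push] at hp'
      obtain ⟨q, -, rfl⟩ := hp'
      exact absurd (Set.mem_biUnion h1 hp) (hin q)
    · obtain ⟨φ, -, rfl⟩ := Finset.mem_image.1 h1
      rw [hT.img_push] at hp
      obtain ⟨q, -, rfl⟩ := hp
      exact absurd (Set.mem_biUnion h2 hp') (hin q)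
    · obtain ⟨φ, hφB, rfl⟩ := Finset.mem_image.1 h1
      obtain ⟨ψ, hψB, rfl⟩ := Finset.mem_image.1 h2
      rw [hT.img_push] at hp hp'
      obtain ⟨q, hq, rfl⟩ := hp
      obtain ⟨q', hq', e⟩ := hp'
      rw [hT.inj e] at hq'
      rw [hB.disj φ hφB ψ hψB q hq hq']
  · have h1 : tyv S = tyv A := tyv_image_univ hτ fun φ => (hτC φ).2
    have h2 : tyv (C \ S) + tyv S = tyv C := by
      rw [← tyv_union Finset.sdiff_disjoint, Finset.sdiff_union_of_subset hSC]
    rw [h1, h, add_comm] at h2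
    rw [tyv_union hdis, tyv_image hT.push_injective fun _ => rfl, add_left_cancel h2, add_comm]

/-- The type vectors of partitions. -/
def Types (D : ChartData) (x : Option D.W) : Set (D.W → ℕ) :=
  {f | ∃ B : Finset (D.Chart x), IsPart B ∧ tyv B = f}

theorem Good.types_transfer (hD : D.Good) {x x' : Option D.W} {a b r : D.W → ℕ}
    (ha : a ∈ D.Types x) (hb : b ∈ D.Types x) (hr : a + r ∈ D.Types x') : b + r ∈ D.Types x' := by
  obtain ⟨A, hA, rfl⟩ := ha
  obtain ⟨B, hB, rfl⟩ := hb
  obtain ⟨C, hC, h⟩ := hr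
  exact hD.transfer hA hB hC h

theorem single_mem_types (v : D.W) : Pi.single v 1 ∈ D.Types (some v) :=
  ⟨{one v}, isPart_one v, by rw [tyv_singleton]; rfl⟩

theorem single_le {ι : Type*} [DecidableEq ι] {f : ι → ℕ} {i : ι} (h : f i ≠ 0) :
    Pi.single i 1 ≤ f := by
  intro j
  rw [Pi.single_apply]
  split_ifs with hj
  · subst hj; exact Nat.one_le_iff_ne_zero.2 h
  · exact Nat.zero_le _

theorem Good.exists_add_mem_types (hD : D.Good) (v : D.W) (n : ℕ) : ∀ f : D.W → ℕ,
    ∑ w, f w = n → ∃ r, r ≠ 0 ∧ f + r ∈ D.Types (some v) := by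
  induction n with
  | zero =>
    intro f hf
    have : f = 0 := by
      funext w
      exact (Finset.sum_eq_zero_iff.1 hf) w (Finset.mem_univ w)
    subst this
    refine ⟨Pi.single v 1, ?_, by rw [zero_add]; exact single_mem_types v⟩
    intro h
    simpa using congrFun h v
  | succ n ih =>
    intro f hf
    obtain ⟨w, hw⟩ : ∃ w, f w ≠ 0 := by
      by_contra! h
      simp [h] at hf
    have hle : Pi.single w 1 ≤ f := single_le hw
    obtain ⟨f', rfl⟩ := exists_add_of_le hle
    have hf' : ∑ u, f' u = n := by
      simp only [Pi.add_apply, Finset.sum_add_distrib, Finset.sum_pi_single', Finset.mem_univ,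
        if_true] at hf
      omega
    obtain ⟨r, hr, hmem⟩ := ih f' hf'
    obtain ⟨u, hu⟩ : ∃ u, r u ≠ 0 := by
      by_contra! h
      exact hr (funext h)
    have hle : Pi.single u 1 ≤ r := single_le hu
    obtain ⟨r', rfl⟩ := exists_add_of_le hle
    obtain ⟨Q, hQ, a, ha, b, hb, hab, rfl⟩ := hD.mix u w
    have hQ' : tyv Q = Pi.single a.ty 1 + tyv (Q.erase a) := by
      rw [← tyv_singleton, ← tyv_union, Finset.singleton_union, Finset.insert_erase ha]
      simp
    have hb' : tyv (Q.erase a) ≠ 0 := by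
      intro h
      have := tyv_mono (A := {b}) (B := Q.erase a) (by simp [hb, hab.symm])
      rw [h, tyv_singleton] at this
      simpa using this b.ty
    have := hD.types_transfer (single_mem_types u) ⟨Q, hQ, rfl⟩ (r := f' + r') (by
      convert hmem using 1; abel)
    refine ⟨tyv (Q.erase a) + r', ?_, ?_⟩
    · intro h
      exact hb' (by
        funext i
        have := congrFun h i
        simp only [Pi.add_apply, Pi.zero_apply] at this ⊢
        omega)
    · convert this using 1
      rw [hQ']
      abel

/-- A partition containing a copy of a family of some finite collection of families of charts
partitioning a node space, away from a prescribed small set. -/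
theorem Good.exists_contractions (hD : D.Good) :
    ∃ Z : ∀ v, Set (Finset (D.Chart (some v))), (∀ v, (Z v).Finite) ∧
      (∀ v, ∀ Q ∈ Z v, IsPart Q ∧ 2 ≤ Q.card) ∧
      ∀ N, ∃ n₀, ∀ B : Finset (D.Chart none), IsPart B → n₀ ≤ B.card →
        ∀ F : Finset (D.Chart none), F.card ≤ N →
          ∃ φ : D.Chart none, ∃ Q ∈ Z φ.ty, Q.image φ.comp ⊆ B ∧ Disjoint (Q.image φ.comp) F := by
  let Y : Set (D.W → ℕ) := {y | y ≠ 0 ∧ ∃ f, f ∈ D.Types none ∧ f + y ∈ D.Types none}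
  have hY : ∀ y ∈ Y, ∀ v, Pi.single v 1 + y ∈ D.Types (some v) := by
    rintro y ⟨-, f, hf, hfy⟩ v
    obtain ⟨r, -, hr⟩ := hD.exists_add_mem_types v _ f rfl
    have h2 := hD.types_transfer hf hfy hr
    refine hD.types_transfer hr (single_mem_types v) (r := y) ?_
    convert h2 using 1
    abel
  obtain ⟨T, hTY, hT, hTle⟩ := exists_finite_minorants Y
  have hQ : ∀ v y, ∃ Q : Finset (D.Chart (some v)), y ∈ Y →
      IsPart Q ∧ tyv Q = Pi.single v 1 + y := by
    intro v y
    by_cases hy : y ∈ Y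
    · obtain ⟨Q, hQ⟩ := hY y hy v
      exact ⟨Q, fun _ => hQ⟩
    · exact ⟨∅, fun h => absurd h hy⟩
  choose Q hQ using hQ
  have hsum1 : ∀ v : D.W, ∑ w, (Pi.single v 1 : D.W → ℕ) w = 1 := fun v => by
    simp
  refine ⟨fun v => Q v '' T, fun v => hT.image _, ?_, fun N => ?_⟩
  · rintro v _ ⟨y, hy, rfl⟩
    obtain ⟨h1, h2⟩ := hQ v y (hTY hy)
    refine ⟨h1, ?_⟩
    rw [← sum_tyv, h2]
    simp only [Pi.add_apply, Finset.sum_add_distrib, hsum1]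
    have : ∑ w, y w ≠ 0 := by
      intro h
      exact (hTY hy).1 (funext fun w => (Finset.sum_eq_zero_iff.1 h) w (Finset.mem_univ w))
    omega
  · choose U hUsub hU hUle using fun f : D.W → ℕ =>
      exists_finite_minorants {d | f + d ∈ D.Types none}
    have hfin : {f : D.W → ℕ | ∑ w, f w ≤ N}.Finite := by
      refine (Set.finite_Iic (fun _ : D.W => N)).subset fun f hf w => ?_
      exact (Finset.single_le_sum (fun _ _ => Nat.zero_le _) (Finset.mem_univ w)).trans hf
    obtain ⟨b₁, hb₁⟩ := ((hfin.biUnion fun f _ => hU f).image fun d => ∑ w, d w).bddAbove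
    obtain ⟨b₂, hb₂⟩ := (hT.image fun d => ∑ w, d w).bddAbove
    refine ⟨N + b₁ + b₂ + 1, fun B hB hcard F hF => ?_⟩
    have hsplit : tyv (B ∩ F) + tyv (B \ F) = tyv B := by
      rw [← tyv_union (Finset.disjoint_sdiff_inter B F).symm, Finset.union_comm,
        Finset.sdiff_union_inter]
    have hfN : ∑ w, tyv (B ∩ F) w ≤ N := by
      rw [sum_tyv]
      exact (Finset.card_le_card Finset.inter_subset_right).trans hF
    have hd : b₁ + b₂ + 1 ≤ ∑ w, tyv (B \ F) w := by
      have := congrArg (fun f => ∑ w, f w) hsplit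
      simp only [Pi.add_apply, Finset.sum_add_distrib] at this
      rw [sum_tyv B] at this
      omega
    obtain ⟨d₀, hd₀, hle⟩ := hUle (tyv (B ∩ F)) (tyv (B \ F)) (by
      show _ + _ ∈ D.Types none
      rw [hsplit]
      exact ⟨B, hB, rfl⟩)
    have hd₀b : ∑ w, d₀ w ≤ b₁ := hb₁ ⟨d₀, Set.mem_biUnion hfN hd₀, rfl⟩
    obtain ⟨y, hy⟩ := exists_add_of_le hle
    have hyY : y ∈ Y := by
      refine ⟨?_, tyv (B ∩ F) + d₀, hUsub _ hd₀, ?_⟩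
      · rintro rfl
        rw [add_zero] at hy
        rw [hy] at hd
        omega
      · rw [add_assoc, ← hy, hsplit]
        exact ⟨B, hB, rfl⟩
    obtain ⟨y₀, hy₀, hle₀⟩ := hTle y hyY
    have hy₀b : ∑ w, y₀ w ≤ b₂ := hb₂ ⟨y₀, hy₀, rfl⟩
    have hle₁ : y₀ ≤ tyv (B \ F) := hle₀.trans (hy ▸ le_add_self)
    obtain ⟨v, hv⟩ : ∃ v, y₀ v < tyv (B \ F) v := by
      by_contra! h
      have := Finset.sum_le_sum fun w (_ : w ∈ Finset.univ) => h w
      omega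
    obtain ⟨hQp, hQt⟩ := hQ v y₀ (hTY hy₀)
    obtain ⟨τ, hτ, hτB⟩ := exists_embedding (A := Q v y₀) (C := B \ F) (by
      rw [hQt]
      intro w
      have := hle₁ w
      simp only [Pi.add_apply, Pi.single_apply]
      split_ifs with hw
      · subst hw; omega
      · simpa using this)
    obtain ⟨R, hR, hRτ, -⟩ := hD.exists_adm hQp τ (fun φ => (hτB φ).2) fun φ ψ p hp hp' =>
      hτ (hB.disj _ (Finset.sdiff_subset (hτB φ).1) _ (Finset.sdiff_subset (hτB ψ).1) p hp hp')
    have himg : (Q v y₀).image (hR.push (one v)).comp ⊆ B \ F := by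
      intro χ hχ
      obtain ⟨m, hm, rfl⟩ := Finset.mem_image.1 hχ
      have : (hR.push (one v)).comp m = τ ⟨m, hm⟩ := hRτ ⟨m, hm⟩
      rw [this]
      exact (hτB _).1
    exact ⟨hR.push (one v), Q v y₀, ⟨y₀, hy₀, rfl⟩, himg.trans Finset.sdiff_subset,
      Finset.sdiff_disjoint.mono_left himg⟩

end ChartData

section Walks

variable {α : Type*} {L : Type*} [Group L]

/-- `l` lists the successive vertices of a walk from `a` to `b`, the vertex `a` excluded. -/
def IsWalk (adj : α → α → Prop) : α → List α → α → Prop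
  | a, [], b => a = b
  | a, d :: l, b => adj a d ∧ IsWalk adj d l b

/-- The value of a walk. -/
def wval (c : α → α → L) : α → List α → L
  | _, [] => 1
  | a, d :: l => c a d * wval c d l

theorem IsWalk.append {adj : α → α → Prop} {l' : List α} {e : α} :
    ∀ {l : List α} {a b : α}, IsWalk adj a l b → IsWalk adj b l' e → IsWalk adj a (l ++ l') e
  | [], _, _, h, h' => by cases h; exact h'
  | _ :: _, _, _, h, h' => ⟨h.1, h.2.append h'⟩

theorem wval_append {adj : α → α → Prop} (c : α → α → L) {l' : List α} :
    ∀ {l : List α} {a b : α}, IsWalk adj a l b → wval c a (l ++ l') = wval c a l * wval c b l'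
  | [], _, _, h => by cases h; simp [wval]
  | _ :: _, _, _, h => by
    simp only [List.cons_append, wval, wval_append c h.2, mul_assoc]

theorem IsWalk.mono {adj adj' : α → α → Prop} (hadj : ∀ a b, adj a b → adj' a b) :
    ∀ {l : List α} {a b : α}, IsWalk adj a l b → IsWalk adj' a l b
  | [], _, _, h => h
  | _ :: _, _, _, h => ⟨hadj _ _ h.1, h.2.mono hadj⟩

theorem exists_isWalk {adj : α → α → Prop} {a b : α} (h : Relation.ReflTransGen adj a b) :
    ∃ l, IsWalk adj a l b := by
  induction h using Relation.ReflTransGen.head_induction_on with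
  | refl => exact ⟨[], rfl⟩
  | head h _ ih =>
    obtain ⟨l, hl⟩ := ih
    exact ⟨_ :: l, h, hl⟩

theorem IsWalk.reflTransGen {adj : α → α → Prop} :
    ∀ {l : List α} {a b : α}, IsWalk adj a l b → Relation.ReflTransGen adj a b
  | [], _, _, h => by cases h; exact .refl
  | _ :: _, _, _, h => .head h.1 h.2.reflTransGen

/-- All closed walks of length at most `K` have trivial value. -/
def TrivLoops (adj : α → α → Prop) (K : ℕ) (c : α → α → L) : Prop :=
  ∀ a l, l.length ≤ K → IsWalk adj a l a → wval c a l = 1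

namespace TrivLoops

variable {adj : α → α → Prop} {K : ℕ} {c : α → α → L}

theorem mono {adj' : α → α → Prop} (h : TrivLoops adj K c) (hadj : ∀ a b, adj' a b → adj a b) :
    TrivLoops adj' K c := fun a l hl hw => h a l hl (hw.mono hadj)

theorem self (h : TrivLoops adj K c) (hK : 4 ≤ K) {a : α} (ha : adj a a) : c a a = 1 := by
  simpa [wval] using h a [a] (by simp; omega) ⟨ha, rfl⟩

theorem symm (h : TrivLoops adj K c) (hK : 4 ≤ K) {a b : α} (hab : adj a b) (hba : adj b a) :
    c b a = (c a b)⁻¹ := by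
  have := h a [b, a] (by simp; omega) ⟨hab, hba, rfl⟩
  simp only [wval, mul_one] at this
  exact (inv_eq_of_mul_eq_one_right this).symm

theorem square (h : TrivLoops adj K c) (hK : 4 ≤ K) {a b b' d : α} (h1 : adj a b) (h2 : adj b d)
    (h3 : adj a b') (h4 : adj b' d) (h3' : adj b' a) (h4' : adj d b') :
    c a b * c b d = c a b' * c b' d := by
  have := h a [b, d, b', a] (by simpa using hK) ⟨h1, h2, h4', h3', rfl⟩
  simp only [wval, mul_one] at this
  rw [h.symm hK h4 h4', h.symm hK h3 h3', ← mul_assoc, ← mul_inv_rev, mul_inv_eq_one] at this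
  exact this

end TrivLoops

/-- A cocycle on a flag complex in which any four vertices have a common neighbour
is a coboundary. -/
theorem exists_potential_of_flag (perp : α → α → Prop) (hsymm : ∀ a b, perp a b → perp b a)
    (w : α → α → L) (htri : ∀ a b d, perp a b → perp b d → perp a d → w a b * w b d = w a d)
    (hinv : ∀ a b, perp a b → w a b * w b a = 1)
    (hcomm : ∀ a b d e, ∃ f, perp f a ∧ perp f b ∧ perp f d ∧ perp f e) :
    ∃ p : α → L, ∀ a b, perp a b → p a * w a b = p b := by
  rcases isEmpty_or_nonempty α with h | ⟨⟨a₀⟩⟩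
  · exact ⟨fun _ => 1, fun a => h.elim a⟩
  have hd : ∀ a, ∃ d, perp d a₀ ∧ perp d a := fun a => by
    obtain ⟨f, h1, h2, -, -⟩ := hcomm a₀ a a a
    exact ⟨f, h1, h2⟩
  choose d hd0 hda using hd
  have hind : ∀ a d d', perp d a₀ → perp d a → perp d' a₀ → perp d' a →
      w a₀ d * w d a = w a₀ d' * w d' a := by
    intro a d d' h1 h2 h1' h2'
    obtain ⟨e, he, hea, hed, hed'⟩ := hcomm a₀ a d d'
    have key : ∀ d, perp d a₀ → perp d a → perp e d → w a₀ d * w d a = w a₀ e * w e a := by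
      intro d h1 h2 hed
      rw [← htri a₀ e d (hsymm _ _ he) hed (hsymm _ _ h1),
        ← htri d e a (hsymm _ _ hed) hea h2, mul_assoc, ← mul_assoc (w e d), hinv _ _ hed, one_mul]
    rw [key d h1 h2 hed, key d' h1' h2' hed']
  refine ⟨fun a => w a₀ (d a) * w (d a) a, fun a b hab => ?_⟩
  obtain ⟨e, he, hea, heb, -⟩ := hcomm a₀ a b b
  show w a₀ (d a) * w (d a) a * w a b = w a₀ (d b) * w (d b) b
  rw [hind a (d a) e (hd0 a) (hda a) he hea, hind b (d b) e (hd0 b) (hda b) he heb, mul_assoc,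
    htri e a b hea hab heb]

end Walks

namespace ChartData

open Chart

variable {D : ChartData} {x : Option D.W}

/-- An elementary move: restricting one chart along a partition with charts in `M`. -/
def Mv (M : ∀ v, Set (D.Chart (some v))) (A B : Finset (D.Chart x)) : Prop :=
  ∃ R θ P, Ctx R θ ∧ IsPart P ∧ (∀ m ∈ P, m ∈ M θ.ty) ∧ A = insert θ R ∧ B = plug R θ P

/-- Partitions which are equal or differ by an elementary move. -/
def Adj (M : ∀ v, Set (D.Chart (some v))) (A B : Finset (D.Chart x)) : Prop :=
  IsPart A ∧ IsPart B ∧ (A = B ∨ Mv M A B ∨ Mv M B A)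

variable {M : ∀ v, Set (D.Chart (some v))}

theorem Adj.symm {A B : Finset (D.Chart x)} (h : Adj M A B) : Adj M B A :=
  ⟨h.2.1, h.1, by rcases h.2.2 with h | h | h <;> simp [h]⟩

theorem IsPart.adj {A : Finset (D.Chart x)} (h : IsPart A) : Adj M A A := ⟨h, h, Or.inl rfl⟩

theorem Mv.adj {A B : Finset (D.Chart x)} (h : Mv M A B) : Adj M A B := by
  refine ⟨?_, ?_, Or.inr (Or.inl h)⟩
  · obtain ⟨R, θ, P, hR, -, -, rfl, rfl⟩ := h
    exact hR.1
  · obtain ⟨R, θ, P, hR, hP, -, rfl, rfl⟩ := h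
    exact hR.isPart_plug hP

theorem Ctx.mv {R : Finset (D.Chart x)} {θ : D.Chart x} (h : Ctx R θ)
    {P : Finset (D.Chart (some θ.ty))} (hP : IsPart P) (hM : ∀ m ∈ P, m ∈ M θ.ty) :
    Mv M (insert θ R) (ChartData.plug R θ P) := ⟨R, θ, P, h, hP, hM, rfl, rfl⟩

theorem mv_expand (hM : ∀ v (e : D.Ed v), edge e ∈ M v) {B : Finset (D.Chart x)} (hB : IsPart B)
    {φ : D.Chart x} (h : φ ∈ B) : Mv M B (expand B φ) := by
  have := (ctx_erase hB h).mv (M := M) (isPart_edges φ.ty) fun m hm => by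
    obtain ⟨e, rfl⟩ := mem_edges.1 hm
    exact hM _ e
  rwa [Finset.insert_erase h] at this

/-- A place where a partition can be coarsened: a chart together with a partition of its source. -/
abbrev Con (D : ChartData) (x : Option D.W) := Σ φ : D.Chart x, Finset (D.Chart (some φ.ty))

/-- The charts to be merged. -/
def Con.supp (κ : D.Con x) : Finset (D.Chart x) := κ.2.image κ.1.comp

/-- The coarsened partition. -/
def Con.app (κ : D.Con x) (B : Finset (D.Chart x)) : Finset (D.Chart x) :=
  insert κ.1 (B \ κ.supp)

/-- The conditions under which a partition can be coarsened along `κ`. -/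
structure Con.Valid (κ : D.Con x) (B : Finset (D.Chart x)) : Prop where
  part : IsPart κ.2
  two_le : 2 ≤ κ.2.card
  sub : κ.supp ⊆ B

theorem Con.mem_supp {κ : D.Con x} {χ : D.Chart x} : χ ∈ κ.supp ↔ ∃ m ∈ κ.2, κ.1.comp m = χ :=
  Finset.mem_image

namespace Con.Valid

variable {κ κ' : D.Con x} {B A : Finset (D.Chart x)}

theorem notMem (h : κ.Valid B) (hB : IsPart B) : κ.1 ∉ B := by
  intro hφ
  obtain ⟨a, ha, b, hb, hab⟩ := Finset.one_lt_card.1 h.two_le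
  have key : ∀ m ∈ κ.2, κ.1.comp m = κ.1 := fun m hm =>
    hB.eq_of_img_subset (h.sub (Con.mem_supp.2 ⟨m, hm, rfl⟩)) hφ (img_comp_subset _ _)
  exact hab (κ.1.comp_injective ((key a ha).trans (key b hb).symm))

theorem isPart (h : κ.Valid B) (hB : IsPart B) : IsPart (κ.app B) := by
  have himg : ∀ p, p ∈ κ.1.img → ∃ χ ∈ κ.supp, p ∈ χ.img := by
    rintro _ ⟨q, rfl⟩
    obtain ⟨m, hm, y, rfl⟩ := h.part.cover q
    exact ⟨_, Con.mem_supp.2 ⟨m, hm, rfl⟩, y, rfl⟩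
  have hdis : ∀ χ ∈ B \ κ.supp, ∀ p ∈ χ.img, p ∉ κ.1.img := by
    intro χ hχ p hp hp'
    obtain ⟨ψ, hψ, hp''⟩ := himg p hp'
    obtain ⟨h1, h2⟩ := Finset.mem_sdiff.1 hχ
    exact h2 (hB.disj χ h1 ψ (h.sub hψ) p hp hp'' ▸ hψ)
  refine ⟨fun p => ?_, ?_⟩
  · obtain ⟨χ, hχ, hp⟩ := hB.cover p
    by_cases hs : χ ∈ κ.supp
    · obtain ⟨m, -, rfl⟩ := Con.mem_supp.1 hs
      exact ⟨κ.1, Finset.mem_insert_self _ _, img_comp_subset _ _ hp⟩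
    · exact ⟨χ, Finset.mem_insert_of_mem (Finset.mem_sdiff.2 ⟨hχ, hs⟩), hp⟩
  · intro φ hφ ψ hψ p hp hp'
    rcases Finset.mem_insert.1 hφ with rfl | h1 <;> rcases Finset.mem_insert.1 hψ with rfl | h2
    · rfl
    · exact absurd hp (hdis ψ h2 p hp')
    · exact absurd hp' (hdis φ h1 p hp)
    · exact hB.disj φ (Finset.sdiff_subset h1) ψ (Finset.sdiff_subset h2) p hp hp'

theorem ctx (h : κ.Valid B) (hB : IsPart B) : Ctx (B \ κ.supp) κ.1 :=
  ⟨h.isPart hB, fun h' => h.notMem hB (Finset.sdiff_subset h')⟩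

theorem plug_eq (h : κ.Valid B) : plug (B \ κ.supp) κ.1 κ.2 = B :=
  Finset.sdiff_union_of_subset h.sub

theorem card_supp : κ.supp.card = κ.2.card := Finset.card_image_of_injective _ κ.1.comp_injective

theorem card_lt (h : κ.Valid B) (hB : IsPart B) : (κ.app B).card < B.card := by
  rw [Con.app, Finset.card_insert_of_notMem (h.ctx hB).2, Finset.card_sdiff_of_subset h.sub,
    card_supp]
  have := h.two_le
  have := Finset.card_le_card h.sub
  rw [card_supp] at this
  omega

theorem adj (h : κ.Valid B) (hB : IsPart B) (hM : ∀ m ∈ κ.2, m ∈ M κ.1.ty) :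
    Adj M B (κ.app B) := by
  have := ((h.ctx hB).mv (M := M) h.part hM).adj.symm
  rwa [h.plug_eq] at this

theorem notMem_supp (_h : κ.Valid B) (h' : κ'.Valid B) (hB : IsPart B) : κ.1 ∉ κ'.supp :=
  fun hm => _h.notMem hB (h'.sub hm)

theorem app (_h : κ.Valid B) (h' : κ'.Valid B) (hd : Disjoint κ.supp κ'.supp) :
    κ'.Valid (κ.app B) := by
  refine ⟨h'.part, h'.two_le, fun χ hχ => Finset.mem_insert_of_mem (Finset.mem_sdiff.2
    ⟨h'.sub hχ, fun hm => Finset.disjoint_left.1 hd hm hχ⟩)⟩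

theorem app_comm (h : κ.Valid B) (h' : κ'.Valid B) (hB : IsPart B) :
    κ'.app (κ.app B) = κ.app (κ'.app B) := by
  have h1 := h.notMem_supp h' hB
  have h2 := h'.notMem_supp h hB
  ext χ
  simp only [Con.app, Finset.mem_insert, Finset.mem_sdiff]
  constructor
  · rintro (rfl | ⟨rfl | ⟨h3, h4⟩, h5⟩)
    · exact Or.inr ⟨Or.inl rfl, h2⟩
    · exact Or.inl rfl
    · exact Or.inr ⟨Or.inr ⟨h3, h5⟩, h4⟩
  · rintro (rfl | ⟨rfl | ⟨h3, h4⟩, h5⟩)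
    · exact Or.inr ⟨Or.inl rfl, h1⟩
    · exact Or.inl rfl
    · exact Or.inr ⟨Or.inr ⟨h3, h5⟩, h4⟩

theorem adj_app (hA : κ.Valid A) (hB : κ.Valid B) (h : Adj M A B) :
    Adj M (κ.app A) (κ.app B) := by
  have key : ∀ A B : Finset (D.Chart x), κ.Valid A → κ.Valid B → IsPart A → IsPart B →
      Mv M A B → A ≠ B → Mv M (κ.app A) (κ.app B) := by
    rintro A B hA hB hA' hB' ⟨R, θ, P, hR, hP, hM, rfl, rfl⟩ hne
    have hθ : θ ∉ plug R θ P := by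
      intro hθ
      rcases mem_plug.1 hθ with h | ⟨m, hm, e⟩
      · exact hR.2 h
      · refine hne (IsPart.eq_of_subset hA' hB' (Finset.insert_subset hθ ?_))
        exact fun χ hχ => mem_plug.2 (Or.inl hχ)
    have hθs : θ ∉ κ.supp := fun h => hθ (hB.sub h)
    have e1 : κ.app (insert θ R) = insert θ (insert κ.1 (R \ κ.supp)) := by
      rw [Con.app, Finset.insert_sdiff_of_notMem _ hθs, Finset.insert_comm]
    have hcs : ∀ m, θ.comp m ∉ κ.supp := by
      intro m hm
      rcases Finset.mem_insert.1 (hA.sub hm) with h | h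
      · exact hθs (h ▸ hm)
      · exact hR.comp_notMem m h
    have e2 : κ.app (plug R θ P) = plug (insert κ.1 (R \ κ.supp)) θ P := by
      ext χ
      simp only [Con.app, Finset.mem_insert, Finset.mem_sdiff, mem_plug]
      constructor
      · rintro (h | ⟨h | ⟨m, hm, rfl⟩, h2⟩)
        · exact Or.inl (Or.inl h)
        · exact Or.inl (Or.inr ⟨h, h2⟩)
        · exact Or.inr ⟨m, hm, rfl⟩
      · rintro ((h | ⟨h, h2⟩) | ⟨m, hm, rfl⟩)
        · exact Or.inl h
        · exact Or.inr ⟨Or.inl h, h2⟩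
        · exact Or.inr ⟨Or.inr ⟨m, hm, rfl⟩, hcs m⟩
    refine ⟨_, θ, P, ⟨?_, ?_⟩, hP, hM, e1, e2⟩
    · rw [← e1]
      exact hA.isPart hA'
    · intro h
      rcases Finset.mem_insert.1 h with h | h
      · exact hA.notMem hA' (h ▸ Finset.mem_insert_self _ _)
      · exact hR.2 (Finset.sdiff_subset h)
  refine ⟨hA.isPart h.1, hB.isPart h.2.1, ?_⟩
  by_cases e : A = B
  · exact Or.inl (e ▸ rfl)
  · rcases h.2.2 with h' | h' | h'
    · exact absurd h' e
    · exact Or.inr (Or.inl (key A B hA hB h.1 h.2.1 h' e))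
    · exact Or.inr (Or.inr (key B A hB hA h.2.1 h.1 h' (Ne.symm e)))

end Con.Valid

end ChartData

section Walks

variable {α : Type*} {L : Type*} [Group L]

theorem wval_congr {adj : α → α → Prop} {c c' : α → α → L} (h : ∀ a b, adj a b → c a b = c' a b) :
    ∀ {l : List α} {a b : α}, IsWalk adj a l b → wval c a l = wval c' a l
  | [], _, _, _ => rfl
  | _ :: _, _, _, hw => by simp only [wval, h _ _ hw.1, wval_congr h hw.2]

end Walks

namespace ChartData

variable {D : ChartData} {x : Option D.W}

/-- A supply of places where large partitions can be coarsened. -/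
structure ConSys (M : ∀ v, Set (D.Chart (some v))) (Z : ∀ v, Set (Finset (D.Chart (some v))))
    (s N n₁ : ℕ) : Prop where
  adm : ∀ v, ∀ Q ∈ Z v, IsPart Q ∧ 2 ≤ Q.card ∧ ∀ m ∈ Q, m ∈ M v
  bound : ∀ v (P : Finset (D.Chart (some v))), IsPart P → (∀ m ∈ P, m ∈ M v) → P.card ≤ s
  supply : ∀ B : Finset (D.Chart none), IsPart B → n₁ ≤ B.card →
    ∀ F : Finset (D.Chart none), F.card ≤ N →
      ∃ κ : D.Con none, κ.2 ∈ Z κ.1.ty ∧ κ.supp ⊆ B ∧ Disjoint κ.supp F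

/-- Adjacency of partitions of bounded size. -/
def AdjLe (M : ∀ v, Set (D.Chart (some v))) (n : ℕ) (A B : Finset (D.Chart x)) : Prop :=
  Adj M A B ∧ A.card ≤ n ∧ B.card ≤ n

theorem AdjLe.mono {M : ∀ v, Set (D.Chart (some v))} {n k : ℕ} (h : n ≤ k)
    {A B : Finset (D.Chart x)} (hA : AdjLe M n A B) : AdjLe M k A B :=
  ⟨hA.1, hA.2.1.trans h, hA.2.2.trans h⟩

theorem AdjLe.symm {M : ∀ v, Set (D.Chart (some v))} {n : ℕ} {A B : Finset (D.Chart x)}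
    (h : AdjLe M n A B) : AdjLe M n B A := ⟨h.1.symm, h.2.2, h.2.1⟩

theorem _root_.IsWalk.exists_adjLe {M : ∀ v, Set (D.Chart (some v))} (n : ℕ) :
    ∀ {l : List (Finset (D.Chart x))} {A B}, IsWalk (Adj M) A l B →
      ∃ k, IsWalk (AdjLe M (n + k)) A l B
  | [], _, _, h => ⟨0, h⟩
  | C :: l, A, B, h => by
    obtain ⟨k, hk⟩ := h.2.exists_adjLe n
    exact ⟨k + A.card + C.card, ⟨h.1, by omega, by omega⟩,
      hk.mono fun _ _ h => h.mono (by omega)⟩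

/-- `κ` is a contraction from the supply `Z` which applies to `B`. -/
def Fits (Z : ∀ v, Set (Finset (D.Chart (some v)))) (κ : D.Con x) (B : Finset (D.Chart x)) : Prop :=
  κ.2 ∈ Z κ.1.ty ∧ κ.supp ⊆ B

namespace ConSys

variable {M : ∀ v, Set (D.Chart (some v))} {Z : ∀ v, Set (Finset (D.Chart (some v)))}
  {s N n₁ : ℕ}

theorem valid (S : ConSys M Z s N n₁)
    {κ : D.Con x} {B : Finset (D.Chart x)} (h : Fits Z κ B) : κ.Valid B :=
  ⟨(S.adm _ _ h.1).1, (S.adm _ _ h.1).2.1, h.2⟩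

theorem adj (S : ConSys M Z s N n₁)
    {κ : D.Con x} {B : Finset (D.Chart x)} (h : Fits Z κ B) (hB : IsPart B) :
    Adj M B (κ.app B) := (S.valid h).adj hB (S.adm _ _ h.1).2.2

theorem card_supp_le (S : ConSys M Z s N n₁)
    {κ : D.Con x} {B : Finset (D.Chart x)} (h : Fits Z κ B) :
    κ.supp.card ≤ s := by
  rw [Con.Valid.card_supp]
  exact S.bound _ _ (S.adm _ _ h.1).1 (S.adm _ _ h.1).2.2

theorem fits_app (S : ConSys M Z s N n₁)
    {κ κ' : D.Con x} {B : Finset (D.Chart x)} (h : Fits Z κ B) (h' : Fits Z κ' B)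
    (hd : Disjoint κ.supp κ'.supp) : Fits Z κ' (κ.app B) :=
  ⟨h'.1, ((S.valid h).app (S.valid h') hd).sub⟩

theorem card_sdiff_le (S : ConSys M Z s N n₁)
    (hs : 1 ≤ s) {A B : Finset (D.Chart x)} (h : Adj M A B) :
    (A \ B).card ≤ s ∧ B.card ≤ A.card + s := by
  obtain ⟨-, -, rfl | ⟨R, θ, P, hR, hP, hM, rfl, rfl⟩ | ⟨R, θ, P, hR, hP, hM, rfl, rfl⟩⟩ := h
  · simp
  · have hP' := S.bound _ P hP hM
    rw [hR.card_plug, Finset.card_insert_of_notMem hR.2]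
    refine ⟨?_, by omega⟩
    have : insert θ R \ plug R θ P ⊆ {θ} := by
      intro χ hχ
      obtain ⟨h1, h2⟩ := Finset.mem_sdiff.1 hχ
      rcases Finset.mem_insert.1 h1 with rfl | h1
      · simp
      · exact absurd (mem_plug.2 (Or.inl h1)) h2
    exact (Finset.card_le_card this).trans (by simpa using hs)
  · have hP' := S.bound _ P hP hM
    rw [hR.card_plug, Finset.card_insert_of_notMem hR.2]
    refine ⟨?_, by omega⟩
    have : plug R θ P \ insert θ R ⊆ P.image θ.comp := by
      intro χ hχ
      obtain ⟨h1, h2⟩ := Finset.mem_sdiff.1 hχ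
      rcases Finset.mem_union.1 h1 with h1 | h1
      · exact absurd (Finset.mem_insert_of_mem h1) h2
      · exact h1
    exact (Finset.card_le_card this).trans (Finset.card_image_le.trans hP')

section Extend

variable {K n : ℕ} {L : Type*} [Group L] {c : Finset (D.Chart none) → Finset (D.Chart none) → L}

/-- The values of a cocycle on the contractions of a partition. -/
structure _root_.ChartData.IsPot (Z : ∀ v, Set (Finset (D.Chart (some v)))) (n : ℕ)
    (c : Finset (D.Chart none) → Finset (D.Chart none) → L)
    (B : Finset (D.Chart none)) (p : D.Con none → L) : Prop where
  comm : ∀ κ κ', Fits Z κ B → Fits Z κ' B → Disjoint κ.supp κ'.supp →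
    p κ * c (κ.app B) (κ'.app (κ.app B)) = p κ' * c (κ'.app B) (κ'.app (κ.app B))
  eq : B.card ≤ n → ∀ κ, Fits Z κ B → p κ = c B (κ.app B)

theorem _root_.ChartData.Adj.le {A B : Finset (D.Chart x)} (h : Adj M A B) (hA : A.card ≤ n)
    (hB : B.card ≤ n) : AdjLe M n A B := ⟨h, hA, hB⟩

theorem adjLe (S : ConSys M Z s N n₁)
    {κ : D.Con none} {B : Finset (D.Chart none)} (h : Fits Z κ B) (hB : IsPart B)
    (hn : B.card ≤ n) : AdjLe M n B (κ.app B) ∧ AdjLe M n (κ.app B) B :=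
  have := ((S.valid h).card_lt hB).le.trans hn
  ⟨(S.adj h hB).le hn this, (S.adj h hB).symm.le this hn⟩

theorem square (S : ConSys M Z s N n₁)
    (hK : 4 ≤ K) (hc : TrivLoops (AdjLe M n) K c) {κ κ' : D.Con none}
    {B : Finset (D.Chart none)} (h : Fits Z κ B) (h' : Fits Z κ' B)
    (hd : Disjoint κ.supp κ'.supp) (hB : IsPart B) (hn : B.card ≤ n) :
    c B (κ.app B) * c (κ.app B) (κ'.app (κ.app B)) =
      c B (κ'.app B) * c (κ'.app B) (κ'.app (κ.app B)) := by
  have e := (S.valid h).app_comm (S.valid h') hB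
  have h1 := S.adjLe h hB hn
  have h2 := S.adjLe h' hB hn
  have h3 := S.adjLe (S.fits_app h h' hd) h1.1.1.2.1 h1.1.2.2
  have h4 := S.adjLe (S.fits_app h' h hd.symm) h2.1.1.2.1 h2.1.2.2
  rw [← e] at h4
  exact hc.square hK h1.1 h3.1 h2.1 h4.1 h2.2 h4.2

theorem exists_isPot (S : ConSys M Z s N n₁) (hK : 4 ≤ K) (hN : 4 * s ≤ N) (hn : n₁ ≤ n)
    (hc : TrivLoops (AdjLe M n) K c) {B : Finset (D.Chart none)} (hB : IsPart B)
    (hBn : B.card ≤ n + 1) : ∃ p, IsPot Z n c B p := by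
  by_cases hle : B.card ≤ n
  · exact ⟨fun κ => c B (κ.app B), fun κ κ' h h' hd => S.square hK hc h h' hd hB hle,
      fun _ _ _ => rfl⟩
  let α := {κ : D.Con none // Fits Z κ B}
  let w : α → α → L := fun κ κ' =>
    c (κ.1.app B) (κ'.1.app (κ.1.app B)) * (c (κ'.1.app B) (κ'.1.app (κ.1.app B)))⁻¹
  have hcard : ∀ κ : α, IsPart (κ.1.app B) ∧ (κ.1.app B).card ≤ n := fun κ =>
    ⟨(S.valid κ.2).isPart hB, by have := (S.valid κ.2).card_lt hB; omega⟩
  have hcm : ∀ κ κ' : α, κ'.1.app (κ.1.app B) = κ.1.app (κ'.1.app B) := fun κ κ' =>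
    (S.valid κ.2).app_comm (S.valid κ'.2) hB
  suffices h : ∃ p : α → L, ∀ κ κ' : α, Disjoint κ.1.supp κ'.1.supp → p κ * w κ κ' = p κ' by
    obtain ⟨p, hp⟩ := h
    refine ⟨fun κ => if h : Fits Z κ B then p ⟨κ, h⟩ else 1, fun κ κ' h h' hd => ?_,
      fun h => absurd h hle⟩
    have := hp ⟨κ, h⟩ ⟨κ', h'⟩ hd
    simp only [w] at this
    rw [dif_pos h, dif_pos h', ← this]
    simp [mul_assoc]
  refine exists_potential_of_flag (fun κ κ' : α => Disjoint κ.1.supp κ'.1.supp)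
    (fun _ _ h => h.symm) w ?_ ?_ ?_
  · intro a b d hab hbd had
    have fab := S.fits_app a.2 b.2 hab
    have fad := S.fits_app a.2 d.2 had
    have fba := S.fits_app b.2 a.2 hab.symm
    have fbd := S.fits_app b.2 d.2 hbd
    have fda := S.fits_app d.2 a.2 had.symm
    have fdb := S.fits_app d.2 b.2 hbd.symm
    have s1 := S.square hK hc fab fad hbd (hcard a).1 (hcard a).2
    have s2 := S.square hK hc fba fbd had (hcard b).1 (hcard b).2
    have s3 := S.square hK hc fda fdb hab (hcard d).1 (hcard d).2
    have e1 := (S.valid fab).app_comm (S.valid fad) (hcard a).1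
    have e2 := (S.valid fba).app_comm (S.valid fbd) (hcard b).1
    have e3 := (S.valid fda).app_comm (S.valid fdb) (hcard d).1
    simp only [w]
    rw [hcm b a] at s2 e2
    rw [hcm d a, hcm d b] at s3 e3
    rw [e3] at e1 s3
    rw [e1] at s1 s2
    rw [eq_mul_inv_of_mul_eq s1, eq_mul_inv_of_mul_eq s2, eq_mul_inv_of_mul_eq s3]
    group
  · intro a b _
    simp only [w]
    rw [hcm b a]
    group
  · intro a b d e
    obtain ⟨κ, h1, h2, h3⟩ := S.supply B hB (by omega)
      (a.1.supp ∪ b.1.supp ∪ d.1.supp ∪ e.1.supp) (by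
        have := S.card_supp_le a.2
        have := S.card_supp_le b.2
        have := S.card_supp_le d.2
        have := S.card_supp_le e.2
        have := Finset.card_union_le (a.1.supp ∪ b.1.supp ∪ d.1.supp) e.1.supp
        have := Finset.card_union_le (a.1.supp ∪ b.1.supp) d.1.supp
        have := Finset.card_union_le a.1.supp b.1.supp
        omega)
    simp only [Finset.disjoint_union_right] at h3
    exact ⟨⟨κ, h1, h2⟩, h3.1.1.1, h3.1.1.2, h3.1.2, h3.2⟩

theorem exists_third (S : ConSys M Z s N n₁) (hN : 4 * s ≤ N) (hs : 1 ≤ s) {κ₁ κ₂ : D.Con none}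
    {A B : Finset (D.Chart none)} (hAB : Adj M A B) (hA : n₁ ≤ A.card) (h₁ : Fits Z κ₁ A)
    (h₂ : Fits Z κ₂ A) : ∃ κ : D.Con none, Fits Z κ A ∧ Fits Z κ B ∧
      Disjoint κ.supp κ₁.supp ∧ Disjoint κ.supp κ₂.supp := by
  obtain ⟨κ, h1, h2, h3⟩ := S.supply A hAB.1 hA (κ₁.supp ∪ κ₂.supp ∪ A \ B) (by
    have := S.card_supp_le h₁
    have := S.card_supp_le h₂
    have := (S.card_sdiff_le hs hAB).1
    have := Finset.card_union_le (κ₁.supp ∪ κ₂.supp) (A \ B)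
    have := Finset.card_union_le κ₁.supp κ₂.supp
    omega)
  simp only [Finset.disjoint_union_right] at h3
  refine ⟨κ, ⟨h1, h2⟩, ⟨h1, fun χ hχ => ?_⟩, h3.1.1, h3.1.2⟩
  by_contra hB
  exact Finset.disjoint_left.1 h3.2 hχ (Finset.mem_sdiff.2 ⟨h2 hχ, hB⟩)

theorem exists_edge_value (S : ConSys M Z s N n₁)
    (hK : 4 ≤ K) (hs : 1 ≤ s) (hN : 4 * s ≤ N) (hn : n₁ + s ≤ n + 1)
    (hc : TrivLoops (AdjLe M n) K c) {A B : Finset (D.Chart none)} (hAB : AdjLe M (n + 1) A B)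
    {pA pB : D.Con none → L} (hpA : IsPot Z n c A pA) (hpB : IsPot Z n c B pB) :
    ∃ g : L, (A.card ≤ n → B.card ≤ n → g = c A B) ∧ ∀ κ, Fits Z κ A → Fits Z κ B →
      g = pA κ * c (κ.app A) (κ.app B) * (pB κ)⁻¹ := by
  obtain ⟨hadj, hA, hB⟩ := hAB
  have hle : ∀ {κ : D.Con none} {B : Finset (D.Chart none)}, Fits Z κ B → IsPart B →
      B.card ≤ n + 1 → (κ.app B).card ≤ n := fun h hB hB' => by
    have := (S.valid h).card_lt hB; omega
  by_cases hAB' : A.card ≤ n ∧ B.card ≤ n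
  · refine ⟨c A B, fun _ _ => rfl, fun κ h h' => ?_⟩
    rw [hpA.eq hAB'.1 κ h, hpB.eq hAB'.2 κ h', eq_mul_inv_iff_mul_eq]
    have h1 := S.adjLe h hadj.1 hAB'.1
    have h2 := S.adjLe h' hadj.2.1 hAB'.2
    have h3 := (S.valid h).adj_app (S.valid h') hadj
    exact hc.square hK (hadj.le hAB'.1 hAB'.2) h2.1 h1.1 (h3.le h1.1.2.2 h2.1.2.2) h1.2
      (h3.le h1.1.2.2 h2.1.2.2).symm
  have hdisj : ∀ κ₁ κ₂ : D.Con none, Fits Z κ₁ A → Fits Z κ₁ B → Fits Z κ₂ A → Fits Z κ₂ B →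
      Disjoint κ₁.supp κ₂.supp → pA κ₁ * c (κ₁.app A) (κ₁.app B) * (pB κ₁)⁻¹ =
        pA κ₂ * c (κ₂.app A) (κ₂.app B) * (pB κ₂)⁻¹ := by
    have key : ∀ κ₁ κ₂ : D.Con none, Fits Z κ₁ A → Fits Z κ₁ B → Fits Z κ₂ A → Fits Z κ₂ B →
        Disjoint κ₁.supp κ₂.supp → pA κ₁ * c (κ₁.app A) (κ₁.app B) * (pB κ₁)⁻¹ =
          (pA κ₁ * c (κ₁.app A) (κ₂.app (κ₁.app A))) *
            c (κ₂.app (κ₁.app A)) (κ₂.app (κ₁.app B)) *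
            (pB κ₁ * c (κ₁.app B) (κ₂.app (κ₁.app B)))⁻¹ := by
      intro κ₁ κ₂ h1A h1B h2A h2B hd
      have f1 := S.fits_app h1A h2A hd
      have f2 := S.fits_app h1B h2B hd
      have a1 := (S.valid h1A).adj_app (S.valid h1B) hadj
      have a2 := (S.valid f1).adj_app (S.valid f2) a1
      have b1 := S.adjLe f1 a1.1 (hle h1A hadj.1 hA)
      have b2 := S.adjLe f2 a1.2.1 (hle h1B hadj.2.1 hB)
      have := hc.square hK (a1.le b1.1.2.1 b2.1.2.1) b2.1 b1.1 (a2.le b1.1.2.2 b2.1.2.2) b1.2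
        (a2.le b1.1.2.2 b2.1.2.2).symm
      rw [eq_mul_inv_of_mul_eq this]
      group
    intro κ₁ κ₂ h1A h1B h2A h2B hd
    rw [key κ₁ κ₂ h1A h1B h2A h2B hd, key κ₂ κ₁ h2A h2B h1A h1B hd.symm,
      hpA.comm κ₁ κ₂ h1A h2A hd, hpB.comm κ₁ κ₂ h1B h2B hd,
      (S.valid h1A).app_comm (S.valid h2A) hadj.1, (S.valid h1B).app_comm (S.valid h2B) hadj.2.1]
  by_cases hex : ∃ κ : D.Con none, Fits Z κ A ∧ Fits Z κ B
  · obtain ⟨κ₀, h0A, h0B⟩ := hex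
    refine ⟨pA κ₀ * c (κ₀.app A) (κ₀.app B) * (pB κ₀)⁻¹, fun h h' => absurd ⟨h, h'⟩ hAB',
      fun κ hA' hB' => ?_⟩
    have hcard : n₁ ≤ A.card := by
      have := (S.card_sdiff_le hs hadj).2
      have := (S.card_sdiff_le hs hadj.symm).2
      omega
    obtain ⟨κ', h3A, h3B, hd, hd'⟩ := S.exists_third hN hs hadj hcard h0A hA'
    rw [← hdisj κ' κ₀ h3A h3B h0A h0B hd, ← hdisj κ' κ h3A h3B hA' hB' hd']
  · exact ⟨1, fun h h' => absurd ⟨h, h'⟩ hAB', fun κ hA' hB' => absurd ⟨κ, hA', hB'⟩ hex⟩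

theorem exists_common (S : ConSys M Z s N n₁) (hs : 1 ≤ s) : ∀ {l : List (Finset (D.Chart none))}
    {A B : Finset (D.Chart none)}, IsWalk (Adj M) A l B →
    (∀ C ∈ l, C.card ≤ A.card + l.length * s ∧ A.card ≤ C.card + l.length * s) ∧
    ∃ F : Finset (D.Chart none), F.card ≤ l.length * s ∧
      ∀ T ⊆ A, Disjoint T F → ∀ C ∈ l, T ⊆ C
  | [], A, B, _ => ⟨by simp, ∅, by simp⟩
  | C :: l, A, B, h => by
    obtain ⟨h1, F, h2, h3⟩ := exists_common S hs h.2
    have h4 := S.card_sdiff_le hs h.1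
    have h5 := S.card_sdiff_le hs h.1.symm
    have h6 : (C :: l).length * s = l.length * s + s := by rw [List.length_cons, Nat.succ_mul]
    refine ⟨fun C' hC' => ?_, A \ C ∪ F, ?_, fun T hT hd C' hC' => ?_⟩
    · rcases List.mem_cons.1 hC' with rfl | hC'
      · omega
      · have := h1 C' hC'
        omega
    · have := Finset.card_union_le (A \ C) F
      omega
    · rw [Finset.disjoint_union_right] at hd
      have hTC : T ⊆ C := fun χ hχ => by
        by_contra hC
        exact Finset.disjoint_left.1 hd.1 hχ (Finset.mem_sdiff.2 ⟨hT hχ, hC⟩)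
      rcases List.mem_cons.1 hC' with rfl | hC'
      · exact hTC
      · exact h3 T hTC hd.2 C' hC'

theorem exists_extend_succ (S : ConSys M Z s N n₁)
    (hK : 4 ≤ K) (hs : 1 ≤ s) (hN : K * s ≤ N) (hn : n₁ + K * s ≤ n + 1)
    (hc : TrivLoops (AdjLe M n) K c) : ∃ c' : Finset (D.Chart none) → Finset (D.Chart none) → L,
      TrivLoops (AdjLe M (n + 1)) K c' ∧
      ∀ A B, AdjLe M n A B → c' A B = c A B := by
  have hN' : 4 * s ≤ N := (Nat.mul_le_mul_right s hK).trans hN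
  have hKs : 4 * s ≤ K * s := Nat.mul_le_mul_right s hK
  have hp : ∀ B : Finset (D.Chart none), ∃ p, IsPart B → B.card ≤ n + 1 → IsPot Z n c B p := by
    intro B
    by_cases h : IsPart B ∧ B.card ≤ n + 1
    · obtain ⟨p, hp⟩ := S.exists_isPot hK hN' (by omega) hc h.1 h.2
      exact ⟨p, fun _ _ => hp⟩
    · exact ⟨1, fun h1 h2 => absurd ⟨h1, h2⟩ h⟩
  choose p hp using hp
  have hg : ∀ A B : Finset (D.Chart none), ∃ g : L, AdjLe M (n + 1) A B →
      (A.card ≤ n → B.card ≤ n → g = c A B) ∧ ∀ κ, Fits Z κ A → Fits Z κ B →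
        g = p A κ * c (κ.app A) (κ.app B) * (p B κ)⁻¹ := by
    intro A B
    by_cases h : AdjLe M (n + 1) A B
    · obtain ⟨g, hg⟩ := S.exists_edge_value hK hs hN' (by omega) hc h (hp A h.1.1 h.2.1)
        (hp B h.1.2.1 h.2.2)
      exact ⟨g, fun _ => hg⟩
    · exact ⟨1, fun h' => absurd h' h⟩
  choose c' hc' using hg
  have hwalk : ∀ κ : D.Con none, ∀ l A B, IsWalk (AdjLe M (n + 1)) A l B → Fits Z κ A →
      (∀ C ∈ l, Fits Z κ C) →
      IsWalk (AdjLe M n) (κ.app A) (l.map κ.app) (κ.app B) ∧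
      wval c' A l = p A κ * wval c (κ.app A) (l.map κ.app) * (p B κ)⁻¹ := by
    intro κ l
    induction l with
    | nil => rintro A _ rfl - -; exact ⟨rfl, by simp [wval]⟩
    | cons C l ih =>
      rintro A B ⟨h, hw⟩ hA hl
      have hC := hl C (by simp)
      obtain ⟨h1, h2⟩ := ih C B hw hC fun C' hC' => hl C' (by simp [hC'])
      have hA' := (S.valid hA).card_lt h.1.1
      have hC' := (S.valid hC).card_lt h.1.2.1
      refine ⟨⟨((S.valid hA).adj_app (S.valid hC) h.1).le ?_ ?_, h1⟩, ?_⟩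
      · have := h.2.1; omega
      · have := h.2.2; omega
      · simp only [wval, List.map_cons]
        rw [h2, (hc' A C h).2 κ hA hC]
        group
  refine ⟨c', fun A l hl hw => ?_, fun A B h => (hc' A B (h.mono (Nat.le_succ n))).1 h.2.1 h.2.2⟩
  by_cases hsmall : A.card ≤ n ∧ ∀ C ∈ l, C.card ≤ n
  · have key : ∀ l (A B : Finset (D.Chart none)), IsWalk (AdjLe M (n + 1)) A l B → A.card ≤ n →
        (∀ C ∈ l, C.card ≤ n) → IsWalk (AdjLe M n) A l B ∧ wval c' A l = wval c A l := by
      intro l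
      induction l with
      | nil => intro A B h _ _; exact ⟨h, rfl⟩
      | cons C l ih =>
        rintro A B ⟨h, hw⟩ hA hl
        have hC := hl C (by simp)
        obtain ⟨h1, h2⟩ := ih C B hw hC fun C' hC' => hl C' (by simp [hC'])
        exact ⟨⟨h.1.le hA hC, h1⟩, by simp only [wval]; rw [h2, (hc' A C h).1 hA hC]⟩
    obtain ⟨h1, h2⟩ := key l A A hw hsmall.1 hsmall.2
    rw [h2]
    exact hc A l hl h1
  · rcases l with _ | ⟨C, l⟩
    · rfl
    obtain ⟨h1, F, hF, hFT⟩ := S.exists_common hs (hw.mono fun _ _ h => h.1)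
    have hls : (C :: l).length * s ≤ K * s := Nat.mul_le_mul_right s hl
    have hAn : n₁ ≤ A.card := by
      by_contra hlt
      refine hsmall ⟨by omega, fun C' hC' => ?_⟩
      have := (h1 C' hC').1
      omega
    obtain ⟨κ, hκ, hκA, hκF⟩ := S.supply A hw.1.1.1 hAn F (hF.trans (hls.trans hN))
    obtain ⟨h2, h3⟩ := hwalk κ _ A A hw ⟨hκ, hκA⟩ fun C' hC' => ⟨hκ, hFT _ hκA hκF C' hC'⟩
    rw [h3, hc _ _ (by simpa using hl) h2]
    simp

theorem exists_extend (S : ConSys M Z s N n₁)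
    (hK : 4 ≤ K) (hs : 1 ≤ s) (hN : K * s ≤ N) (hn : n₁ + K * s ≤ n)
    (hc : TrivLoops (AdjLe M n) K c) : ∃ c' : Finset (D.Chart none) → Finset (D.Chart none) → L,
      TrivLoops (Adj M) K c' ∧ ∀ A B, AdjLe M n A B → c' A B = c A B := by
  let Cc := fun k : ℕ => {c : Finset (D.Chart none) → Finset (D.Chart none) → L //
    TrivLoops (AdjLe M (n + k)) K c}
  have step : ∀ k (f : Cc k), ∃ f' : Cc (k + 1), ∀ A B, AdjLe M (n + k) A B →
      f'.1 A B = f.1 A B := fun k f => by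
    obtain ⟨c', h1, h2⟩ := S.exists_extend_succ hK hs hN (by omega) f.2
    exact ⟨⟨c', h1⟩, h2⟩
  choose nxt hnxt using step
  let f : ∀ k, Cc k := fun k => Nat.rec ⟨c, hc⟩ (fun k f => nxt k f) k
  have hf : ∀ k j A B, AdjLe M (n + k) A B → (f (k + j)).1 A B = (f k).1 A B := by
    intro k j A B h
    induction j with
    | zero => rfl
    | succ j ih =>
      rw [← ih]
      exact hnxt (k + j) (f (k + j)) A B (h.mono (by omega))
  let c' : Finset (D.Chart none) → Finset (D.Chart none) → L := fun A B =>
    (f (A.card + B.card)).1 A B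
  have hc' : ∀ k A B, AdjLe M (n + k) A B → c' A B = (f k).1 A B := by
    intro k A B h
    rcases le_total k (A.card + B.card) with h' | h'
    · obtain ⟨j, hj⟩ := Nat.exists_eq_add_of_le h'
      simp only [c']
      rw [hj]
      exact hf k j A B h
    · obtain ⟨j, hj⟩ := Nat.exists_eq_add_of_le h'
      simp only [c']
      have := hf (A.card + B.card) j A B (h.1.le (by omega) (by omega))
      rw [hj, this]
  refine ⟨c', fun A l hl hw => ?_, fun A B h => hc' 0 A B h⟩
  obtain ⟨k, hk⟩ := hw.exists_adjLe n
  rw [wval_congr (hc' k) hk]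
  exact (f k).2 A l hl hk

end Extend

theorem reflTransGen_adjLe (S : ConSys M Z s N n₁)
    (hs : 1 ≤ s) (hN : 4 * s ≤ N) {n : ℕ} (hn : n₁ + s ≤ n + 1)
    {A B : Finset (D.Chart none)} (hA : A.card ≤ n) (hB : B.card ≤ n)
    (h : Relation.ReflTransGen (Adj M) A B) : Relation.ReflTransGen (AdjLe M n) A B := by
  have hsymm : ∀ {n} {A B : Finset (D.Chart none)}, Relation.ReflTransGen (AdjLe M n) A B →
      Relation.ReflTransGen (AdjLe M n) B A := fun h =>
    by
    induction h with
    | refl => exact .refl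
    | tail _ h ih => exact .head h.symm ih
  have down : ∀ m ≥ n, Relation.ReflTransGen (AdjLe M (m + 1)) A B → A.card ≤ m → B.card ≤ m →
      Relation.ReflTransGen (AdjLe M m) A B := by
    intro m hm h hA hB
    have small : ∀ {κ : D.Con none} {C : Finset (D.Chart none)}, Fits Z κ C → IsPart C →
        C.card ≤ m + 1 → (κ.app C).card ≤ m := fun h hB hB' => by
      have := (S.valid h).card_lt hB; omega
    have two : ∀ {C : Finset (D.Chart none)} {κ κ' : D.Con none}, IsPart C → C.card ≤ m + 1 →
        n₁ ≤ C.card → Fits Z κ C → Fits Z κ' C →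
        Relation.ReflTransGen (AdjLe M m) (κ.app C) (κ'.app C) := by
      have dj : ∀ {C : Finset (D.Chart none)} {κ κ' : D.Con none}, IsPart C → C.card ≤ m + 1 →
          Fits Z κ C → Fits Z κ' C → Disjoint κ.supp κ'.supp →
          Relation.ReflTransGen (AdjLe M m) (κ.app C) (κ'.app C) := by
        intro C κ κ' hC hm h h' hd
        have h1 := S.adjLe (S.fits_app h h' hd) ((S.valid h).isPart hC) (small h hC hm)
        have h2 := S.adjLe (S.fits_app h' h hd.symm) ((S.valid h').isPart hC) (small h' hC hm)
        rw [← (S.valid h).app_comm (S.valid h') hC] at h2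
        exact .head h1.1 (.single h2.2)
      intro C κ κ' hC hm hn h h'
      obtain ⟨κ₃, h3, -, hd, hd'⟩ := S.exists_third hN hs (hC.adj (M := M)) hn h h'
      exact (dj hC hm h h3 hd.symm).trans (dj hC hm h3 h' hd')
    let r : Finset (D.Chart none) → Finset (D.Chart none) := fun C =>
      if C.card ≤ m then C else if h : ∃ κ, Fits Z κ C then h.choose.app C else C
    have hr : ∀ {C κ}, IsPart C → C.card ≤ m + 1 → n₁ ≤ C.card → Fits Z κ C →
        Relation.ReflTransGen (AdjLe M m) (r C) (κ.app C) := by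
      intro C κ hC hm hn h
      by_cases hCm : C.card ≤ m
      · simp only [r, if_pos hCm]
        exact .single (S.adjLe h hC hCm).1
      · have hex : ∃ κ, Fits Z κ C := ⟨κ, h⟩
        simp only [r, if_neg hCm, dif_pos hex]
        exact two hC hm hn hex.choose_spec h
    have step : ∀ C C', AdjLe M (m + 1) C C' → Relation.ReflTransGen (AdjLe M m) (r C) (r C') := by
      intro C C' h
      by_cases hsm : C.card ≤ m ∧ C'.card ≤ m
      · simp only [r, if_pos hsm.1, if_pos hsm.2]
        exact .single (h.1.le hsm.1 hsm.2)
      · have h1 := (S.card_sdiff_le hs h.1).2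
        have h2 := (S.card_sdiff_le hs h.1.symm).2
        obtain ⟨κ, k1, k2, k3⟩ := S.supply C h.1.1 (by omega) (C \ C')
          ((S.card_sdiff_le hs h.1).1.trans (by omega))
        have k4 : Fits Z κ C' := ⟨k1, fun χ hχ => by
          by_contra hB
          exact Finset.disjoint_left.1 k3 hχ (Finset.mem_sdiff.2 ⟨k2 hχ, hB⟩)⟩
        have k5 : Fits Z κ C := ⟨k1, k2⟩
        refine (hr h.1.1 h.2.1 (by omega) k5).trans (.trans (.single ?_)
          (hsymm (hr h.1.2.1 h.2.2 (by omega) k4)))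
        exact ((S.valid k5).adj_app (S.valid k4) h.1).le (small k5 h.1.1 h.2.1)
          (small k4 h.1.2.1 h.2.2)
    have := Relation.ReflTransGen.lift' r step A B h
    simpa only [Function.onFun, r, if_pos hA, if_pos hB] using this
  obtain ⟨l, hl⟩ := exists_isWalk h
  obtain ⟨k, hk⟩ := hl.exists_adjLe n
  replace hk := hk.reflTransGen
  induction k with
  | zero => exact hk
  | succ k ih => exact ih (down (n + k) (by omega) hk (by omega) (by omega))

end ConSys

end ChartData

section Walks

variable {α : Type*} {L : Type*} [Group L] {adj : α → α → Prop} {K : ℕ} {c : α → α → L}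

theorem TrivLoops.exists_reverse (h : TrivLoops adj K c) (hK : 4 ≤ K)
    (hs : ∀ a b, adj a b → adj b a) : ∀ {l : List α} {a b : α}, IsWalk adj a l b →
      ∃ l', l'.length = l.length ∧ IsWalk adj b l' a ∧ wval c b l' = (wval c a l)⁻¹
  | [], _, _, hw => by cases hw; exact ⟨[], rfl, rfl, by simp [wval]⟩
  | d :: l, a, b, hw => by
    obtain ⟨l', h1, h2, h3⟩ := h.exists_reverse hK hs hw.2
    have hda : IsWalk adj d [a] a := ⟨hs _ _ hw.1, rfl⟩
    refine ⟨l' ++ [a], by simp [h1], h2.append hda, ?_⟩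
    rw [wval_append c h2, h3]
    simp [wval, h.symm hK hw.1 (hs _ _ hw.1)]

theorem TrivLoops.wval_mul (h : TrivLoops adj K c) (hK : 4 ≤ K) (hs : ∀ a b, adj a b → adj b a)
    {a b d : α} {l l' : List α} (hl : IsWalk adj a l b) (hl' : IsWalk adj a l' d)
    (hbd : adj b d) (hle : l.length + l'.length + 1 ≤ K) : wval c a l * c b d = wval c a l' := by
  obtain ⟨r, h1, h2, h3⟩ := h.exists_reverse hK hs hl'
  have h4 : IsWalk adj b (d :: r) a := ⟨hbd, h2⟩
  have := h a (l ++ d :: r) (by simp; omega) (hl.append h4)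
  rw [wval_append c hl, wval, h3, ← mul_assoc, mul_inv_eq_one] at this
  exact this

theorem wval_ladder {c' : α → α → L} {f : α → L}
    (h : ∀ a b, adj a b → c a b * f b = f a * c' a b) : ∀ {l : List α} {a b : α},
      IsWalk adj a l b → wval c a l * f b = f a * wval c' a l
  | [], _, _, hw => by cases hw; simp [wval]
  | d :: l, a, b, hw => by
    simp only [wval]
    rw [mul_assoc, wval_ladder h hw.2, ← mul_assoc, h _ _ hw.1, mul_assoc]

end Walks

namespace ChartData

open Chart

variable {D : ChartData} {x : Option D.W} {M : ∀ v, Set (D.Chart (some v))}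

/-- Every chart in `Y` is the restriction of a chart in `X` along a chart in `M`. -/
def Sub (M : ∀ v, Set (D.Chart (some v))) (X Y : Finset (D.Chart x)) : Prop :=
  ∀ χ ∈ Y, ∃ θ ∈ X, ∃ m ∈ M θ.ty, χ = θ.comp m

theorem Sub.mono {M' : ∀ v, Set (D.Chart (some v))} (h : ∀ v, M v ⊆ M' v)
    {X Y : Finset (D.Chart x)} (hXY : Sub M X Y) : Sub M' X Y := fun χ hχ => by
  obtain ⟨θ, hθ, m, hm, e⟩ := hXY χ hχ
  exact ⟨θ, hθ, m, h _ hm, e⟩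

theorem Sub.refl (h : ∀ v, one v ∈ M v) (X : Finset (D.Chart x)) : Sub M X X :=
  fun χ hχ => ⟨χ, hχ, one _, h _, rfl⟩

/-- The part of `Y` lying below `θ`, as a set of charts of the source of `θ`. -/
def coord (Y : Finset (D.Chart x)) (θ : D.Chart x) : Finset (D.Chart (some θ.ty)) :=
  Y.preimage θ.comp θ.comp_injective.injOn

theorem mem_coord {Y : Finset (D.Chart x)} {θ : D.Chart x} {m : D.Chart (some θ.ty)} :
    m ∈ coord Y θ ↔ θ.comp m ∈ Y := Finset.mem_preimage

theorem IsPart.comp_eq {X : Finset (D.Chart x)} (hX : IsPart X) {θ η : D.Chart x} (hθ : θ ∈ X)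
    (hη : η ∈ X) {m : D.Chart (some θ.ty)} {n : D.Chart (some η.ty)} (h : θ.comp m = η.comp n) :
    θ = η := by
  obtain ⟨p, hp⟩ := (θ.comp m).img_nonempty
  exact hX.disj θ hθ η hη p (img_comp_subset _ _ hp) (img_comp_subset η n (h ▸ hp))

theorem Sub.isPart_coord {X Y : Finset (D.Chart x)} (h : Sub M X Y) (hX : IsPart X)
    (hY : IsPart Y) {θ : D.Chart x} (hθ : θ ∈ X) : IsPart (coord Y θ) where
  cover p := by
    obtain ⟨χ, hχ, hp⟩ := hY.cover (θ.fn p)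
    obtain ⟨η, hη, m, -, rfl⟩ := h χ hχ
    obtain rfl := hX.disj θ hθ η hη (θ.fn p) ⟨p, rfl⟩ (img_comp_subset _ _ hp)
    obtain ⟨y, hy⟩ := hp
    exact ⟨m, mem_coord.2 hχ, y, D.inj θ.mem hy⟩
  disj := by
    rintro φ hφ ψ hψ p ⟨y, rfl⟩ ⟨z, hz⟩
    refine θ.comp_injective (hY.disj _ (mem_coord.1 hφ) _ (mem_coord.1 hψ) (θ.fn (φ.fn y))
      ⟨y, rfl⟩ ⟨z, ?_⟩)
    exact congrArg θ.fn hz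

theorem Sub.mem_of_mem_coord {X Y : Finset (D.Chart x)} (h : Sub M X Y) (hX : IsPart X)
    {θ : D.Chart x} (hθ : θ ∈ X) {m : D.Chart (some θ.ty)} (hm : m ∈ coord Y θ) :
    m ∈ M θ.ty := by
  obtain ⟨η, hη, n, hn, e⟩ := h _ (mem_coord.1 hm)
  obtain rfl := hX.comp_eq hθ hη e
  rwa [comp_inj.1 e]

/-- Plugging a family of partitions into the charts of `X`. -/
def plugAll (X : Finset (D.Chart x)) (f : ∀ θ : D.Chart x, Finset (D.Chart (some θ.ty))) :
    Finset (D.Chart x) := X.biUnion fun θ => (f θ).image θ.comp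

theorem mem_plugAll {X : Finset (D.Chart x)} {f : ∀ θ : D.Chart x, Finset (D.Chart (some θ.ty))}
    {χ : D.Chart x} : χ ∈ plugAll X f ↔ ∃ θ ∈ X, ∃ m ∈ f θ, χ = θ.comp m := by
  simp [plugAll, eq_comm]

theorem plugAll_congr {X : Finset (D.Chart x)}
    {f g : ∀ θ : D.Chart x, Finset (D.Chart (some θ.ty))} (h : ∀ θ ∈ X, f θ = g θ) :
    plugAll X f = plugAll X g := Finset.biUnion_congr rfl fun θ hθ => by rw [h θ hθ]

theorem Sub.plugAll_coord {X Y : Finset (D.Chart x)} (h : Sub M X Y) :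
    plugAll X (coord Y) = Y := by
  ext χ
  rw [mem_plugAll]
  constructor
  · rintro ⟨θ, -, m, hm, rfl⟩
    exact mem_coord.1 hm
  · intro hχ
    obtain ⟨θ, hθ, m, -, rfl⟩ := h χ hχ
    exact ⟨θ, hθ, m, mem_coord.2 hχ, rfl⟩

theorem IsPart.plugAll {X : Finset (D.Chart x)} (hX : IsPart X)
    {f : ∀ θ : D.Chart x, Finset (D.Chart (some θ.ty))} (hf : ∀ θ ∈ X, IsPart (f θ)) :
    IsPart (ChartData.plugAll X f) where
  cover p := by
    obtain ⟨θ, hθ, q, rfl⟩ := hX.cover p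
    obtain ⟨m, hm, y, rfl⟩ := (hf θ hθ).cover q
    exact ⟨θ.comp m, mem_plugAll.2 ⟨θ, hθ, m, hm, rfl⟩, y, rfl⟩
  disj := by
    intro φ hφ ψ hψ p hp hp'
    obtain ⟨θ, hθ, m, hm, rfl⟩ := mem_plugAll.1 hφ
    obtain ⟨η, hη, n, hn, rfl⟩ := mem_plugAll.1 hψ
    obtain rfl := hX.disj θ hθ η hη p (img_comp_subset _ _ hp) (img_comp_subset _ _ hp')
    obtain ⟨y, rfl⟩ := hp
    obtain ⟨z, hz⟩ := hp'
    rw [(hf θ hθ).disj m hm n hn (m.fn y) ⟨y, rfl⟩ ⟨z, D.inj θ.mem hz⟩]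

theorem plugAll_update {X : Finset (D.Chart x)} {θ : D.Chart x} (hθ : θ ∈ X)
    (f : ∀ θ : D.Chart x, Finset (D.Chart (some θ.ty))) (P : Finset (D.Chart (some θ.ty))) :
    plugAll X (Function.update f θ P) = plug (plugAll (X.erase θ) f) θ P := by
  have h1 : plugAll (X.erase θ) (Function.update f θ P) = plugAll (X.erase θ) f :=
    plugAll_congr fun η hη => Function.update_of_ne (Finset.ne_of_mem_erase hη) _ _
  conv_lhs => rw [← Finset.insert_erase hθ]
  rw [plugAll, Finset.biUnion_insert, Function.update_self, Finset.union_comm, plug, ← h1]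
  rfl

theorem IsPart.ctx_plugAll {X : Finset (D.Chart x)} (hX : IsPart X)
    {f : ∀ θ : D.Chart x, Finset (D.Chart (some θ.ty))} {θ : D.Chart x} (hθ : θ ∈ X)
    (hf : ∀ η ∈ X, η ≠ θ → IsPart (f η)) : Ctx (ChartData.plugAll (X.erase θ) f) θ := by
  constructor
  · rw [← plug_one, ← plugAll_update hθ]
    refine hX.plugAll fun η hη => ?_
    by_cases e : η = θ
    · subst e
      rw [Function.update_self]
      exact isPart_one _
    · rw [Function.update_of_ne e]
      exact hf η hη e
  · intro h
    obtain ⟨η, hη, m, -, e⟩ := mem_plugAll.1 h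
    obtain ⟨h1, h2⟩ := Finset.mem_erase.1 hη
    exact h1 (hX.comp_eq (m := one _) hθ h2 e).symm

theorem Ctx.adj_plug {R : Finset (D.Chart x)} {θ : D.Chart x} (hR : Ctx R θ)
    {P P' : Finset (D.Chart (some θ.ty))} (h : Adj M P P') :
    Adj M (ChartData.plug R θ P) (ChartData.plug R θ P') := by
  have key : ∀ {P P' : Finset (D.Chart (some θ.ty))}, Mv M P P' →
      Mv M (ChartData.plug R θ P) (ChartData.plug R θ P') := by
    rintro P P' ⟨S, m, T, hS, hT, hM, rfl, rfl⟩
    refine ⟨ChartData.plug R θ S, θ.comp m, T, hR.plug hS, hT, hM, ?_, ?_⟩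
    · rw [insert_plug]
    · rw [plug_plug]
  refine ⟨hR.isPart_plug h.1, hR.isPart_plug h.2.1, ?_⟩
  rcases h.2.2 with h | h | h
  · exact Or.inl (h ▸ rfl)
  · exact Or.inr (Or.inl (key h))
  · exact Or.inr (Or.inr (key h))

theorem Mv.exists_coord {M' : ∀ v, Set (D.Chart (some v))} {X A B : Finset (D.Chart x)}
    (hX : IsPart X) (hA : Sub M' X A) (h : Mv M A B) :
    ∃ θ ∈ X, Mv M (coord A θ) (coord B θ) ∧ ∀ η ∈ X, η ≠ θ → coord A η = coord B η := by
  obtain ⟨R, ψ, P, hR, hP, hM, rfl, rfl⟩ := h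
  obtain ⟨θ, hθ, m, -, rfl⟩ := hA ψ (Finset.mem_insert_self _ _)
  have e1 : coord (insert (θ.comp m) R) θ = insert m (coord R θ) := by
    ext n
    simp only [mem_coord, Finset.mem_insert, comp_inj]
  refine ⟨θ, hθ, ⟨coord R θ, m, P, ⟨?_, ?_⟩, hP, hM, e1, ?_⟩, fun η hη hne => ?_⟩
  · rw [← e1]
    exact hA.isPart_coord hX hR.1 hθ
  · rw [mem_coord]
    exact hR.2
  · ext n
    rw [mem_coord, mem_plug]
    refine Iff.trans ?_ (mem_plug (R := coord R θ) (θ := m) (P := P)).symm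
    rw [mem_coord]
    refine or_congr_right (exists_congr fun a => and_congr_right fun _ => ?_)
    exact comp_inj (φ := θ) (m := n) (m' := m.comp a)
  · ext n
    simp only [mem_coord, mem_plug, Finset.mem_insert]
    constructor
    · rintro (h | h)
      · exact absurd (hX.comp_eq hη hθ h) hne
      · exact Or.inl h
    · rintro (h | ⟨a, -, h⟩)
      · exact Or.inr h
      · exact absurd (hX.comp_eq hη hθ (h.trans (comp_assoc θ m a))) hne

variable {L : Type*} [Group L] {c : Finset (D.Chart x) → Finset (D.Chart x) → L} {K k₀ : ℕ}

theorem exists_box_potential (hK : 4 ≤ K) (hk : 2 * k₀ + 1 ≤ K) (hc : TrivLoops (Adj M) K c)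
    (S : ∀ v, Set (Finset (D.Chart (some v))))
    (hS : ∀ v, ∀ P ∈ S v, ∃ l, l.length ≤ k₀ ∧ IsWalk (Adj M) {one v} l P)
    {X : Finset (D.Chart x)} (hX : IsPart X) (A : Finset (D.Chart x)) : A ⊆ X →
    ∃ Q : (∀ θ : D.Chart x, Finset (D.Chart (some θ.ty))) → L, ∀ f,
      (∀ θ ∈ A, f θ ∈ S θ.ty) → (∀ θ ∉ A, f θ = {one θ.ty}) → ∀ θ ∈ A, ∀ P ∈ S θ.ty,
      Adj M (f θ) P → c (plugAll X f) (plugAll X (Function.update f θ P)) =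
        (Q f)⁻¹ * Q (Function.update f θ P) := by
  have hSp : ∀ v, ∀ P ∈ S v, IsPart P := by
    intro v P hP
    obtain ⟨l, -, hl⟩ := hS v P hP
    have key : ∀ (l : List (Finset (D.Chart (some v)))) A B, IsPart A → IsWalk (Adj M) A l B →
        IsPart B := by
      intro l
      induction l with
      | nil => rintro A _ h rfl; exact h
      | cons C l ih => exact fun A B _ hw => ih C B hw.1.2.1 hw.2
    exact key l _ _ (isPart_one v) hl
  choose wl hwl hwalk using hS
  have hadj : ∀ f : (∀ θ : D.Chart x, Finset (D.Chart (some θ.ty))), (∀ θ ∈ X, IsPart (f θ)) →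
      ∀ θ ∈ X, ∀ P P', Adj M P P' →
        Adj M (plugAll X (Function.update f θ P)) (plugAll X (Function.update f θ P')) := by
    intro f hf θ hθ P P' h
    rw [plugAll_update hθ, plugAll_update hθ]
    exact (hX.ctx_plugAll hθ fun η hη _ => hf η hη).adj_plug h
  induction A using Finset.induction_on with
  | empty => exact fun _ => ⟨1, by simp⟩
  | insert η A hη ih =>
    intro hAX
    obtain ⟨hηX, hAX⟩ := Finset.insert_subset_iff.1 hAX
    obtain ⟨Q, hQ⟩ := ih hAX
    let c' : (∀ θ : D.Chart x, Finset (D.Chart (some θ.ty))) → Finset (D.Chart (some η.ty)) →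
      Finset (D.Chart (some η.ty)) → L := fun f P P' =>
        c (plugAll X (Function.update f η P)) (plugAll X (Function.update f η P'))
    let Q' : (∀ θ : D.Chart x, Finset (D.Chart (some θ.ty))) → L := fun f =>
      Q (Function.update f η {one η.ty}) *
        if h : f η ∈ S η.ty then wval (c' f) {one η.ty} (wl η.ty (f η) h) else 1
    refine ⟨Q', fun f hfS hf1 θ hθ P hP hfP => ?_⟩
    have hfη : f η ∈ S η.ty := hfS η (Finset.mem_insert_self _ _)
    have hfp : ∀ θ ∈ X, IsPart (f θ) := fun θ _ => by
      by_cases h : θ ∈ insert η A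
      · exact hSp _ _ (hfS θ h)
      · rw [hf1 θ h]
        exact isPart_one _
    by_cases e : θ = η
    · subst e
      have hc' : TrivLoops (Adj M) K (c' f) := by
        intro P l hl hw
        have key : ∀ l P P', IsWalk (Adj M) P l P' →
            IsWalk (Adj M) (plugAll X (Function.update f θ P))
              (l.map fun P => plugAll X (Function.update f θ P))
              (plugAll X (Function.update f θ P')) ∧
            wval (c' f) P l = wval c (plugAll X (Function.update f θ P))
              (l.map fun P => plugAll X (Function.update f θ P)) := by
          intro l
          induction l with
          | nil => rintro P _ rfl; exact ⟨rfl, rfl⟩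
          | cons C l ih =>
            rintro P P' ⟨h, hw⟩
            obtain ⟨h1, h2⟩ := ih C P' hw
            exact ⟨⟨hadj f hfp θ hηX _ _ h, h1⟩, by simp only [wval, h2, List.map_cons]; rfl⟩
        obtain ⟨h1, h2⟩ := key l P P hw
        rw [h2]
        exact hc _ _ (by simpa using hl) h1
      have e1 : c' (Function.update f θ P) = c' f := by
        funext P P'
        simp only [c', Function.update_idem]
      have h1 := hc'.wval_mul hK (fun _ _ h => h.symm) (hwalk _ _ hfη) (hwalk _ _ hP) hfP (by
        have := hwl _ _ hfη
        have := hwl _ _ hP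
        omega)
      have h2 : c' f (f θ) P = c (plugAll X f) (plugAll X (Function.update f θ P)) := by
        simp only [c', Function.update_eq_self]
      simp only [Q', Function.update_idem, Function.update_self, dif_pos hfη, dif_pos hP, e1]
      rw [← h1, h2]
      group
    · have hθA : θ ∈ A := (Finset.mem_insert.1 hθ).resolve_left e
      have hcm : ∀ R, Function.update (Function.update f θ P) η R =
          Function.update (Function.update f η R) θ P := fun R =>
        (Function.update_comm (Ne.symm e) _ _ _).symm
      have hfη' : Function.update f θ P η = f η := Function.update_of_ne (Ne.symm e) _ _
      let F : Finset (D.Chart (some η.ty)) → L := fun R =>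
        c (plugAll X (Function.update f η R))
          (plugAll X (Function.update (Function.update f η R) θ P))
      have hpart : ∀ R, IsPart R → ∀ θ ∈ X, IsPart (Function.update f η R θ) := by
        intro R hR θ hθ
        by_cases e : θ = η
        · subst e
          rwa [Function.update_self]
        · rw [Function.update_of_ne e]
          exact hfp θ hθ
      have hv : ∀ R, IsPart R → Adj M (plugAll X (Function.update f η R))
          (plugAll X (Function.update (Function.update f η R) θ P)) := by
        intro R hR
        have := hadj _ (hpart R hR) θ (hAX hθA) _ _ hfP
        rwa [Function.update_eq_self_iff.2 (by rw [Function.update_of_ne e])] at this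
      have lad := wval_ladder (c := c' f) (c' := c' (Function.update f θ P)) (f := F)
        (adj := Adj M) (fun R R' h => by
          have h1 := hadj f hfp η hηX R R' h
          have h2 := hadj (Function.update f θ P) (fun ζ hζ => by
            by_cases e' : ζ = θ
            · subst e'
              rw [Function.update_self]
              exact hSp _ _ hP
            · rw [Function.update_of_ne e']
              exact hfp ζ hζ) η hηX R R' h
          simp only [c', F]
          rw [hcm, hcm] at h2 ⊢
          exact hc.square hK h1 (hv R' h.2.1) (hv R h.1) h2 (hv R h.1).symm h2.symm)
        (hwalk _ _ hfη)
      have hF0 : F {one η.ty} = (Q (Function.update f η {one η.ty}))⁻¹ *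
          Q (Function.update (Function.update f η {one η.ty}) θ P) := by
        refine hQ _ (fun ζ hζ => ?_) (fun ζ hζ => ?_) θ hθA P hP ?_
        · rw [Function.update_of_ne (show ζ ≠ η by rintro rfl; exact hη hζ)]
          exact hfS ζ (Finset.mem_insert_of_mem hζ)
        · by_cases e' : ζ = η
          · subst e'
            rw [Function.update_self]
          · rw [Function.update_of_ne e']
            exact hf1 ζ (by simp [e', hζ])
        · rwa [Function.update_of_ne e]
      have hF1 : F (f η) = c (plugAll X f) (plugAll X (Function.update f θ P)) := by
        simp only [F, Function.update_eq_self]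
      rw [hF0, hF1] at lad
      simp only [Q']
      rw [dif_pos hfη, hcm]
      simp only [hfη', dif_pos hfη]
      rw [← hF1] at lad ⊢
      generalize F (f η) = y at *
      rw [eq_comm, mul_inv_rev, mul_assoc, inv_mul_eq_iff_eq_mul, lad, mul_assoc]

end ChartData

namespace ChartData

open Chart

variable {D : ChartData} {x : Option D.W} {M : ∀ v, Set (D.Chart (some v))}

theorem exists_uniform (T : ∀ v, Set (D.Chart (some v))) (hT : ∀ v, (T v).Finite)
    (R : ∀ v, ℕ → D.Chart (some v) → Prop) (hR : ∀ v n k m, n ≤ k → R v n m → R v k m)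
    (h : ∀ v, ∀ m ∈ T v, ∃ n, R v n m) : ∃ n, ∀ v, ∀ m ∈ T v, R v n m := by
  have h1 : ∀ v, ∃ n, ∀ m ∈ T v, R v n m := by
    intro v
    choose! d hd using h v
    obtain ⟨n, hn⟩ := ((hT v).image d).bddAbove
    exact ⟨n, fun m hm => hR v _ _ m (hn ⟨m, hm, rfl⟩) (hd m hm)⟩
  choose d hd using h1
  let _ := D.fintypeW
  exact ⟨Finset.univ.sup d, fun v m hm =>
    hR v _ _ m (Finset.le_sup (Finset.mem_univ v)) (hd v m hm)⟩

/-- A finite system of charts stable under sufficiently deep expansion. -/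
structure MSys (M : ∀ v, Set (D.Chart (some v))) : Prop where
  fin : ∀ v, (M v).Finite
  one_mem : ∀ v, one v ∈ M v
  edge_mem : ∀ v (e : D.Ed v), edge e ∈ M v
  step : ∀ v, ∀ m ∈ M v,
    Bar (fun χ => ∃ e : D.Ed v, ∃ m' ∈ M (D.tgt e), χ = (edge e).comp m') m
  deep : ∀ v (m : D.Chart (some v)), ∃ h, Bar (fun χ => ∃ j ≤ h, ∃ β, reach j (one v) β ∧
    ∃ m' ∈ M β.ty, χ = β.comp m') m

theorem Good.exists_mSys (hD : D.Good) (A : ∀ v, Set (D.Chart (some v)))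
    (hA : ∀ v, (A v).Finite) (h1 : ∀ v, one v ∈ A v) (hE : ∀ v (e : D.Ed v), edge e ∈ A v) :
    ∃ M : ∀ v, Set (D.Chart (some v)), MSys M ∧ ∀ v, A v ⊆ M v := by
  obtain ⟨N, hN, hbar⟩ := hD.contraction
  obtain ⟨d, hd⟩ := exists_uniform (fun v => A v ∪ N v) (fun v => (hA v).union (hN v))
    (fun v n m => Bar (fun χ => ∃ k ≤ n, ∃ β, reach (k + 1) (one v) β ∧
      ∃ n ∈ N β.ty, χ = β.comp n) m)
    (fun v n k m hnk h => h.mono fun χ ⟨j, hj, h⟩ => ⟨j, hj.trans hnk, h⟩)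
    (fun v m _ => (hbar v m).exists_bound)
  let P : ∀ v, Set (D.Chart (some v)) := fun v =>
    {χ | ∃ j ≤ d, ∃ β, reach j (one v) β ∧ ∃ n ∈ N β.ty, χ = β.comp n}
  have hP : ∀ v, (P v).Finite := by
    intro v
    have : P v ⊆ ⋃ j ∈ Set.Iic d, ⋃ β ∈ {β | reach j (one v) β}, β.comp '' N β.ty := by
      rintro _ ⟨j, hj, β, hβ, n, hn, rfl⟩
      simp only [Set.mem_iUnion]
      exact ⟨j, hj, β, hβ, n, hn, rfl⟩
    exact ((Set.finite_Iic d).biUnion fun j _ => (finite_reach j _).biUnion fun β _ =>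
      (hN _).image _).subset this
  have hNP : ∀ v, N v ⊆ P v := fun v n hn => ⟨0, Nat.zero_le _, one v, rfl, n, hn, rfl⟩
  have hpull : ∀ v j β, j ≤ d → reach (j + 1) (one v) β → ∀ n ∈ N β.ty,
      ∃ e : D.Ed v, ∃ m' ∈ A (D.tgt e) ∪ P (D.tgt e), β.comp n = (edge e).comp m' := by
    rintro v j β hj ⟨e, hr⟩ n hn
    obtain ⟨β', hβ', rfl⟩ := hr.exists_path
    exact ⟨e, β'.comp n, Or.inr ⟨j, hj, β', hβ', n, hn, rfl⟩, rfl⟩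
  refine ⟨fun v => A v ∪ P v, ⟨fun v => (hA v).union (hP v), fun v => Or.inl (h1 v),
    fun v e => Or.inl (hE v e), fun v m hm => ?_, fun v m => ?_⟩, fun v => Set.subset_union_left⟩
  · have key : ∀ m ∈ A v ∪ N v,
        Bar (fun χ => ∃ e : D.Ed v, ∃ m' ∈ A (D.tgt e) ∪ P (D.tgt e), χ = (edge e).comp m') m :=
      fun m hm => (hd v m hm).mono fun χ ⟨k, hk, β, hβ, n, hn, e⟩ => by
        rw [e]
        exact hpull v k β hk hβ n hn
    rcases hm with hm | ⟨j, hj, β, hβ, n, hn, rfl⟩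
    · exact key m (Or.inl hm)
    · cases j with
      | zero =>
        cases hβ
        exact key n (Or.inr hn)
      | succ j => exact .here (hpull v j β (by omega) hβ n hn)
  · obtain ⟨h, hb⟩ := (hbar v m).exists_bound
    refine ⟨h + 1, hb.mono ?_⟩
    rintro χ ⟨k, hk, β, hβ, n, hn, e⟩
    exact ⟨k + 1, by omega, β, hβ, n, Or.inr (hNP _ hn), e⟩

theorem reach_one_add {j : ℕ} {φ β : D.Chart x} (h : reach j φ β) (e : D.Ed β.ty) :
    reach (j + 1) φ (β.comp (edge e)) := h.trans ⟨e, rfl⟩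

namespace MSys

theorem raise (hM : MSys M) {φ : D.Chart x} (k : ℕ) : ∀ {j : ℕ} {β : D.Chart x},
    reach j φ β → ∀ m ∈ M β.ty,
      Bar (fun χ => ∃ β, reach (j + k) φ β ∧ ∃ m' ∈ M β.ty, χ = β.comp m') (β.comp m) := by
  induction k with
  | zero => exact fun {j β} h m hm => .here ⟨β, h, m, hm, rfl⟩
  | succ k ih =>
    intro j β h m hm
    refine Bar.bind ?_ ((hM.step _ m hm).comp_left β
      (R' := fun χ => ∃ e, ∃ m' ∈ M (D.tgt e), χ = (β.comp (edge e)).comp m') ?_)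
    · rintro χ ⟨e, m', hm', rfl⟩
      have := ih (reach_one_add h e) m' hm'
      rwa [show j + 1 + k = j + (k + 1) by omega] at this
    · rintro χ ⟨e, m', hm', rfl⟩
      exact ⟨e, m', hm', rfl⟩

theorem deep_ge (hM : MSys M) {v} (m : D.Chart (some v)) : ∃ h₀, ∀ h ≥ h₀,
    Bar (fun χ => ∃ β, reach h (one v) β ∧ ∃ m' ∈ M β.ty, χ = β.comp m') m := by
  obtain ⟨h₀, hb⟩ := hM.deep v m
  refine ⟨h₀, fun h hh => hb.bind ?_⟩
  rintro χ ⟨j, hj, β, hβ, m', hm', rfl⟩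
  obtain ⟨k, rfl⟩ := Nat.exists_eq_add_of_le (hj.trans hh)
  exact hM.raise k hβ m' hm'

end MSys

theorem exists_depth {B : Finset (D.Chart x)} (hB : IsPart B) (h : ℕ) :
    ∃ X, IsPart X ∧ Le B X ∧ (∀ θ ∈ B, ∀ χ, reach h θ χ → χ ∈ X) ∧
      ∀ χ ∈ X, ∃ θ ∈ B, reach h θ χ := by
  obtain ⟨X, hX, hle, hR⟩ := hB.exists_le (R := fun χ => ∃ θ ∈ B, reach h θ χ)
    fun θ hθ => (bar_reach h θ).mono fun χ hχ => ⟨θ, hθ, hχ⟩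
  refine ⟨X, hX, hle, fun θ hθ χ hχ => ?_, hR⟩
  obtain ⟨p, hp⟩ := χ.img_nonempty
  obtain ⟨ψ, hψ, hp'⟩ := hX.cover p
  obtain ⟨η, hη, hr⟩ := hR ψ hψ
  obtain rfl := hB.disj θ hθ η hη p (hχ.img_subset hp) (hr.img_subset hp')
  rwa [hχ.eq_of_overlap hr hp hp']

theorem MSys.exists_fraction (hD : D.Good) (hM : MSys M) {B₀ B : Finset (D.Chart x)}
    (hB₀ : IsPart B₀) (hB : IsPart B) :
    ∃ X Y, IsPart X ∧ IsPart Y ∧ Le B₀ X ∧ Le B Y ∧ Sub M X Y := by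
  obtain ⟨Y₁, hY₁, hle₁, hR₁⟩ := hB.exists_le fun χ _ => hD.leb hB₀ χ
  have h1 : ∀ χ ∈ Y₁, ∃ h₀, ∀ h ≥ h₀, Bar (fun ψ => ∃ φ ∈ B₀, ∃ β, reach h (one φ.ty) β ∧
      ∃ m' ∈ M β.ty, ψ = φ.comp (β.comp m')) χ := by
    intro χ hχ
    obtain ⟨φ, hφ, hsub⟩ := hR₁ χ hχ
    obtain ⟨m, rfl⟩ := exists_comp_of_img_subset hsub
    obtain ⟨h₀, hh⟩ := hM.deep_ge m
    refine ⟨h₀, fun h hge => (hh h hge).comp_left φ ?_⟩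
    rintro ψ ⟨β, hβ, m', hm', rfl⟩
    exact ⟨φ, hφ, β, hβ, m', hm', rfl⟩
  choose! d hd using h1
  obtain ⟨X, hX, hle, hin, -⟩ := exists_depth hB₀ (Y₁.sup d)
  obtain ⟨Y, hY, hle', hR⟩ := hY₁.exists_le fun χ hχ => hd χ hχ _ (Finset.le_sup hχ)
  refine ⟨X, Y, hX, hY, hle, hle₁.trans hle', fun χ hχ => ?_⟩
  obtain ⟨φ, hφ, β, hβ, m', hm', rfl⟩ := hR χ hχ
  exact ⟨φ.comp β, hin φ hφ _ (hβ.comp_left φ), m', hm', rfl⟩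

theorem Sub.chain {X Y : Finset (D.Chart x)} (h : Sub M X Y) (hX : IsPart X) (hY : IsPart Y) :
    Relation.ReflTransGen (fun A B => IsPart A ∧ IsPart B ∧ A ⊆ X ∪ Y ∧ B ⊆ X ∪ Y ∧ Mv M A B)
      X Y := by
  let f : Finset (D.Chart x) → ∀ θ : D.Chart x, Finset (D.Chart (some θ.ty)) := fun S θ =>
    if θ ∈ S then coord Y θ else {one θ.ty}
  have hf : ∀ S, ∀ θ ∈ X, IsPart (f S θ) := by
    intro S θ hθ
    by_cases e : θ ∈ S
    · simp only [f, if_pos e]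
      exact h.isPart_coord hX hY hθ
    · simp only [f, if_neg e]
      exact isPart_one _
  have hsub : ∀ S, plugAll X (f S) ⊆ X ∪ Y := by
    intro S χ hχ
    obtain ⟨θ, hθ, m, hm, rfl⟩ := mem_plugAll.1 hχ
    by_cases e : θ ∈ S
    · simp only [f, if_pos e] at hm
      exact Finset.mem_union_right _ (mem_coord.1 hm)
    · simp only [f, if_neg e, Finset.mem_singleton] at hm
      subst hm
      exact Finset.mem_union_left _ hθ
  have key : ∀ S ⊆ X, Relation.ReflTransGen (fun A B => IsPart A ∧ IsPart B ∧ A ⊆ X ∪ Y ∧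
      B ⊆ X ∪ Y ∧ Mv M A B) (plugAll X (f ∅)) (plugAll X (f S)) := by
    intro S
    induction S using Finset.induction_on with
    | empty => exact fun _ => .refl
    | insert η S hη ih =>
      intro hS
      obtain ⟨hηX, hSX⟩ := Finset.insert_subset_iff.1 hS
      refine (ih hSX).tail ⟨hX.plugAll (hf S), hX.plugAll (hf _), hsub _, hsub _, ?_⟩
      have hctx := hX.ctx_plugAll hηX fun ζ hζ _ => hf S ζ hζ
      have e1 : plugAll X (f S) = insert η (plugAll (X.erase η) (f S)) := by
        rw [← plug_one, ← plugAll_update hηX, Function.update_eq_self_iff.2]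
        simp [f, hη]
      have e2 : f (insert η S) = Function.update (f S) η (coord Y η) := by
        funext ζ
        by_cases e : ζ = η
        · subst e
          simp [f]
        · rw [Function.update_of_ne e]
          simp [f, e]
      rw [e2, plugAll_update hηX, e1]
      exact hctx.mv (h.isPart_coord hX hY hηX) fun m hm => h.mem_of_mem_coord hX hηX hm
  have e0 : plugAll X (f ∅) = X := by
    ext χ
    rw [mem_plugAll]
    simp [f]
  have e1 : plugAll X (f X) = Y := by
    rw [plugAll_congr (g := coord Y) fun θ hθ => by simp [f, hθ], h.plugAll_coord]
  have := key X subset_rfl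
  rwa [e0, e1] at this

theorem Up.reflTransGen {L : Type*} [Group L] {c : Finset (D.Chart x) → Finset (D.Chart x) → L}
    (hM : ∀ v (e : D.Ed v), edge e ∈ M v) {B X : Finset (D.Chart x)} {g : L} (h : Up c B X g)
    (hB : IsPart B) : Relation.ReflTransGen (Adj M) B X := by
  induction h with
  | refl B => exact .refl
  | step h _ ih => exact .head (mv_expand hM hB h).adj (ih (isPart_expand hB h))

theorem MSys.reflTransGen (hD : D.Good) (hM : MSys M) {A B : Finset (D.Chart x)}
    (hA : IsPart A) (hB : IsPart B) : Relation.ReflTransGen (Adj M) A B := by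
  obtain ⟨X, Y, hX, hY, hAX, hBY, hXY⟩ := hM.exists_fraction hD hA hB
  obtain ⟨_, h1⟩ := hAX.exists_up (c := fun _ _ => (1 : Unit)) hA hX
  obtain ⟨_, h2⟩ := hBY.exists_up (c := fun _ _ => (1 : Unit)) hB hY
  have h3 : Relation.ReflTransGen (Adj M) X Y :=
    Relation.ReflTransGen.mono (fun _ _ h => h.2.2.2.2.adj) _ _ (hXY.chain hX hY)
  have h4 : Relation.ReflTransGen (Adj M) Y B := by
    have := (h2.reflTransGen hM.edge_mem hB)
    rw [← Relation.reflTransGen_swap] at this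
    exact Relation.ReflTransGen.mono (fun _ _ h => Adj.symm h) _ _ this
  exact ((h1.reflTransGen hM.edge_mem hA).trans h3).trans h4

end ChartData

namespace ChartData

open Chart

variable {D : ChartData} {x : Option D.W} {M : ∀ v, Set (D.Chart (some v))}

/-- Products of an edge path of length at most `h` and two elements of `M`. -/
def wide (M : ∀ v, Set (D.Chart (some v))) (h : ℕ) (v : D.W) : Set (D.Chart (some v)) :=
  {χ | ∃ j ≤ h, ∃ β, reach j (one v) β ∧ ∃ m ∈ M β.ty, ∃ m' ∈ M m.ty, χ = β.comp (m.comp m')}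

theorem finite_wide (hM : MSys M) (h : ℕ) (v : D.W) : (wide M h v).Finite := by
  have : wide M h v ⊆ ⋃ j ∈ Set.Iic h, ⋃ β ∈ {β | reach j (one v) β}, ⋃ m ∈ M β.ty,
      (fun m' => β.comp (m.comp m')) '' M m.ty := by
    rintro _ ⟨j, hj, β, hβ, m, hm, m', hm', rfl⟩
    simp only [Set.mem_iUnion]
    exact ⟨j, hj, β, hβ, m, hm, m', hm', rfl⟩
  exact ((Set.finite_Iic h).biUnion fun j _ => (finite_reach j _).biUnion fun β _ =>
    (hM.fin _).biUnion fun m _ => (hM.fin _).image _).subset this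

theorem Sub.between {T : ∀ v, Set (D.Chart (some v))} {X' X X₁ V : Finset (D.Chart x)}
    (hX' : IsPart X') (hX₁ : IsPart X₁) (hV : IsPart V) (h : Sub T X' X) (h₁ : Sub T X' X₁)
    (hXV : Le X V) (hVX : Le V X₁) : Sub (fun v => ChartData.between (T v)) X' V := by
  intro ψ hψ
  obtain ⟨a, ha, hab⟩ := hXV ψ hψ
  obtain ⟨b, hb, hψb⟩ := hVX.exists_below hV hX₁ hψ
  obtain ⟨θ, hθ, a', ha', rfl⟩ := h a ha
  obtain ⟨η, hη, b', hb', rfl⟩ := h₁ b hb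
  obtain ⟨n, hn⟩ := hab
  obtain ⟨β, hβ, rfl⟩ := hn.exists_path
  obtain ⟨p, hp⟩ := (η.comp b').img_nonempty
  obtain rfl := hX'.disj θ hθ η hη p
    (img_comp_subset θ (a'.comp β) (hψb.img_subset hp)) (img_comp_subset _ _ hp)
  exact ⟨θ, hθ, a'.comp β, ⟨a', ha', b', hb', ⟨n, hβ.comp_left a'⟩,
    Below.comp_cancel (a := a'.comp β) hψb⟩, rfl⟩

variable {L : Type*} [Group L] {c : Finset (D.Chart x) → Finset (D.Chart x) → L}

/-- A family of potentials for `c`, one for each system of boxes. -/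
structure BoxSys (M : ∀ v, Set (D.Chart (some v))) (h : ℕ)
    (c : Finset (D.Chart x) → Finset (D.Chart x) → L)
    (Q : Finset (D.Chart x) → Finset (D.Chart x) → L) : Prop where
  sys : MSys M
  pos : 1 ≤ h
  deep : ∀ v, ∀ m ∈ M v, ∀ m' ∈ M m.ty,
    Bar (fun χ => ∃ β, reach h (one v) β ∧ ∃ n ∈ M β.ty, χ = β.comp n) (m.comp m')
  pot : ∀ X A B, IsPart X → Sub (fun v => between (wide M h v)) X A →
    Sub (fun v => between (wide M h v)) X B → Mv M A B → c A B = (Q X A)⁻¹ * Q X B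

/-- The value of passing from `X` to `Y`, where `Sub M X Y`. -/
def tval (Q : Finset (D.Chart x) → Finset (D.Chart x) → L) (X Y : Finset (D.Chart x)) : L :=
  (Q X X)⁻¹ * Q X Y

namespace BoxSys

variable {h : ℕ} {Q : Finset (D.Chart x) → Finset (D.Chart x) → L}

theorem mul_mem_wide {v} {m : D.Chart (some v)} (hm : m ∈ M v)
    {m'} (hm' : m' ∈ M m.ty) : m.comp m' ∈ wide M h v :=
  ⟨0, Nat.zero_le _, one v, rfl, m, hm, m', hm', rfl⟩

theorem mem_wide_path (hS : BoxSys M h c Q) {v} {j : ℕ} (hj : j ≤ h) {β : D.Chart (some v)}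
    (hβ : reach j (one v) β) {m} (hm : m ∈ M β.ty) : β.comp m ∈ wide M h v :=
  ⟨j, hj, β, hβ, m, hm, one _, hS.sys.one_mem _, rfl⟩

theorem mem_wide (hS : BoxSys M h c Q) {v} {m : D.Chart (some v)} (hm : m ∈ M v) :
    m ∈ wide M h v := mul_mem_wide hm (hS.sys.one_mem _)

theorem mem_wide_edge (hS : BoxSys M h c Q) {v} (e : D.Ed v) {m} (hm : m ∈ M (D.tgt e)) :
    (edge e).comp m ∈ wide M h v := hS.mem_wide_path hS.pos (β := edge e) ⟨e, rfl⟩ hm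

theorem sub_wide (hS : BoxSys M h c Q) {X Y : Finset (D.Chart x)} (hXY : Sub M X Y) :
    Sub (wide M h) X Y := hXY.mono fun _ _ hm => hS.mem_wide hm

theorem sub_self (hS : BoxSys M h c Q) (X : Finset (D.Chart x)) : Sub (wide M h) X X :=
  hS.sub_wide (.refl hS.sys.one_mem X)

theorem tval_eq (hS : BoxSys M h c Q) {X' X Y : Finset (D.Chart x)} (hX' : IsPart X')
    (hX : IsPart X) (hY : IsPart Y) (h1 : Sub (wide M h) X' X) (h2 : Sub (wide M h) X' Y)
    (hXY : Sub M X Y) : tval Q X Y = (Q X' X)⁻¹ * Q X' Y := by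
  have key : ∀ (Z : Finset (D.Chart x)), IsPart Z → Sub (wide M h) Z X → Sub (wide M h) Z Y →
      ∀ A B, A ⊆ X ∪ Y → B ⊆ X ∪ Y → Mv M A B → c A B = (Q Z A)⁻¹ * Q Z B := by
    intro Z hZ hZX hZY A B hA hB hAB
    have : ∀ A, A ⊆ X ∪ Y → Sub (fun v => between (wide M h v)) Z A := by
      intro A hA χ hχ
      obtain ⟨θ, hθ, m, hm, e⟩ : ∃ θ ∈ Z, ∃ m ∈ wide M h θ.ty, χ = θ.comp m :=
        (Finset.mem_union.1 (hA hχ)).elim (hZX χ) (hZY χ)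
      exact ⟨θ, hθ, m, subset_between _ hm, e⟩
    exact hS.pot Z A B hZ (this A hA) (this B hB) hAB
  have hc := hXY.chain hX hY
  unfold tval
  have : ∀ A B, A ⊆ X ∪ Y → B ⊆ X ∪ Y → Mv M A B →
      (Q X A)⁻¹ * Q X B = (Q X' A)⁻¹ * Q X' B := fun A B hA hB hAB => by
    rw [← key X hX (hS.sub_self X) (hS.sub_wide hXY) A B hA hB hAB,
      ← key X' hX' h1 h2 A B hA hB hAB]
  clear key
  have gen : ∀ Y', Relation.ReflTransGen (fun A B => IsPart A ∧ IsPart B ∧ A ⊆ X ∪ Y ∧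
      B ⊆ X ∪ Y ∧ Mv M A B) X Y' → (Q X X)⁻¹ * Q X Y' = (Q X' X)⁻¹ * Q X' Y' := by
    intro Y' hc
    induction hc with
    | refl => simp
    | @tail A B _ h ih =>
      have := this A B h.2.2.1 h.2.2.2.1 h.2.2.2.2
      calc (Q X X)⁻¹ * Q X B = ((Q X X)⁻¹ * Q X A) * ((Q X A)⁻¹ * Q X B) := by group
        _ = (Q X' X)⁻¹ * Q X' B := by rw [ih, this]; group
  exact gen Y hc

theorem up_eq (hS : BoxSys M h c Q) {X' X Y : Finset (D.Chart x)} {g : L} (hX' : IsPart X')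
    (hX : IsPart X) (h1 : Sub (wide M h) X' X) (h2 : Sub (wide M h) X' Y)
    (hg : Up c X Y g) : g = (Q X' X)⁻¹ * Q X' Y := by
  have hY := hg.isPart hX
  refine hg.eq_of_potential hX _ fun V φ hV hφ hle hle' => ?_
  refine hS.pot X' _ _ hX' (h1.between hX' hY hV h2 hle ((le_expand hφ).trans hle'))
    (h1.between hX' hY (isPart_expand hV hφ) h2 (hle.trans (le_expand hφ)) hle') ?_
  exact mv_expand hS.sys.edge_mem hV hφ

theorem tval_mul (hS : BoxSys M h c Q) {X Y Y' : Finset (D.Chart x)} {g : L} (hX : IsPart X)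
    (hY : IsPart Y) (h1 : Sub M X Y) (h2 : Sub M X Y') (hg : Up c Y Y' g) :
    tval Q X Y * g = tval Q X Y' := by
  rw [hS.up_eq hX hY (hS.sub_wide h1) (hS.sub_wide h2) hg, tval, tval]
  group

theorem tval_mv (hS : BoxSys M h c Q) {A B : Finset (D.Chart x)} (hA : IsPart A)
    (hAB : Mv M A B) (hs : Sub M A B) : c A B = tval Q A B :=
  hS.pot A A B hA ((hS.sub_self A).mono fun _ => subset_between _)
    ((hS.sub_wide hs).mono fun _ => subset_between _) hAB

theorem exists_expand (hS : BoxSys M h c Q) {X Y : Finset (D.Chart x)} (hX : IsPart X)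
    (hY : IsPart Y) (hXY : Sub M X Y) {θ : D.Chart x} (hθ : θ ∈ X) :
    ∃ Y' g, Up c Y Y' g ∧ Sub M (expand X θ) Y' ∧
      tval Q X Y * g = c X (expand X θ) * tval Q (expand X θ) Y' := by
  obtain ⟨Y', hY', hle, hR⟩ := hY.exists_le (R := fun χ =>
      (∃ η ∈ X, η ≠ θ ∧ ∃ m ∈ M η.ty, χ = η.comp m) ∨
      ∃ e : D.Ed θ.ty, ∃ m ∈ M (D.tgt e), χ = θ.comp ((edge e).comp m)) (by
    intro χ hχ
    obtain ⟨η, hη, m, hm, rfl⟩ := hXY χ hχ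
    by_cases e : η = θ
    · subst e
      refine (hS.sys.step _ m hm).comp_left η ?_
      rintro _ ⟨e, m', hm', rfl⟩
      exact Or.inr ⟨e, m', hm', rfl⟩
    · exact .here (Or.inl ⟨η, hη, e, m, hm, rfl⟩))
  obtain ⟨g, hg⟩ := hle.exists_up (c := c) hY hY'
  have hsub : Sub M (expand X θ) Y' := by
    intro χ hχ
    rcases hR χ hχ with ⟨η, hη, hne, m, hm, rfl⟩ | ⟨e, m, hm, rfl⟩
    · exact ⟨η, mem_expand.2 (Or.inl ⟨hne, hη⟩), m, hm, rfl⟩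
    · exact ⟨θ.comp (edge e), mem_expand.2 (Or.inr ⟨e, rfl⟩), m, hm, rfl⟩
  have hXY' : Sub (wide M h) X Y' := by
    intro χ hχ
    rcases hR χ hχ with ⟨η, hη, hne, m, hm, rfl⟩ | ⟨e, m, hm, rfl⟩
    · exact ⟨η, hη, m, hS.mem_wide hm, rfl⟩
    · exact ⟨θ, hθ, _, hS.mem_wide_edge e hm, rfl⟩
  have hXX' : Sub (wide M h) X (expand X θ) := by
    intro χ hχ
    rcases mem_expand.1 hχ with ⟨-, h'⟩ | ⟨e, rfl⟩
    · exact hS.sub_self X χ h'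
    · exact ⟨θ, hθ, edge e, hS.mem_wide (hS.sys.edge_mem _ e), rfl⟩
  have hX1 := isPart_expand hX hθ
  refine ⟨Y', g, hg, hsub, ?_⟩
  have e1 := hS.up_eq hX hX (hS.sub_self X) hXX' (.step hθ (.refl _))
  rw [mul_one] at e1
  rw [e1, hS.up_eq hX hY (hS.sub_wide hXY) hXY' hg, hS.tval_eq hX hX1 hY' hXX' hXY' hsub, tval]
  group

theorem exists_up (hS : BoxSys M h c Q) {X X₁ : Finset (D.Chart x)} {g : L} (hg : Up c X X₁ g) :
    ∀ {Y : Finset (D.Chart x)}, IsPart X → IsPart Y → Sub M X Y →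
      ∃ Y' g', Up c Y Y' g' ∧ Sub M X₁ Y' ∧ tval Q X Y * g' = g * tval Q X₁ Y' := by
  induction hg with
  | refl X => exact fun {Y} _ hY hXY => ⟨Y, 1, .refl Y, hXY, by simp⟩
  | @step X X₁ θ g hθ _ ih =>
    intro Y hX hY hXY
    obtain ⟨Y₁, g₁, hg₁, hs₁, e₁⟩ := hS.exists_expand hX hY hXY hθ
    obtain ⟨Y₂, g₂, hg₂, hs₂, e₂⟩ := ih (isPart_expand hX hθ) (hg₁.isPart hY) hs₁
    refine ⟨Y₂, g₁ * g₂, hg₁.trans hg₂, hs₂, ?_⟩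
    rw [← mul_assoc, e₁, mul_assoc, e₂, mul_assoc]

theorem exists_comp (hS : BoxSys M h c Q) {X Y Z : Finset (D.Chart x)} (hX : IsPart X)
    (hY : IsPart Y) (hZ : IsPart Z) (hXY : Sub M X Y) (hYZ : Sub M Y Z) :
    ∃ X' Z' u w, Up c X X' u ∧ Up c Z Z' w ∧ Sub M X' Z' ∧
      tval Q X Y * tval Q Y Z * w = u * tval Q X' Z' := by
  obtain ⟨X', hX', hle, hin, hout⟩ := exists_depth hX h
  have hXZ : ∀ χ ∈ Z, ∃ θ ∈ X, ∃ m ∈ M θ.ty, ∃ m' ∈ M m.ty, χ = θ.comp (m.comp m') := by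
    intro χ hχ
    obtain ⟨η, hη, m', hm', rfl⟩ := hYZ χ hχ
    obtain ⟨θ, hθ, m, hm, rfl⟩ := hXY η hη
    exact ⟨θ, hθ, m, hm, m', hm', rfl⟩
  obtain ⟨Z', hZ', hle', hR⟩ := hZ.exists_le (R := fun χ => ∃ θ ∈ X, ∃ β, reach h (one θ.ty) β ∧
      ∃ n ∈ M β.ty, χ = θ.comp (β.comp n)) (by
    intro χ hχ
    obtain ⟨θ, hθ, m, hm, m', hm', rfl⟩ := hXZ χ hχ
    refine (hS.deep _ m hm m' hm').comp_left θ ?_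
    rintro _ ⟨β, hβ, n, hn, rfl⟩
    exact ⟨θ, hθ, β, hβ, n, hn, rfl⟩)
  obtain ⟨u, hu⟩ := hle.exists_up (c := c) hX hX'
  obtain ⟨w, hw⟩ := hle'.exists_up (c := c) hZ hZ'
  have hsub : Sub M X' Z' := by
    intro χ hχ
    obtain ⟨θ, hθ, β, hβ, n, hn, rfl⟩ := hR χ hχ
    exact ⟨θ.comp β, hin θ hθ _ (hβ.comp_left θ), n, hn, rfl⟩
  have s1 : Sub (wide M h) X X' := by
    intro χ hχ
    obtain ⟨θ, hθ, hr⟩ := hout χ hχ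
    obtain ⟨β, hβ, rfl⟩ := hr.exists_path
    exact ⟨θ, hθ, β, hS.mem_wide_path le_rfl hβ (hS.sys.one_mem _), rfl⟩
  have s2 : Sub (wide M h) X Z := by
    intro χ hχ
    obtain ⟨θ, hθ, m, hm, m', hm', rfl⟩ := hXZ χ hχ
    exact ⟨θ, hθ, _, mul_mem_wide hm hm', rfl⟩
  have s3 : Sub (wide M h) X Z' := by
    intro χ hχ
    obtain ⟨θ, hθ, β, hβ, n, hn, rfl⟩ := hR χ hχ
    exact ⟨θ, hθ, _, hS.mem_wide_path le_rfl hβ hn, rfl⟩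
  have s0 := hS.sub_self X
  have sY := hS.sub_wide hXY
  refine ⟨X', Z', u, w, hu, hw, hsub, ?_⟩
  rw [hS.tval_eq hX hX' hZ' s1 s3 hsub, hS.up_eq hX hX s0 s1 hu, hS.up_eq hX hZ s2 s3 hw,
    hS.tval_eq hX hY hZ sY s2 hYZ, tval]
  group

/-- `g` is the value of a zigzag from `B₀` to `A`. -/
def Frac (M : ∀ v, Set (D.Chart (some v))) (c Q : Finset (D.Chart x) → Finset (D.Chart x) → L)
    (B₀ A : Finset (D.Chart x)) (g : L) : Prop :=
  ∃ X Y u w, Up c B₀ X u ∧ Up c A Y w ∧ Sub M X Y ∧ g = u * tval Q X Y * w⁻¹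

theorem frac_unique (hD : D.Good) (hsq : ExpandSquares c) (hS : BoxSys M h c Q)
    {B₀ A : Finset (D.Chart x)} (hB₀ : IsPart B₀) (hA : IsPart A) {g g' : L}
    (hg : Frac M c Q B₀ A g) (hg' : Frac M c Q B₀ A g') : g = g' := by
  obtain ⟨X₁, Y₁, u₁, w₁, hu₁, hw₁, hs₁, rfl⟩ := hg
  obtain ⟨X₂, Y₂, u₂, w₂, hu₂, hw₂, hs₂, rfl⟩ := hg'
  have hX₁ := hu₁.isPart hB₀
  have hX₂ := hu₂.isPart hB₀
  have hX := hD.isPart_join hB₀ hX₁ hX₂ hu₁.le hu₂.le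
  obtain ⟨a₁, ha₁⟩ := (le_join X₁ X₂).exists_up (c := c) hX₁ hX
  obtain ⟨a₂, ha₂⟩ := (le_join' X₁ X₂).exists_up (c := c) hX₂ hX
  have hY₁ := hw₁.isPart hA
  have hY₂ := hw₂.isPart hA
  obtain ⟨Z₁, b₁, hb₁, hr₁, e₁⟩ := hS.exists_up ha₁ hX₁ hY₁ hs₁
  obtain ⟨Z₂, b₂, hb₂, hr₂, e₂⟩ := hS.exists_up ha₂ hX₂ hY₂ hs₂
  have hZ₁ := hb₁.isPart hY₁
  have hZ₂ := hb₂.isPart hY₂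
  have hZ := hD.isPart_join hA hZ₁ hZ₂ (hw₁.trans hb₁).le (hw₂.trans hb₂).le
  obtain ⟨d₁, hd₁⟩ := (le_join Z₁ Z₂).exists_up (c := c) hZ₁ hZ
  obtain ⟨d₂, hd₂⟩ := (le_join' Z₁ Z₂).exists_up (c := c) hZ₂ hZ
  have hr : Sub M (join X₁ X₂) (join Z₁ Z₂) := fun χ hχ =>
    (Finset.mem_union.1 (join_subset _ _ hχ)).elim (hr₁ χ) (hr₂ χ)
  have f₁ := hS.tval_mul hX hZ₁ hr₁ hr hd₁
  have f₂ := hS.tval_mul hX hZ₂ hr₂ hr hd₂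
  have k₁ := Up.unique hD hsq hB₀ (hu₁.trans ha₁) (hu₂.trans ha₂)
  have k₂ := Up.unique hD hsq hA ((hw₁.trans hb₁).trans hd₁) ((hw₂.trans hb₂).trans hd₂)
  have E : ∀ (u t b a t' w d T : L), t * b = a * t' → t' * d = T →
      u * t * w⁻¹ = (u * a) * T * (w * b * d)⁻¹ := by
    rintro u t b a t' w d _ h1 rfl
    rw [eq_mul_inv_of_mul_eq h1]
    group
  rw [E _ _ _ _ _ w₁ _ _ e₁ f₁, E _ _ _ _ _ w₂ _ _ e₂ f₂, k₁, k₂]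

theorem frac_mv (hS : BoxSys M h c Q) {B₀ A B : Finset (D.Chart x)} (hB₀ : IsPart B₀)
    (hA : IsPart A) (hB : IsPart B) {g : L} (hg : Frac M c Q B₀ A g) (hAB : Mv M A B) :
    Frac M c Q B₀ B (g * c A B) := by
  have hs : Sub M A B := by
    obtain ⟨R, θ, P, hR, hP, hM, rfl, rfl⟩ := hAB
    intro χ hχ
    rcases mem_plug.1 hχ with h | ⟨m, hm, rfl⟩
    · exact ⟨χ, Finset.mem_insert_of_mem h, one _, hS.sys.one_mem _, rfl⟩
    · exact ⟨θ, Finset.mem_insert_self _ _, m, hM m hm, rfl⟩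
  obtain ⟨X, Y, u, w, hu, hw, hXY, rfl⟩ := hg
  have hX := hu.isPart hB₀
  have hY := hw.isPart hA
  obtain ⟨B', b, hb, hYB, e₁⟩ := hS.exists_up hw hA hB hs
  obtain ⟨X', B'', a, b', ha, hb', hs', e₂⟩ := hS.exists_comp hX hY (hb.isPart hB) hXY hYB
  refine ⟨X', B'', u * a, b * b', hu.trans ha, hb.trans hb', hs', ?_⟩
  rw [hS.tval_mv hA hAB hs, eq_mul_inv_of_mul_eq e₁, mul_assoc u a, ← e₂]
  group

theorem exists_potential (hD : D.Good) (hsq : ExpandSquares c) (hS : BoxSys M h c Q)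
    {B₀ : Finset (D.Chart x)} (hB₀ : IsPart B₀) : ∃ p : Finset (D.Chart x) → L,
      ∀ A B, IsPart A → IsPart B → Mv M A B → p A * c A B = p B := by
  have hex : ∀ A : Finset (D.Chart x), ∃ g, IsPart A → Frac M c Q B₀ A g := by
    intro A
    by_cases hA : IsPart A
    · obtain ⟨X, Y, hX, hY, h1, h2, h3⟩ := hS.sys.exists_fraction hD hB₀ hA
      obtain ⟨u, hu⟩ := h1.exists_up (c := c) hB₀ hX
      obtain ⟨w, hw⟩ := h2.exists_up (c := c) hA hY
      exact ⟨_, fun _ => ⟨X, Y, u, w, hu, hw, h3, rfl⟩⟩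
    · exact ⟨1, fun h => absurd h hA⟩
  choose p hp using hex
  refine ⟨p, fun A B hA hB hAB => ?_⟩
  exact hS.frac_unique hD hsq hB₀ hB (hS.frac_mv hB₀ hA hB (hp A hA) hAB) (hp B hB)

end BoxSys

end ChartData

namespace ChartData

open Chart

variable {D : ChartData} {x : Option D.W} {M : ∀ v, Set (D.Chart (some v))}

theorem MSys.exists_depth_mul (hM : MSys M) : ∃ h, 1 ≤ h ∧ ∀ v, ∀ m ∈ M v, ∀ m' ∈ M m.ty,
    Bar (fun χ => ∃ β, reach h (one v) β ∧ ∃ n ∈ M β.ty, χ = β.comp n) (m.comp m') := by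
  obtain ⟨h, hh⟩ := exists_uniform (fun v => ⋃ m ∈ M v, m.comp '' M m.ty)
    (fun v => (hM.fin v).biUnion fun m _ => (hM.fin _).image _)
    (fun v h m => ∀ k ≥ h, Bar (fun χ => ∃ β, reach k (one v) β ∧
      ∃ m' ∈ M β.ty, χ = β.comp m') m)
    (fun v n k m hnk h j hj => h j (hnk.trans hj)) (fun v m _ => hM.deep_ge m)
  refine ⟨h + 1, by omega, fun v m hm m' hm' => hh v _ ?_ _ (Nat.le_succ h)⟩
  simp only [Set.mem_iUnion]
  exact ⟨m, hm, m', hm', rfl⟩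

theorem MSys.exists_walk_bound (hD : D.Good) (hM : MSys M) (T : ∀ v, Set (D.Chart (some v)))
    (hT : ∀ v, (T v).Finite) : ∃ k, ∀ v, ∀ P : Finset (D.Chart (some v)), IsPart P →
      (∀ m ∈ P, m ∈ T v) → ∃ l, l.length ≤ k ∧ IsWalk (Adj M) {one v} l P := by
  have h1 : ∀ v (P : Finset (D.Chart (some v))), ∃ l, IsPart P → IsWalk (Adj M) {one v} l P := by
    intro v P
    by_cases hP : IsPart P
    · obtain ⟨l, hl⟩ := exists_isWalk (hM.reflTransGen hD (isPart_one v) hP)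
      exact ⟨l, fun _ => hl⟩
    · exact ⟨[], fun h => absurd h hP⟩
  choose l hl using h1
  have h2 : ∀ v, ∃ k, ∀ P : Finset (D.Chart (some v)), (∀ m ∈ P, m ∈ T v) →
      (l v P).length ≤ k := by
    intro v
    refine ⟨((hT v).toFinset.powerset).sup fun P => (l v P).length, fun P hP => ?_⟩
    exact Finset.le_sup (f := fun P => (l v P).length)
      (Finset.mem_powerset.2 fun m hm => (hT v).mem_toFinset.2 (hP m hm))
  choose k hk using h2
  let _ := D.fintypeW
  exact ⟨Finset.univ.sup k, fun v P hP hPT =>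
    ⟨l v P, (hk v P hPT).trans (Finset.le_sup (Finset.mem_univ v)), hl v P hP⟩⟩

variable {L : Type*} [Group L] {c : Finset (D.Chart x) → Finset (D.Chart x) → L}

theorem exists_pot {K k₀ : ℕ} (hK : 4 ≤ K) (hk : 2 * k₀ + 1 ≤ K) (hc : TrivLoops (Adj M) K c)
    {T : ∀ v, Set (D.Chart (some v))}
    (hT : ∀ v, ∀ P : Finset (D.Chart (some v)), IsPart P → (∀ m ∈ P, m ∈ T v) →
      ∃ l, l.length ≤ k₀ ∧ IsWalk (Adj M) {one v} l P)
    {X : Finset (D.Chart x)} (hX : IsPart X) : ∃ Q : Finset (D.Chart x) → L, ∀ A B,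
      Sub T X A → Sub T X B → Mv M A B → c A B = (Q A)⁻¹ * Q B := by
  obtain ⟨Q, hQ⟩ := exists_box_potential hK hk hc
    (fun v => {P | IsPart P ∧ ∀ m ∈ P, m ∈ T v}) (fun v P hP => hT v P hP.1 hP.2) hX X subset_rfl
  let f : Finset (D.Chart x) → ∀ θ : D.Chart x, Finset (D.Chart (some θ.ty)) := fun Y θ =>
    if θ ∈ X then coord Y θ else {one θ.ty}
  have hf : ∀ Y, Sub T X Y → plugAll X (f Y) = Y := fun Y hY => by
    rw [plugAll_congr (g := coord Y) fun θ hθ => by simp [f, hθ], hY.plugAll_coord]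
  refine ⟨fun Y => Q (f Y), fun A B hA hB hAB => ?_⟩
  have hadj := hAB.adj
  obtain ⟨θ, hθ, hm, hne⟩ := hAB.exists_coord hX hA
  have e : f B = Function.update (f A) θ (coord B θ) := by
    funext η
    by_cases e : η = θ
    · subst e
      simp [f, hθ]
    · rw [Function.update_of_ne e]
      by_cases h : η ∈ X
      · simp [f, h, hne η h e]
      · simp [f, h]
  have hmem : ∀ Y, IsPart Y → Sub T X Y → ∀ θ ∈ X, IsPart (coord Y θ) ∧
      ∀ m ∈ coord Y θ, m ∈ T θ.ty := fun Y hY hs θ hθ =>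
    ⟨hs.isPart_coord hX hY hθ, fun m hm => hs.mem_of_mem_coord hX hθ hm⟩
  have := hQ (f A) (fun θ hθ => by simpa [f, hθ] using hmem A hadj.1 hA θ hθ)
    (fun θ hθ => by simp [f, hθ]) θ hθ (coord B θ) (hmem B hadj.2.1 hB θ hθ)
    (by simpa [f, hθ] using hm.adj)
  rwa [← e, hf A hA, hf B hB] at this

theorem expandSquares {K : ℕ} (hM : MSys M) (hK : 4 ≤ K) (hc : TrivLoops (Adj M) K c) :
    ExpandSquares c := by
  intro B φ ψ hB hφ hψ hne
  have hψ' : ψ ∈ expand B φ := mem_expand.2 (Or.inl ⟨Ne.symm hne, hψ⟩)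
  have hφ' : φ ∈ expand B ψ := mem_expand.2 (Or.inl ⟨hne, hφ⟩)
  have a1 := (mv_expand hM.edge_mem hB hφ).adj
  have a2 := (mv_expand hM.edge_mem (isPart_expand hB hφ) hψ').adj
  have a3 := (mv_expand hM.edge_mem hB hψ).adj
  have a4 := (mv_expand hM.edge_mem (isPart_expand hB hψ) hφ').adj
  rw [← expand_comm hB hφ hψ hne] at a4
  exact hc.square hK a1 a2 a3 a4 a3.symm a4.symm

/-- Cocycles on the graph of all partitions with trivial short loops are coboundaries. -/
theorem Good.exists_mSys_potential (hD : D.Good) (A : ∀ v, Set (D.Chart (some v)))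
    (hA : ∀ v, (A v).Finite) (h1 : ∀ v, one v ∈ A v) (hE : ∀ v (e : D.Ed v), edge e ∈ A v) :
    ∃ M : ∀ v, Set (D.Chart (some v)), MSys M ∧ (∀ v, A v ⊆ M v) ∧ ∃ K, 4 ≤ K ∧
      ∀ {x : Option D.W} {B₀ : Finset (D.Chart x)}, IsPart B₀ → ∀ {L : Type} [Group L]
        (c : Finset (D.Chart x) → Finset (D.Chart x) → L), TrivLoops (Adj M) K c →
        ∃ p : Finset (D.Chart x) → L, ∀ A B, Adj M A B → p A * c A B = p B := by
  obtain ⟨M, hM, hAM⟩ := hD.exists_mSys A hA h1 hE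
  obtain ⟨h, hpos, hdeep⟩ := hM.exists_depth_mul
  obtain ⟨k, hk⟩ := hM.exists_walk_bound hD (fun v => between (wide M h v))
    (fun v => hD.finite_between (finite_wide hM h v))
  refine ⟨M, hM, hAM, 2 * k + 4, by omega, fun {x B₀} hB₀ L _ c hc => ?_⟩
  have hQ : ∀ X : Finset (D.Chart x), ∃ Q : Finset (D.Chart x) → L, IsPart X → ∀ A B,
      Sub (fun v => between (wide M h v)) X A → Sub (fun v => between (wide M h v)) X B →
      Mv M A B → c A B = (Q A)⁻¹ * Q B := by
    intro X
    by_cases hX : IsPart X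
    · obtain ⟨Q, hQ⟩ := exists_pot (by omega) (by omega) hc hk hX
      exact ⟨Q, fun _ => hQ⟩
    · exact ⟨1, fun h => absurd h hX⟩
  choose Q hQ using hQ
  have hS : BoxSys M h c Q := ⟨hM, hpos, hdeep, fun X A B hX => hQ X hX A B⟩
  obtain ⟨p, hp⟩ := hS.exists_potential hD (expandSquares hM (by omega) hc) hB₀
  refine ⟨p, fun A B hAB => ?_⟩
  rcases hAB.2.2 with rfl | h | h
  · rw [hc.self (by omega) hAB, mul_one]
  · exact hp A B hAB.1 hAB.2.1 h
  · rw [hc.symm (by omega) hAB.symm hAB, ← hp B A hAB.2.1 hAB.1 h, mul_inv_cancel_right]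

end ChartData

section Walks

variable {X : Type*}

theorem wval_map {Y L : Type*} [Group L] (c : Y → Y → L) (f : X → Y) :
    ∀ (l : List X) (a : X), wval (fun a b => c (f a) (f b)) a l = wval c (f a) (l.map f)
  | [], _ => rfl
  | _ :: l, _ => by simp only [wval, List.map_cons, wval_map c f l]

theorem IsWalk.map {Y : Type*} {adj : X → X → Prop} {adj' : Y → Y → Prop} {f : X → Y}
    (hf : ∀ a b, adj a b → adj' (f a) (f b)) :
    ∀ {l : List X} {a b : X}, IsWalk adj a l b → IsWalk adj' (f a) (l.map f) (f b)
  | [], _, _, h => congrArg f h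
  | _ :: _, _, _, h => ⟨hf _ _ h.1, h.2.map hf⟩

theorem map_wval {L L' : Type*} [Group L] [Group L'] (f : L →* L') (c : X → X → L) :
    ∀ (l : List X) (a : X), f (wval c a l) = wval (fun a b => f (c a b)) a l
  | [], _ => map_one f
  | _ :: l, _ => by simp only [wval, map_mul, map_wval f c l]

theorem IsWalk.wval_mem {L : Type*} [Group L] {adj : X → X → Prop} {c : X → X → L} {S : Set L}
    (hS : ∀ a b, adj a b → c a b ∈ S) :
    ∀ {l : List X} {a b : X}, IsWalk adj a l b →
      ∃ m : List S, m.length = l.length ∧ (m.map Subtype.val).prod = wval c a l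
  | [], _, _, _ => ⟨[], rfl, rfl⟩
  | d :: _, a, _, h => by
    obtain ⟨m, hm, hm'⟩ := h.2.wval_mem hS
    exact ⟨⟨c a d, hS _ _ h.1⟩ :: m, by simp [hm], by rw [List.map_cons, List.prod_cons, hm', wval]⟩

theorem IsWalk.wval_eq {L : Type*} [Group L] {adj : X → X → Prop} {c : X → X → L} {q : X → L}
    (hq : ∀ a b, adj a b → q a * c a b = q b) :
    ∀ {l : List X} {a b : X}, IsWalk adj a l b → q a * wval c a l = q b
  | [], _, _, h => by cases h; simp [wval]
  | _ :: _, _, _, h => by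
    rw [wval, ← mul_assoc, hq _ _ h.1, h.2.wval_eq hq]

/-- Every cocycle with trivial short loops is a coboundary. -/
def Potentials (adj : X → X → Prop) (K : ℕ) : Prop :=
  ∀ {L : Type} [Group L] (c : X → X → L), TrivLoops adj K c →
    ∃ p : X → L, ∀ a b, adj a b → p a * c a b = p b

variable {V : Type*} {adj : V → V → Prop} {K : ℕ} {f : X → V}

theorem Potentials.comap (h : Potentials adj K) (hK : 4 ≤ K) (hr : ∀ a, adj a a)
    (hs : ∀ a b, adj a b → adj b a) (hf : Function.Surjective f) :
    Potentials (fun a b => adj (f a) (f b)) K := by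
  intro L _ c hc
  obtain ⟨s, hs'⟩ := hf.hasRightInverse
  replace hs' : ∀ a, f (s a) = a := hs'
  obtain ⟨p, hp⟩ := h (fun a b => c (s a) (s b)) (by
    intro a l hl hw
    rw [wval_map]
    exact hc _ _ (by simpa using hl) (hw.map (by intro a b; simp only [hs']; exact id)))
  refine ⟨fun x => p (f x) * c (s (f x)) x, fun a b hab => ?_⟩
  show p (f a) * c (s (f a)) a * c a b = p (f b) * c (s (f b)) b
  rw [← hp _ _ hab, mul_assoc, mul_assoc]
  congr 1
  have hs'' := hs _ _ hab
  apply hc.square hK <;> first | exact hab | exact hs'' | (simp only [hs', hr]; done) |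
    simpa only [hs'] using hab |
    simpa only [hs'] using hs''

theorem reflTransGen_comap (hr : ∀ a, adj a a) (hf : Function.Surjective f)
    (h : ∀ a b, Relation.ReflTransGen adj a b) (x y : X) :
    Relation.ReflTransGen (fun a b => adj (f a) (f b)) x y := by
  suffices ∀ b, Relation.ReflTransGen adj (f x) b → ∀ y, f y = b →
      Relation.ReflTransGen (fun a b => adj (f a) (f b)) x y from this _ (h _ _) y rfl
  intro b hb
  induction hb with
  | refl => exact fun y hy => .single (by rw [hy]; exact hr _)
  | @tail b b' _ hbb ih =>
    intro y hy
    obtain ⟨z, hz⟩ := hf b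
    exact (ih z hz).tail (by rw [hz, hy]; exact hbb)

end Walks

theorem Group.IsFinitelyPresented.of_leftInverse {L G : Type*} [Group L] [Group G]
    [Group.IsFinitelyPresented L] (f : L →* G) (s : G →* L) (h : Function.LeftInverse f s) :
    Group.IsFinitelyPresented G := by
  obtain ⟨n, φ, hφ, -⟩ := Group.IsFinitelyPresented.out (G := L)
  set S : Set L := Set.range fun i => (φ (.of i))⁻¹ * s (f (φ (.of i)))
  refine .of_surjective f h.surjective ⟨S, Set.finite_range _, le_antisymm ?_ ?_⟩
  · refine Subgroup.normalClosure_le_normal ?_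
    rintro _ ⟨i, rfl⟩
    simp [MonoidHom.mem_ker, h (f _)]
  · intro l hl
    have key : (QuotientGroup.mk' (Subgroup.normalClosure S)).comp φ =
        (QuotientGroup.mk' (Subgroup.normalClosure S)).comp ((s.comp f).comp φ) := by
      ext i
      refine (QuotientGroup.eq).2 (Subgroup.subset_normalClosure ⟨i, rfl⟩)
    obtain ⟨w, rfl⟩ := hφ l
    have := DFunLike.congr_fun key w
    simp only [MonoidHom.comp_apply, MonoidHom.mem_ker.1 hl, map_one] at this
    exact (QuotientGroup.eq_one_iff _).1 this

theorem Group.IsFinitelyPresented.of_potentials {G R : Type} {V : Type*} [Group G] [MulAction G V]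
    [Nonempty V] [Finite R] (v : R → V) (hv : ∀ a : V, ∃ (g : G) (r : R), g • v r = a)
    {adj : V → V → Prop} (hr : ∀ a, adj a a) (hs : ∀ a b, adj a b → adj b a)
    (hinv : ∀ (g : G) a b, adj (g • a) (g • b) ↔ adj a b)
    (hcon : ∀ a b, Relation.ReflTransGen adj a b)
    (hfin : ∀ r r' : R, {h : G | adj (v r) (h • v r')}.Finite) {K : ℕ} (hK : 4 ≤ K)
    (hpot : Potentials adj K) : Group.IsFinitelyPresented G := by
  set f : R × G → V := fun x => x.2 • v x.1 with hf
  have hfs : Function.Surjective f := fun a => by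
    obtain ⟨g, r, h⟩ := hv a
    exact ⟨(r, g), h⟩
  set T : Set (R × R × G) := {t | adj (v t.1) (t.2.2 • v t.2.1)} with hT
  have hTfin : T.Finite := by
    refine (Set.finite_iUnion fun r : R => Set.finite_iUnion fun r' : R =>
      (hfin r r').image fun h => (r, r', h)).subset ?_
    rintro ⟨r, r', h⟩ ht
    exact Set.mem_iUnion.2 ⟨r, Set.mem_iUnion.2 ⟨r', h, ht, rfl⟩⟩
  have := hTfin.to_subtype
  set adj' : R × G → R × G → Prop := fun a b => adj (f a) (f b) with hadj'
  have hmem : ∀ a b, adj' a b ↔ (a.1, b.1, a.2⁻¹ * b.2) ∈ T := by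
    intro a b
    show _ ↔ adj (v a.1) ((a.2⁻¹ * b.2) • v b.1)
    rw [← hinv a.2, smul_smul, mul_inv_cancel_left]
  set c₀ : R × G → R × G → FreeGroup T := fun a b =>
    if h : (a.1, b.1, a.2⁻¹ * b.2) ∈ T then .of ⟨_, h⟩ else 1 with hc₀
  set rels : Set (FreeGroup T) :=
    {w | ∃ a l, l.length ≤ K ∧ IsWalk adj' a l a ∧ wval c₀ a l = w} with hrels
  have hrfin : rels.Finite := by
    set S : Set (FreeGroup T) := Set.range FreeGroup.of
    have : Finite S := (Set.finite_range _).to_subtype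
    refine ((List.finite_length_le S K).image fun m => (m.map Subtype.val).prod).subset ?_
    rintro _ ⟨a, l, hl, hw, rfl⟩
    obtain ⟨m, hm, hm'⟩ := hw.wval_mem (S := S) (c := c₀) (by
      intro a b hab
      rw [hmem] at hab
      exact ⟨⟨_, hab⟩, by simp only [hc₀, hab, dif_pos]⟩)
    exact ⟨m, by rw [Set.mem_ofPred_eq, hm]; exact hl, hm'⟩
  have := hrfin.to_subtype
  set c : R × G → R × G → PresentedGroup rels := fun a b => PresentedGroup.mk rels (c₀ a b) with hc
  obtain ⟨p, hp⟩ := hpot.comap hK hr hs hfs (L := PresentedGroup rels) c (by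
    intro a l hl hw
    rw [hc, ← map_wval]
    exact (QuotientGroup.eq_one_iff _).2 (Subgroup.subset_normalClosure ⟨a, l, hl, hw, rfl⟩))
  have hcon' := reflTransGen_comap hr hfs hcon
  set e : FreeGroup T →* G := FreeGroup.lift fun t => t.1.2.2 with he
  have he' : ∀ a b, adj' a b → a.2 * e (c₀ a b) = b.2 := by
    intro a b hab
    rw [hmem] at hab
    simp [he, hc₀, dif_pos hab]
  set π : PresentedGroup rels →* G := PresentedGroup.toGroup (f := fun t : T => t.1.2.2) (by
    rintro _ ⟨a, l, -, hw, rfl⟩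
    show e _ = 1
    rw [map_wval]
    have := hw.wval_eq (c := fun a b => e (c₀ a b)) (q := Prod.snd) he'
    exact mul_left_cancel (this.trans (mul_one _).symm)) with hπ
  have hπe : ∀ w, π (PresentedGroup.mk rels w) = e w := fun w => rfl
  obtain ⟨x₀⟩ : Nonempty (R × G) := (hfs (Classical.arbitrary V)).nonempty
  have hceq : ∀ (g : G) a b, c (a.1, g * a.2) (b.1, g * b.2) = c a b := by
    intro g a b
    simp only [hc, hc₀, mul_inv_rev, mul_assoc, inv_mul_cancel_left]
  have hadjeq : ∀ (g : G) a b, adj' a b → adj' (a.1, g * a.2) (b.1, g * b.2) := by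
    intro g a b hab
    show adj ((g * a.2) • _) ((g * b.2) • _)
    rw [mul_smul, mul_smul, hinv]
    exact hab
  have hconst : ∀ {H : Type} (F : R × G → H), (∀ a b, adj' a b → F a = F b) → ∀ a b, F a = F b := by
    intro H F hF a b
    induction hcon' a b with
    | refl => rfl
    | tail _ h ih => exact ih.trans (hF _ _ h)
  have hind : ∀ (h : G) a b, p (a.1, h * a.2) * (p a)⁻¹ = p (b.1, h * b.2) * (p b)⁻¹ := by
    intro h a b
    refine hconst (fun a : R × G => p (a.1, h * a.2) * (p a)⁻¹) (fun a b hab => ?_) a b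
    show _ = p (b.1, h * b.2) * (p b)⁻¹
    rw [← hp a b hab, ← hp _ _ (hadjeq h a b hab), hceq]
    group
  have hκ : ∀ a b : R × G, π (p a) * a.2⁻¹ = π (p b) * b.2⁻¹ := by
    refine hconst (fun a : R × G => π (p a) * a.2⁻¹) fun a b hab => ?_
    show _ = π (p b) * b.2⁻¹
    rw [← hp a b hab, map_mul, hc, hπe, ← he' a b hab]
    group
  set ρ : G →* PresentedGroup rels := MonoidHom.mk' (fun h => p (x₀.1, h * x₀.2) * (p x₀)⁻¹) (by
    intro g h
    rw [hind g x₀ (x₀.1, h * x₀.2)]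
    simp only [mul_assoc]
    group) with hρ
  set κ : G := π (p x₀) * x₀.2⁻¹
  refine .of_leftInverse ((MulAut.conj κ⁻¹).toMonoidHom.comp π) ρ fun h => ?_
  have h1 := hκ (x₀.1, h * x₀.2) x₀
  show κ⁻¹ * π (p (x₀.1, h * x₀.2) * (p x₀)⁻¹) * κ⁻¹⁻¹ = h
  have h2 : π (p (x₀.1, h * x₀.2)) = κ * (h * x₀.2) := mul_inv_eq_iff_eq_mul.1 h1
  have h3 : π (p x₀) = κ * x₀.2 := mul_inv_eq_iff_eq_mul.1 rfl
  rw [map_mul, map_inv, h2, h3]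
  group

namespace ChartData

open Chart

variable {D : ChartData} {x : Option D.W}

theorem IsPart.image_push {A : Finset (D.Chart x)} (hA : IsPart A) {x' : Option D.W}
    {T : D.pt x → D.pt x'} (h : Adm T) (hT : Function.Surjective T) :
    IsPart (A.image h.push) where
  cover p := by
    obtain ⟨q, rfl⟩ := hT p
    obtain ⟨φ, hφ, y, rfl⟩ := hA.cover q
    exact ⟨h.push φ, Finset.mem_image_of_mem _ hφ, y, rfl⟩
  disj := by
    simp only [Finset.forall_mem_image]
    intro φ hφ ψ hψ p hp hp'
    obtain ⟨y, rfl⟩ := hp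
    obtain ⟨y', hy⟩ := hp'
    rw [hA.disj φ hφ ψ hψ (φ.fn y) ⟨y, rfl⟩ ⟨y', h.inj hy⟩]

theorem Mv.image_push {M : ∀ v, Set (D.Chart (some v))} {A B : Finset (D.Chart x)} (hm : Mv M A B)
    {x' : Option D.W} {T : D.pt x → D.pt x'} (h : Adm T) (hT : Function.Surjective T) :
    Mv M (A.image h.push) (B.image h.push) := by
  obtain ⟨R, θ, P, hc, hP, hPM, rfl, rfl⟩ := hm
  refine ⟨R.image h.push, h.push θ, P, ⟨?_, ?_⟩, hP, hPM, ?_, ?_⟩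
  · rw [← Finset.image_insert]
    exact hc.1.image_push h hT
  · rw [Finset.mem_image]
    rintro ⟨φ, hφ, he⟩
    exact hc.2 (h.push_injective he ▸ hφ)
  · rw [Finset.image_insert]
  · simp only [plug, Finset.image_union, Finset.image_image]
    rfl

theorem Adj.image_push {M : ∀ v, Set (D.Chart (some v))} {A B : Finset (D.Chart x)}
    (hm : Adj M A B) {x' : Option D.W} {T : D.pt x → D.pt x'} (h : Adm T)
    (hT : Function.Surjective T) : Adj M (A.image h.push) (B.image h.push) := by
  refine ⟨hm.1.image_push h hT, hm.2.1.image_push h hT, ?_⟩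
  rcases hm.2.2 with rfl | hm | hm
  · exact Or.inl rfl
  · exact Or.inr (Or.inl (hm.image_push h hT))
  · exact Or.inr (Or.inr (hm.image_push h hT))

theorem finite_mv {M : ∀ v, Set (D.Chart (some v))} (hM : ∀ v, (M v).Finite)
    (A : Finset (D.Chart x)) : {B | Mv M A B}.Finite := by
  refine (A.finite_toSet.biUnion fun θ _ =>
    (hM θ.ty).toFinset.powerset.finite_toSet.image (plug (A.erase θ) θ)).subset ?_
  rintro _ ⟨R, θ, P, hc, hP, hPM, rfl, rfl⟩
  refine Set.mem_biUnion (Finset.mem_insert_self θ R) ⟨P, ?_, ?_⟩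
  · simpa [Set.subset_def] using hPM
  · rw [Finset.erase_insert hc.2]

theorem exists_lift_walk {M : ∀ v, Set (D.Chart (some v))} {n : ℕ} {L : Type} [Group L]
    {V : Set (Finset (D.Chart x))} (hV : ∀ A B, AdjLe M n A B → B ∈ V) (c : V → V → L)
    (c' : Finset (D.Chart x) → Finset (D.Chart x) → L) (hc : ∀ a b : V, c' a b = c a b) :
    ∀ (l : List (Finset (D.Chart x))) (a : V) (b : Finset (D.Chart x)),
      IsWalk (AdjLe M n) a.1 l b → ∃ (l' : List V) (b' : V), b'.1 = b ∧ l'.length = l.length ∧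
        IsWalk (fun a b : V => AdjLe M n a.1 b.1) a l' b' ∧ wval c a l' = wval c' a l
  | [], a, b, h => ⟨[], a, h, rfl, rfl, rfl⟩
  | d :: l, a, b, h => by
    obtain ⟨l', b', hb, hl, hw, hv⟩ := exists_lift_walk hV c c' hc l ⟨d, hV _ _ h.1⟩ b h.2
    exact ⟨⟨d, hV _ _ h.1⟩ :: l', b', hb, by simp [hl], ⟨h.1, hw⟩, by rw [wval, hv, wval, ← hc]⟩

variable {G : Subgroup (Equiv.Perm (D.pt none))}

theorem Good.exists_perm (hD : D.Good)
    (hfull : ∀ T : Equiv.Perm (D.pt none), ∀ P : Finset (D.Chart none), IsPart P →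
      (∀ φ ∈ P, T ∘ φ.fn ∈ D.M φ.ty none) → T ∈ G)
    {A B : Finset (D.Chart none)} (hA : IsPart A) (hB : IsPart B) (h : tyv A = tyv B) :
    ∃ g ∈ G, ∃ hg : Adm (⇑g), A.image hg.push = B := by
  obtain ⟨τ, hτ, hτB⟩ := exists_embedding h.le
  have himg : Finset.univ.image τ = B := by
    refine Finset.eq_of_subset_of_card_le (fun φ hφ => ?_) ?_
    · obtain ⟨a, -, rfl⟩ := Finset.mem_image.1 hφ
      exact (hτB a).1
    · rw [Finset.card_image_of_injective _ hτ, ← sum_tyv, ← h, sum_tyv]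
      simp
  obtain ⟨T, hT, hTτ, -⟩ := hD.exists_adm hA τ (fun φ => (hτB φ).2) (by
    intro φ ψ p hp hp'
    exact hτ (hB.disj _ (hτB φ).1 _ (hτB ψ).1 p hp hp'))
  have hs : Function.Surjective T := by
    intro p
    obtain ⟨φ, hφ, hp⟩ := hB.cover p
    rw [← himg] at hφ
    obtain ⟨a, -, rfl⟩ := Finset.mem_image.1 hφ
    rw [← hTτ] at hp
    obtain ⟨y, rfl⟩ := hp
    exact ⟨_, rfl⟩
  refine ⟨Equiv.ofBijective T ⟨hT.inj, hs⟩, hfull _ A hA fun φ _ => hT.mem φ, hT, ?_⟩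
  rw [← himg]
  ext χ
  simp only [Finset.mem_image, Finset.mem_univ, true_and, Subtype.exists]
  constructor
  · rintro ⟨φ, hφ, rfl⟩
    exact ⟨φ, hφ, (hTτ ⟨φ, hφ⟩).symm⟩
  · rintro ⟨φ, hφ, rfl⟩
    exact ⟨φ, hφ, hTτ ⟨φ, hφ⟩⟩

theorem IsPart.perm_ext {A : Finset (D.Chart none)} (hA : IsPart A) {g h : Equiv.Perm (D.pt none)}
    (hg : Adm (⇑g)) (hh : Adm (⇑h)) (he : ∀ φ ∈ A, hg.push φ = hh.push φ) : g = h := by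
  ext p
  obtain ⟨φ, hφ, y, rfl⟩ := hA.cover p
  have := he φ hφ
  simp only [Adm.push, Chart.mk.injEq, heq_eq_eq, true_and] at this
  exact congrFun this y

theorem Good.isFinitelyPresented (hD : D.Good)
    (hact : ∀ g ∈ G, ∀ φ : D.Chart none, g ∘ φ.fn ∈ D.M φ.ty none)
    (hfull : ∀ T : Equiv.Perm (D.pt none), ∀ P : Finset (D.Chart none), IsPart P →
      (∀ φ ∈ P, T ∘ φ.fn ∈ D.M φ.ty none) → T ∈ G) : Group.IsFinitelyPresented G := by
  obtain ⟨Z, hZfin, hZ, hsupply⟩ := hD.exists_contractions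
  obtain ⟨M, hM, hAM, K, hK, hpot⟩ := hD.exists_mSys_potential
    (fun v => {one v} ∪ ↑(edges v) ∪ ⋃ Q ∈ Z v, ↑Q)
    (fun v => ((Set.finite_singleton _).union (edges v).finite_toSet).union
      ((hZfin v).biUnion fun Q _ => Q.finite_toSet))
    (fun v => Or.inl (Or.inl rfl)) (fun v e => Or.inl (Or.inr (mem_edges.2 ⟨e, rfl⟩)))
  set s := 1 + ∑ v, (hM.fin v).toFinset.card with hs
  obtain ⟨n₁, hn₁⟩ := hsupply (K * s)
  have S : ConSys M Z s (K * s) n₁ :=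
    { adm := fun v Q hQ => ⟨(hZ v Q hQ).1, (hZ v Q hQ).2, fun m hm =>
        hAM v (Or.inr (Set.mem_biUnion hQ hm))⟩
      bound := fun v P _ hP => by
        have h1 : P.card ≤ (hM.fin v).toFinset.card :=
          Finset.card_le_card fun m hm => by simpa using hP m hm
        have h2 := Finset.single_le_sum (f := fun v => (hM.fin v).toFinset.card)
          (fun _ _ => Nat.zero_le _) (Finset.mem_univ v)
        refine h1.trans (h2.trans ?_)
        omega
      supply := fun B hB hn F hF => by
        obtain ⟨φ, Q, hQ, h1, h2⟩ := hn₁ B hB hn F hF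
        exact ⟨⟨φ, Q⟩, hQ, h1, h2⟩ }
  obtain ⟨B₀, hB₀⟩ := hD.base
  set n := n₁ + K * s + B₀.card with hn
  have hKs : 4 * s ≤ K * s := Nat.mul_le_mul_right s hK
  let V : Set (Finset (D.Chart none)) := {A | IsPart A ∧ A.card ≤ n}
  have hV : ∀ A B : Finset (D.Chart none), AdjLe M n A B → B ∈ V := fun A B h => ⟨h.1.2.1, h.2.2⟩
  have hadm : ∀ g : G, Adm (⇑g.1) := fun g => ⟨g.1.injective, hact g.1 g.2⟩
  let _ : MulAction G V :=
    { smul := fun g A => ⟨A.1.image (hadm g).push, A.2.1.image_push _ g.1.surjective,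
        Finset.card_image_le.trans A.2.2⟩
      one_smul := fun A => Subtype.ext <| by
        show A.1.image (hadm 1).push = A.1
        exact Finset.image_id
      mul_smul := fun g h A => Subtype.ext <| by
        show A.1.image (hadm (g * h)).push = (A.1.image (hadm h).push).image (hadm g).push
        rw [Finset.image_image]
        rfl }
  have hsmul : ∀ (g : G) (A : V), (g • A).1 = A.1.image (hadm g).push := fun _ _ => rfl
  have : Nonempty V := ⟨⟨B₀, hB₀, by omega⟩⟩
  have hself : ∀ a : V, AdjLe M n a.1 a.1 := fun a => ⟨a.2.1.adj, a.2.2, a.2.2⟩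
  have hinv : ∀ (g : G) (a b : V), AdjLe M n a.1 b.1 → AdjLe M n (g • a).1 (g • b).1 :=
    fun g a b h => ⟨h.1.image_push _ g.1.surjective, (g • a).2.2, (g • b).2.2⟩
  have hinv' : ∀ (g : G) (a b : V), AdjLe M n (g • a).1 (g • b).1 → AdjLe M n a.1 b.1 := by
    intro g a b h
    simpa only [inv_smul_smul] using hinv g⁻¹ _ _ h
  have hmv : ∀ (g : G) (a b : V), Mv M a.1 b.1 → Mv M (g • a).1 (g • b).1 :=
    fun g a b h => h.image_push _ g.1.surjective
  have hstab : ∀ a b : V, {g : G | g • a = b}.Finite := by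
    intro a b
    have hmem : ∀ g : {g : G | g • a = b}, ∀ φ : a.1, (hadm g.1).push φ ∈ b.1 := by
      rintro ⟨g, rfl⟩ φ
      exact Finset.mem_image_of_mem _ φ.2
    have : Function.Injective fun (g : {g : G | g • a = b}) (φ : a.1) =>
        (⟨(hadm g.1).push φ, hmem g φ⟩ : b.1) := fun g h e =>
      Subtype.ext <| Subtype.ext <| a.2.1.perm_ext (hadm g.1) (hadm h.1) fun φ hφ =>
        congrArg Subtype.val (congrFun e ⟨φ, hφ⟩)
    exact Set.finite_coe_iff.1 (Finite.of_injective _ this)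
  let R := {t : D.W → Fin (n + 1) // ∃ a : V, ∀ w, tyv a.1 w = t w}
  have hadjV : ∀ (a : V) (l) (b : V), IsWalk (AdjLe M n) a.1 l b.1 →
      Relation.ReflTransGen (fun a b : V => AdjLe M n a.1 b.1) a b := by
    intro a l b h
    obtain ⟨l', b', hb, -, hw, -⟩ := exists_lift_walk (L := Unit) hV (fun _ _ => 1)
      (fun _ _ => 1) (fun _ _ => rfl) l a b h
    rw [← Subtype.ext hb]
    exact hw.reflTransGen
  refine .of_potentials (R := R) (V := V) (adj := fun a b => AdjLe M n a.1 b.1)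
    (fun r => r.2.choose) ?_ hself (fun a b h => h.symm) (fun g a b => ⟨hinv' g a b, hinv g a b⟩)
    ?_ ?_ hK ?_
  · intro a
    have hle : ∀ w, tyv a.1 w < n + 1 := fun w => Nat.lt_succ_of_le <|
      (Finset.card_filter_le _ _).trans a.2.2
    let r : R := ⟨fun w => ⟨tyv a.1 w, hle w⟩, a, fun w => rfl⟩
    obtain ⟨g, hg, hg', h⟩ := hD.exists_perm hfull r.2.choose.2.1 a.2.1
      (funext fun w => r.2.choose_spec w)
    exact ⟨⟨g, hg⟩, r, Subtype.ext h⟩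
  · intro a b
    obtain ⟨l, hl⟩ := exists_isWalk (S.reflTransGen_adjLe (by omega) hKs (n := n) (by omega)
      a.2.2 b.2.2 (hM.reflTransGen hD a.2.1 b.2.1))
    exact hadjV a l b hl
  · intro r r'
    have hfin : ∀ a b : V, {h : G | Mv M a.1 (h • b).1}.Finite := by
      intro a b
      refine (((finite_mv hM.fin a.1).preimage Subtype.val_injective.injOn).biUnion
        fun d _ => hstab b d).subset fun h hh => ?_
      exact Set.mem_biUnion (x := h • b) hh rfl
    generalize r.2.choose = a, r'.2.choose = b
    refine (((hstab b a).union (hfin a b)).union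
      ((hfin b a).preimage inv_injective.injOn)).subset ?_
    rintro h ⟨⟨-, -, he | hm | hm⟩, -⟩
    · exact Or.inl (Or.inl (Subtype.ext he.symm))
    · exact Or.inl (Or.inr hm)
    · refine Or.inr ?_
      have := hmv h⁻¹ _ _ hm
      rwa [inv_smul_smul] at this
  · intro L _ c hc
    let c' : Finset (D.Chart none) → Finset (D.Chart none) → L := fun A B =>
      if h : A ∈ V ∧ B ∈ V then c ⟨A, h.1⟩ ⟨B, h.2⟩ else 1
    have hc' : ∀ a b : V, c' a b = c a b := fun a b => dif_pos ⟨a.2, b.2⟩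
    obtain ⟨c'', h1, h2⟩ := S.exists_extend hK (by omega) le_rfl (n := n) (by omega) (c := c') (by
      intro A l hl hw
      cases l with
      | nil => rfl
      | cons B l =>
        have hA : A ∈ V := hV _ _ hw.1.symm
        obtain ⟨l', b', hb, hl', hw', hv⟩ := exists_lift_walk hV c c' hc' _ ⟨A, hA⟩ A hw
        obtain rfl : b' = ⟨A, hA⟩ := Subtype.ext hb
        rw [← hv]
        exact hc _ _ (hl'.trans_le hl) hw')
    obtain ⟨p, hp⟩ := hpot hB₀ c'' h1
    refine ⟨fun a => p a.1, fun a b hab => ?_⟩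
    rw [← hc', ← h2 _ _ hab]
    exact hp _ _ hab.1

end ChartData

section Cylinders

open Topology

variable {α : Type*} [TopologicalSpace α] [DiscreteTopology α]

theorem exists_cylinder_subset {S : Set (ℕ → α)} {y : S} {U : Set S} (hU : U ∈ 𝓝 y) :
    ∃ n, ∀ z : S, (∀ i < n, z.1 i = y.1 i) → z ∈ U := by
  obtain ⟨V, hV, hVU⟩ := mem_nhds_subtype S y U |>.1 hU
  obtain ⟨_, ⟨x, n, rfl⟩, hy, hn⟩ :=
    (PiNat.isTopologicalBasis_cylinders (fun _ : ℕ => α)).mem_nhds_iff.1 hV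
  refine ⟨n, fun z hz => hVU (hn ?_)⟩
  rw [← PiNat.mem_cylinder_iff_eq.1 hy]
  exact hz

theorem cylinder_mem_nhds {S : Set (ℕ → α)} (y : S) (n : ℕ) :
    {z : S | ∀ i < n, z.1 i = y.1 i} ∈ 𝓝 y :=
  (((PiNat.isOpen_cylinder (fun _ : ℕ => α) y.1 n).preimage continuous_subtype_val)).mem_nhds
    fun _ _ => rfl

theorem exists_uniform_cylinder {S : Set (ℕ → α)} [CompactSpace S] {Q : ℕ → Set S → Prop}
    (hQ : ∀ {m n : ℕ} {U U' : Set S}, m ≤ n → U' ⊆ U → Q m U → Q n U')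
    (h : ∀ y : S, ∃ n, ∃ U ∈ 𝓝 y, Q n U) :
    ∃ n, ∀ y : S, Q n {z | ∀ i < n, z.1 i = y.1 i} := by
  have h' : ∀ y : S, ∃ n, Q n {z | ∀ i < n, z.1 i = y.1 i} := by
    intro y
    obtain ⟨n, U, hU, hn⟩ := h y
    obtain ⟨k, hk⟩ := exists_cylinder_subset hU
    exact ⟨max n k, hQ (le_max_left _ _)
      (fun z hz => hk z fun i hi => hz i (hi.trans_le (le_max_right _ _))) hn⟩
  choose n hn using h'
  obtain ⟨t, -, ht⟩ := isCompact_univ.elim_nhds_subcover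
    (fun y : S => {z : S | ∀ i < n y, z.1 i = y.1 i}) fun y _ => cylinder_mem_nhds y (n y)
  refine ⟨t.sup n, fun y => ?_⟩
  obtain ⟨y', hy', hyy'⟩ := Set.mem_iUnion₂.1 (ht (Set.mem_univ y))
  refine hQ (U := {z | ∀ i < n y', z.1 i = y'.1 i}) (Finset.le_sup hy') ?_ (hn y')
  intro z hz i hi
  rw [hz i (hi.trans_le (Finset.le_sup hy')), hyy' i hi]

end Cylinders

namespace FinDigraph

variable {Γ : FinDigraph}

theorem mem_cone_trivPath {v : Γ.V} {x : ℕ → Γ.E} :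
    x ∈ Γ.cone (Γ.trivPath v) ↔ x ∈ Γ.shift ∧ Γ.o (x 0) = v := by
  simp [cone, trivPath]

theorem catPath_of_lt (α : Γ.FinPath) (x : ℕ → Γ.E) {i : ℕ} (h : i < α.edges.length) :
    Γ.catPath α x i = α.edges[i] := by
  simp [catPath, splice, h]

theorem catPath_add (α : Γ.FinPath) (x : ℕ → Γ.E) (i : ℕ) :
    Γ.catPath α x (i + α.edges.length) = x i := by
  simp [catPath, splice, trivPath]

theorem pathEndAux_eq : ∀ (l : List Γ.E) (v : Γ.V) (x : ℕ → Γ.E), x ∈ Γ.shift → Γ.o (x 0) = v →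
    (∀ (i : ℕ) (h : i < l.length), x i = l[i]) → Γ.pathEndAux v l = Γ.o (x l.length)
  | [], _, _, _, hv, _ => hv.symm
  | e :: l, v, x, hx, hv, h => by
    refine pathEndAux_eq l (Γ.t e) (fun i => x (i + 1)) (fun i => hx _) ?_ fun i hi => ?_
    · rw [← hx 0, h 0 (by simp)]
      rfl
    · rw [h (i + 1) (by simpa using hi)]
      rfl

theorem pathEnd_eq {α : Γ.FinPath} {x : ℕ → Γ.E} (hx : x ∈ Γ.cone α) :
    Γ.pathEnd α = Γ.o (x α.edges.length) :=
  pathEndAux_eq _ _ x hx.1 hx.2.1 hx.2.2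

theorem exists_pathOk : ∀ (n : ℕ) (x : ℕ → Γ.E), x ∈ Γ.shift → ∃ l : List Γ.E, l.length = n ∧
    Γ.pathOk (Γ.o (x 0)) l ∧ ∀ (i : ℕ) (h : i < l.length), x i = l[i]
  | 0, _, _ => ⟨[], rfl, trivial, by simp⟩
  | n + 1, x, hx => by
    obtain ⟨l, hl, hok, h⟩ := exists_pathOk n (fun i => x (i + 1)) fun i => hx _
    refine ⟨x 0 :: l, by simp [hl], ⟨rfl, by rwa [hx 0]⟩, ?_⟩
    rintro (_ | i) hi
    · rfl
    · exact h i (by simpa using hi)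

theorem exists_initial {x : ℕ → Γ.E} (hx : x ∈ Γ.shift) (n : ℕ) :
    ∃ α : Γ.FinPath, α.edges.length = n ∧ x ∈ Γ.cone α := by
  obtain ⟨l, hl, hok, h⟩ := exists_pathOk n x hx
  exact ⟨⟨_, l, hok⟩, hl, hx, rfl, h⟩

theorem mem_cone_iff {α : Γ.FinPath} {x y : ℕ → Γ.E} (hx : x ∈ Γ.cone α) :
    y ∈ Γ.cone α ↔ y ∈ Γ.shift ∧ Γ.o (y 0) = α.start ∧ ∀ i < α.edges.length, y i = x i := by
  refine ⟨fun h => ⟨h.1, h.2.1, fun i hi => ?_⟩, fun h => ⟨h.1, h.2.1, fun i hi => ?_⟩⟩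
  · rw [h.2.2 i hi, hx.2.2 i hi]
  · rw [h.2.2 i hi, hx.2.2 i hi]

/-- Dropping an initial segment. -/
def dropSeq (n : ℕ) (x : ℕ → Γ.E) : ℕ → Γ.E := fun i => x (i + n)

theorem dropSeq_mem {α : Γ.FinPath} {x : ℕ → Γ.E} (hx : x ∈ Γ.cone α) :
    dropSeq α.edges.length x ∈ Γ.cone (Γ.trivPath (Γ.pathEnd α)) := by
  rw [mem_cone_trivPath, pathEnd_eq hx]
  refine ⟨fun i => ?_, by simp [dropSeq]⟩
  have := hx.1 (i + α.edges.length)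
  rwa [add_right_comm] at this

theorem catPath_dropSeq {α : Γ.FinPath} {x : ℕ → Γ.E} (hx : x ∈ Γ.cone α) :
    Γ.catPath α (dropSeq α.edges.length x) = x := by
  funext i
  by_cases h : i < α.edges.length
  · rw [catPath_of_lt _ _ h]
    exact (hx.2.2 i h).symm
  · obtain ⟨j, rfl⟩ := Nat.exists_eq_add_of_le' (not_lt.1 h)
    rw [catPath_add]
    rfl

theorem dropSeq_catPath (α : Γ.FinPath) (x : ℕ → Γ.E) :
    dropSeq α.edges.length (Γ.catPath α x) = x :=
  funext fun i => catPath_add α x i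

theorem catPath_injective (α : Γ.FinPath) : Function.Injective (Γ.catPath α) := fun x y h => by
  rw [← dropSeq_catPath α x, h, dropSeq_catPath]

theorem catPath_mem (hc : Γ.NoEmptyCones) {α : Γ.FinPath} {z : ℕ → Γ.E}
    (hz : z ∈ Γ.cone (Γ.trivPath (Γ.pathEnd α))) : Γ.catPath α z ∈ Γ.cone α := by
  obtain ⟨x, hx⟩ := hc α
  rw [mem_cone_trivPath] at hz
  have hlt : ∀ i < α.edges.length, Γ.catPath α z i = x i := fun i hi => by
    rw [catPath_of_lt _ _ hi]
    exact (hx.2.2 i hi).symm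
  have hlen : Γ.catPath α z α.edges.length = z 0 := by simpa using catPath_add α z 0
  refine (mem_cone_iff hx).2 ⟨fun i => ?_, ?_, hlt⟩
  · rcases lt_trichotomy (i + 1) α.edges.length with h | h | h
    · rw [hlt i (by omega), hlt _ h, hx.1]
    · rw [hlt i (by omega), h, hlen, hz.2, pathEnd_eq hx, ← h, hx.1]
    · obtain ⟨j, rfl⟩ := Nat.exists_eq_add_of_le' (Nat.lt_succ_iff.1 h)
      rw [add_right_comm, catPath_add, catPath_add, hz.1]
  · rcases Nat.eq_zero_or_pos α.edges.length with h | h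
    · rw [h] at hlen
      rw [hlen, hz.2, pathEnd_eq hx, h, hx.2.1]
    · rw [hlt 0 h, hx.2.1]

theorem exists_append (hc : Γ.NoEmptyCones) {α β : Γ.FinPath} (h : Γ.pathEnd α = β.start) :
    ∃ γ : Γ.FinPath, γ.edges.length = α.edges.length + β.edges.length ∧ γ.start = α.start ∧
      Γ.pathEnd γ = Γ.pathEnd β ∧ Γ.cone γ ⊆ Γ.cone α ∧
      ∀ z, Γ.catPath γ z = Γ.catPath α (Γ.catPath β z) := by
  obtain ⟨y, hy⟩ := hc β
  have hy' : y ∈ Γ.cone (Γ.trivPath (Γ.pathEnd α)) := by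
    rw [mem_cone_trivPath]
    exact ⟨hy.1, hy.2.1.trans h.symm⟩
  have hx := catPath_mem hc hy'
  obtain ⟨γ, hγ, hxγ⟩ := exists_initial hx.1 (α.edges.length + β.edges.length)
  have hst : γ.start = α.start := hxγ.2.1.symm.trans hx.2.1
  refine ⟨γ, hγ, hst, ?_, fun z hz => ?_, fun z => ?_⟩
  · rw [pathEnd_eq hxγ, hγ, add_comm, catPath_add, pathEnd_eq hy]
  · rw [mem_cone_iff hxγ] at hz
    exact (mem_cone_iff hx).2 ⟨hz.1, hz.2.1.trans hst, fun i hi => hz.2.2 i (by omega)⟩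
  · funext i
    by_cases hi : i < γ.edges.length
    · have h1 : Γ.catPath γ z i = Γ.catPath α y i := by
        rw [catPath_of_lt _ _ hi]
        exact (hxγ.2.2 i hi).symm
      rw [h1]
      by_cases hi' : i < α.edges.length
      · rw [catPath_of_lt _ _ hi', catPath_of_lt _ _ hi']
      · obtain ⟨j, rfl⟩ := Nat.exists_eq_add_of_le' (not_lt.1 hi')
        rw [catPath_add, catPath_add, catPath_of_lt _ _ (by omega)]
        exact hy.2.2 j _
    · obtain ⟨j, rfl⟩ := Nat.exists_eq_add_of_le' (not_lt.1 hi)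
      rw [catPath_add, hγ, show j + (α.edges.length + β.edges.length) =
        (j + β.edges.length) + α.edges.length by omega, catPath_add, catPath_add]

theorem continuous_catPath (α : Γ.FinPath) : Continuous (Γ.catPath α) := by
  refine continuous_pi fun i => ?_
  by_cases h : i < α.edges.length
  · simp only [catPath_of_lt _ _ h]
    exact continuous_const
  · obtain ⟨j, rfl⟩ := Nat.exists_eq_add_of_le' (not_lt.1 h)
    simp only [catPath_add]
    exact continuous_apply j

theorem isClosed_shift : IsClosed Γ.shift := by
  have : Γ.shift = ⋂ i, {x | Γ.t (x i) = Γ.o (x (i + 1))} := by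
    ext x
    simp [shift]
  rw [this]
  refine isClosed_iInter fun i => ?_
  have h : Continuous fun x : ℕ → Γ.E => (x i, x (i + 1)) :=
    (continuous_apply i).prodMk (continuous_apply (i + 1))
  exact (isClosed_discrete {p : Γ.E × Γ.E | Γ.t p.1 = Γ.o p.2}).preimage h

theorem isClosed_cone (α : Γ.FinPath) : IsClosed (Γ.cone α) := by
  have : Γ.cone α = Γ.shift ∩ ({x | Γ.o (x 0) = α.start} ∩
      ⋂ (i : ℕ) (h : i < α.edges.length), {x | x i = α.edges.get ⟨i, h⟩}) := by
    ext x
    simp only [cone, Set.mem_inter_iff, Set.mem_iInter, Set.mem_ofPred_eq]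
  rw [this]
  refine isClosed_shift.inter (IsClosed.inter ?_ ?_)
  · exact (isClosed_discrete {e : Γ.E | Γ.o e = α.start}).preimage
      (continuous_apply 0 : Continuous fun x : ℕ → Γ.E => x 0)
  · exact isClosed_iInter fun i => isClosed_iInter fun h =>
      (isClosed_discrete {α.edges.get ⟨i, h⟩}).preimage
        (continuous_apply i : Continuous fun x : ℕ → Γ.E => x i)

instance (α : Γ.FinPath) : CompactSpace (Γ.cone α) :=
  isCompact_iff_compactSpace.1 (isClosed_cone α).isCompact

theorem ClopenIn.compactSpace {E : Set (ℕ → Γ.E)} (hE : Γ.ClopenIn E) (hsub : E ⊆ Γ.shift) :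
    CompactSpace E := by
  refine isCompact_iff_compactSpace.1 (IsClosed.isCompact ?_)
  have : IsClosed (Subtype.val '' (Subtype.val ⁻¹' E : Set Γ.shift)) :=
    isClosed_shift.isClosedEmbedding_subtypeVal.isClosedMap _ hE.1
  rwa [Subtype.image_preimage_coe, Set.inter_eq_right.2 hsub] at this

theorem exists_ne_of_mem (hiso : Γ.NoIsolatedPoints) {α : Γ.FinPath} {x : ℕ → Γ.E}
    (hx : x ∈ Γ.cone α) : ∃ y ∈ Γ.cone α, y ≠ x := by
  by_contra! h
  refine hiso ⟨x, hx.1⟩ ?_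
  refine isOpen_iff_mem_nhds.2 ?_
  rintro _ rfl
  refine Filter.mem_of_superset (cylinder_mem_nhds ⟨x, hx.1⟩ (α.edges.length + 1)) fun z hz => ?_
  refine Subtype.ext (h z.1 ((mem_cone_iff hx).2 ⟨z.2, ?_, fun i hi => hz i (by omega)⟩))
  rw [hz 0 (by omega)]
  exact hx.2.1

end FinDigraph

namespace FinDigraph

open Topology Filter

variable {Γ : FinDigraph}

theorem catPath_trivPath (v : Γ.V) (x : ℕ → Γ.E) : Γ.catPath (Γ.trivPath v) x = x :=
  funext fun i => catPath_add (Γ.trivPath v) x i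

theorem splice_catPath (α β : Γ.FinPath) (x : ℕ → Γ.E) :
    Γ.splice α β (Γ.catPath α x) = Γ.catPath β x := by
  funext i
  by_cases h : i < β.edges.length
  · simp [catPath, splice, h]
  · rw [splice, dif_neg h, catPath_add]
    simp [catPath, splice, h, trivPath]

/-- The path consisting of a single edge. -/
def edgePath (e : Γ.E) : Γ.FinPath := ⟨Γ.o e, [e], rfl, trivial⟩

/-- A full contracting rational similarity group, together with a chosen core and, for every
node of the core, a path ending there whose cone is properly contained in `E`. -/
structure Setting (Γ : FinDigraph) (E : Set (ℕ → Γ.E)) (G : Subgroup (Equiv.Perm ↥E)) where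
  iso : Γ.NoIsolatedPoints
  cones : Γ.NoEmptyCones
  sub : E ⊆ Γ.shift
  clopen : Γ.ClopenIn E
  rsg : Γ.IsRSG E G
  full : Γ.IsFullOn E G
  finite_nucleus : (Γ.groupNucleus E G).Finite
  core : Set Γ.V
  irr : Γ.IrreducibleOn core
  N : ℕ
  N_spec : ∀ α : Γ.FinPath, N ≤ α.edges.length → Γ.pathEnd α ∈ core
  core_closed : ∀ e, Γ.o e ∈ core → Γ.t e ∈ core
  base : core → Γ.FinPath
  base_end : ∀ v, Γ.pathEnd (base v) = v
  base_ssub : ∀ v, Γ.cone (base v) ⊂ E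

namespace Setting

variable {E : Set (ℕ → Γ.E)} {G : Subgroup (Equiv.Perm ↥E)} (S : Setting Γ E G)

/-- The set `E` itself, or the cone of a node of the core. -/
def node : Option S.core → Set (ℕ → Γ.E)
  | none => E
  | some v => Γ.cone (Γ.trivPath v)

/-- The chosen copy inside `E` of a node space. -/
def emb : ∀ x, S.node x → E
  | none => id
  | some v => fun z => ⟨Γ.catPath (S.base v) z.1, (S.base_ssub v).1
      (catPath_mem S.cones (by rw [S.base_end]; exact z.2))⟩

instance compactSpace_node : ∀ x, CompactSpace (S.node x)
  | none => S.clopen.compactSpace S.sub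
  | some v => inferInstanceAs (CompactSpace (Γ.cone (Γ.trivPath v)))

theorem emb_injective : ∀ x, Function.Injective (S.emb x)
  | none => Function.injective_id
  | some _ => fun _ _ h => Subtype.ext (catPath_injective _ (congrArg Subtype.val h))

theorem continuous_emb : ∀ x, Continuous (S.emb x)
  | none => continuous_id
  | some _ => ((continuous_catPath _).comp continuous_subtype_val).subtype_mk _

theorem isInducing_emb (x) : IsInducing (S.emb x) :=
  ((S.continuous_emb x).isClosedEmbedding (S.emb_injective x)).isInducing

variable {x y z : Option S.core}

/-- Maps of node spaces that locally agree with elements of `G`. -/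
def Loc (f : S.node x → S.node y) : Prop :=
  ∀ p, ∃ g ∈ G, ∀ᶠ q in 𝓝 p, S.emb y (f q) = g (S.emb x q)

variable {S}

theorem Loc.continuous {f : S.node x → S.node y} (hf : S.Loc f) : Continuous f := by
  rw [(S.isInducing_emb y).continuous_iff, continuous_iff_continuousAt]
  intro p
  obtain ⟨g, hg, h⟩ := hf p
  exact ((S.rsg.1 g hg).1.comp (S.continuous_emb x)).continuousAt.congr
    (h.mono fun _ h => h.symm)

theorem Loc.id : S.Loc (id : S.node x → S.node x) := fun _ =>
  ⟨1, G.one_mem, .of_forall fun _ => rfl⟩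

theorem Loc.comp {f : S.node y → S.node z} {f' : S.node x → S.node y} (hf : S.Loc f)
    (hf' : S.Loc f') : S.Loc (f ∘ f') := by
  intro p
  obtain ⟨g, hg, h⟩ := hf (f' p)
  obtain ⟨g', hg', h'⟩ := hf' p
  refine ⟨g * g', G.mul_mem hg hg', ?_⟩
  filter_upwards [h', hf'.continuous.continuousAt.eventually h] with q h1 h2
  rw [Function.comp_apply, h2, h1]
  rfl

theorem Loc.factor {f : S.node y → S.node z} {h : S.node x → S.node y} (hf : S.Loc f)
    (hinj : Function.Injective f) (hfh : S.Loc (f ∘ h)) : S.Loc h := by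
  have hcont : Continuous h := by
    rw [(hf.continuous.isClosedEmbedding hinj).isInducing.continuous_iff]
    exact hfh.continuous
  intro p
  obtain ⟨g, hg, h1⟩ := hf (h p)
  obtain ⟨g', hg', h2⟩ := hfh p
  refine ⟨g⁻¹ * g', G.mul_mem (G.inv_mem hg) hg', ?_⟩
  filter_upwards [hcont.continuousAt.eventually h1, h2] with q h1 h2
  rw [Equiv.Perm.mul_apply, ← h2, Function.comp_apply, h1]
  exact (g.symm_apply_apply _).symm

theorem range_mem_nhds {ι : Type*} {s : Finset ι} {n : ι → S.core}
    {f : ∀ i, S.node (some (n i)) → S.node x} (hf : ∀ i ∈ s, S.Loc (f i))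
    (hcov : ∀ p, ∃ i ∈ s, p ∈ Set.range (f i))
    (hdisj : ∀ i ∈ s, ∀ j ∈ s, ∀ p, p ∈ Set.range (f i) → p ∈ Set.range (f j) → i = j)
    {i : ι} (hi : i ∈ s) {p : S.node x} (hp : p ∈ Set.range (f i)) : Set.range (f i) ∈ 𝓝 p := by
  have hcl : IsClosed (⋃ j ∈ s.erase i, Set.range (f j)) :=
    isClosed_biUnion_finset fun j hj => (isCompact_range
      (hf j (Finset.mem_of_mem_erase hj)).continuous).isClosed
  refine mem_of_superset (hcl.isOpen_compl.mem_nhds ?_) fun q hq => ?_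
  · intro h
    obtain ⟨j, hj, h⟩ := Set.mem_iUnion₂.1 h
    exact Finset.ne_of_mem_erase hj (hdisj i hi j (Finset.mem_of_mem_erase hj) _ hp h).symm
  · obtain ⟨j, hj, h⟩ := hcov q
    by_cases hji : j = i
    · rwa [← hji]
    · exact absurd (Set.mem_biUnion (Finset.mem_erase.2 ⟨hji, hj⟩) h) hq

theorem Loc.of_partition {T : S.node x → S.node y} {ι : Type*} {s : Finset ι} {n : ι → S.core}
    {f : ∀ i, S.node (some (n i)) → S.node x} (hf : ∀ i ∈ s, S.Loc (f i))
    (hinj : ∀ i ∈ s, Function.Injective (f i)) (hT : ∀ i ∈ s, S.Loc (T ∘ f i))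
    (hcov : ∀ p, ∃ i ∈ s, p ∈ Set.range (f i))
    (hdisj : ∀ i ∈ s, ∀ j ∈ s, ∀ p, p ∈ Set.range (f i) → p ∈ Set.range (f j) → i = j) :
    S.Loc T := by
  intro p
  obtain ⟨i, hi, q, rfl⟩ := hcov p
  have hnhds := range_mem_nhds hf hcov hdisj hi ⟨q, rfl⟩
  obtain ⟨g, hg, h1⟩ := hf i hi q
  obtain ⟨g', hg', h2⟩ := hT i hi q
  refine ⟨g' * g⁻¹, G.mul_mem hg' (G.inv_mem hg), ?_⟩
  rw [← ((hf i hi).continuous.isClosedEmbedding (hinj i hi)).isInducing.map_nhds_of_mem _ hnhds,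
    eventually_map]
  filter_upwards [h1, h2] with r h1 h2
  rw [h1, Equiv.Perm.mul_apply]
  exact h2.trans (congrArg g' (g.symm_apply_apply _).symm)

variable (S)

/-- The map of node spaces prepending a path. -/
def sim (α : Γ.FinPath) (w : S.core) (hw : Γ.pathEnd α = w) (h : Γ.cone α ⊆ S.node x) :
    S.node (some w) → S.node x :=
  fun z => ⟨Γ.catPath α z.1, h (catPath_mem S.cones (by rw [hw]; exact z.2))⟩

theorem sim_injective (α : Γ.FinPath) (w : S.core) (hw : Γ.pathEnd α = w)
    (h : Γ.cone α ⊆ S.node x) : Function.Injective (S.sim α w hw h) :=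
  fun _ _ h => Subtype.ext (catPath_injective _ (congrArg Subtype.val h))

theorem loc_of_catPath {w : S.core} {f : S.node (some w) → S.node x} {γ : Γ.FinPath}
    (hγ : Γ.pathEnd γ = w) (hγE : Γ.cone γ ⊂ E)
    (h : ∀ z, (S.emb x (f z)).1 = Γ.catPath γ z.1) : S.Loc f := by
  intro p
  obtain ⟨g, hg, hgr⟩ := S.rsg.2 (S.base w) γ ((S.base_end w).trans hγ.symm) (S.base_ssub w) hγE
  refine ⟨g, hg, .of_forall fun q => Subtype.ext ?_⟩
  rw [h]
  have := hgr _ (S.emb (some w) q).2 (catPath_mem S.cones (by rw [S.base_end]; exact q.2))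
  exact ((this.trans (splice_catPath _ _ _))).symm

theorem loc_sim_none {α : Γ.FinPath} {w : S.core} (hw : Γ.pathEnd α = w)
    (h : Γ.cone α ⊂ E) : S.Loc (S.sim (x := none) α w hw h.1) :=
  S.loc_of_catPath hw h fun _ => rfl

theorem loc_sim_some {v : S.core} {α : Γ.FinPath} {w : S.core} (hw : Γ.pathEnd α = w)
    (h : Γ.cone α ⊆ S.node (some v)) : S.Loc (S.sim (x := some v) α w hw h) := by
  have hst : Γ.pathEnd (S.base v) = α.start := by
    obtain ⟨z, hz⟩ := S.cones α
    rw [S.base_end, ← (mem_cone_trivPath.1 (h hz)).2, hz.2.1]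
  obtain ⟨γ, -, -, hγ, hsub, hcat⟩ := exists_append S.cones hst
  exact S.loc_of_catPath (hγ.trans hw) (ssubset_of_subset_of_ssubset hsub (S.base_ssub v))
    fun z => (hcat z.1).symm

/-- The edges leaving a node of the core. -/
abbrev OutEdge (v : S.core) : Type := {e : Γ.E // Γ.o e = v}

/-- The terminus of an edge leaving a node of the core. -/
def outTgt {v : S.core} (e : S.OutEdge v) : S.core :=
  ⟨Γ.t e.1, S.core_closed _ (by rw [e.2]; exact v.2)⟩

theorem cone_edgePath_subset {v : S.core} (e : S.OutEdge v) :
    Γ.cone (edgePath e.1) ⊆ S.node (some v) :=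
  fun _ hz => mem_cone_trivPath.2 ⟨hz.1, hz.2.1.trans e.2⟩

/-- The system of node spaces with the maps locally agreeing with `G`. -/
def data : ChartData where
  W := S.core
  pt x := S.node x
  M w x := {f : S.node (some w) → S.node x | Function.Injective f ∧ S.Loc f}
  Ed := S.OutEdge
  tgt := S.outTgt
  ed e := S.sim (edgePath e.1) (S.outTgt e) rfl (S.cone_edgePath_subset e)
  inj h := h.1
  ne v := (S.cones (Γ.trivPath v)).to_subtype
  id_mem v := ⟨Function.injective_id, Loc.id⟩
  comp_mem hf hg := ⟨hf.1.comp hg.1, hf.2.comp hg.2⟩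
  factor := by
    intro u w x f g hf hg h
    choose k hk using fun p => h ⟨p, rfl⟩
    obtain rfl : f ∘ k = g := funext hk
    exact ⟨k, ⟨hg.1.of_comp, hf.2.factor hf.1 hg.2⟩, rfl⟩
  ed_mem e := ⟨S.sim_injective _ _ _ _, S.loc_sim_some _ _⟩
  ed_cover := by
    intro v p
    have hp := mem_cone_trivPath.1 p.2
    have hp' : p.1 ∈ Γ.cone (edgePath (p.1 0)) := by
      refine ⟨hp.1, rfl, fun i hi => ?_⟩
      obtain rfl : i = 0 := by simpa [edgePath] using hi
      rfl
    exact ⟨⟨p.1 0, hp.2⟩, ⟨dropSeq 1 p.1, dropSeq_mem hp'⟩, Subtype.ext (catPath_dropSeq hp')⟩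
  ed_disj := by
    intro v e e' y y' h
    have := congrFun (congrArg Subtype.val h) 0
    exact Subtype.ext this

end Setting

end FinDigraph

namespace ChartData

open Chart

variable {D : ChartData} {x : Option D.W}

theorem Bar.of_reach {R : D.Chart x → Prop} {k : ℕ} : ∀ {ψ : D.Chart x},
    (∀ χ, reach k ψ χ → R χ) → Bar R ψ := by
  induction k with
  | zero => exact fun h => .here (h _ rfl)
  | succ k ih => exact fun h => .expand fun e => ih fun χ hχ => h χ ⟨e, hχ⟩

theorem exists_reach_mem (k : ℕ) : ∀ {φ : D.Chart x} {p : D.pt x}, p ∈ φ.img →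
    ∃ χ, reach k φ χ ∧ p ∈ χ.img := by
  induction k with
  | zero => exact fun h => ⟨_, rfl, h⟩
  | succ k ih =>
    rintro φ _ ⟨q, rfl⟩
    obtain ⟨e, y, rfl⟩ := D.ed_cover q
    obtain ⟨χ, h, hp⟩ := ih (φ := φ.comp (edge e)) ⟨y, rfl⟩
    exact ⟨χ, ⟨e, h⟩, hp⟩

theorem isPart_reach (k : ℕ) (v : D.W) : IsPart (finite_reach k (one v)).toFinset where
  cover p := by
    obtain ⟨χ, h, hp⟩ := exists_reach_mem k (φ := one v) ⟨p, rfl⟩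
    exact ⟨χ, (Set.Finite.mem_toFinset _).2 h, hp⟩
  disj φ hφ ψ hψ p h h' :=
    reach.eq_of_overlap ((Set.Finite.mem_toFinset _).1 hφ) ((Set.Finite.mem_toFinset _).1 hψ) h h'

end ChartData

namespace FinDigraph

open Topology Filter ChartData ChartData.Chart

variable {Γ : FinDigraph}

theorem eq_of_mem_cone {α β : Γ.FinPath} {x : ℕ → Γ.E} (hα : x ∈ Γ.cone α) (hβ : x ∈ Γ.cone β)
    (h : α.edges.length = β.edges.length) : α = β := by
  have h1 : α.start = β.start := hα.2.1.symm.trans hβ.2.1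
  have h2 : α.edges = β.edges := List.ext_getElem h fun i hi hi' =>
    (hα.2.2 i hi).symm.trans (hβ.2.2 i hi')
  cases α
  cases β
  cases h1
  cases h2
  rfl

theorem finite_setOf_length (n : ℕ) : {α : Γ.FinPath | α.edges.length = n}.Finite := by
  have : Function.Injective fun α : Γ.FinPath => (α.start, α.edges) := by
    rintro ⟨v, l, h⟩ ⟨v', l', h'⟩ e
    cases e
    rfl
  refine ((Set.finite_univ.prod (List.finite_length_eq Γ.E n)).preimage this.injOn).subset ?_
  exact fun α hα => ⟨Set.mem_univ _, hα⟩

theorem exists_cone_ssubset (hiso : Γ.NoIsolatedPoints) {E : Set (ℕ → Γ.E)}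
    (hsub : E ⊆ Γ.shift) (hE : Γ.ClopenIn E) (hne : E.Nonempty) :
    ∃ K, ∀ α : Γ.FinPath, K ≤ α.edges.length → ∀ x ∈ Γ.cone α, x ∈ E → Γ.cone α ⊂ E := by
  have : CompactSpace Γ.shift := isCompact_iff_compactSpace.1 isClosed_shift.isCompact
  obtain ⟨n, hn⟩ := exists_uniform_cylinder (S := Γ.shift)
    (Q := fun _ U => (∀ z ∈ U, z.1 ∈ E) ∨ ∀ z ∈ U, z.1 ∉ E)
    (fun _ hU h => h.imp (fun h z hz => h z (hU hz)) fun h z hz => h z (hU hz)) fun y => by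
      by_cases hy : y.1 ∈ E
      · exact ⟨0, {x | x.1 ∈ E}, hE.2.mem_nhds hy, Or.inl fun z hz => hz⟩
      · exact ⟨0, {x | x.1 ∈ E}ᶜ, hE.1.isOpen_compl.mem_nhds hy, Or.inr fun z hz => hz⟩
  have hsub' : ∀ α : Γ.FinPath, n ≤ α.edges.length → ∀ x ∈ Γ.cone α, x ∈ E → Γ.cone α ⊆ E := by
    intro α hα x hx hxE y hy
    rcases hn ⟨x, hx.1⟩ with h | h
    · exact h ⟨y, hy.1⟩ fun i hi => ((mem_cone_iff hx).1 hy).2.2 i (hi.trans_le hα)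
    · exact absurd hxE (h ⟨x, hx.1⟩ fun _ _ => rfl)
  obtain ⟨x, hx⟩ := hne
  obtain ⟨α, hα, hxα⟩ := exists_initial (hsub hx) n
  obtain ⟨y, hy, hyx⟩ := exists_ne_of_mem hiso hxα
  have hyE := hsub' α hα.ge x hxα hx hy
  obtain ⟨j, hj⟩ := Function.ne_iff.1 hyx
  refine ⟨max n (j + 1), fun β hβ z hz hzE =>
    ⟨hsub' β ((le_max_left _ _).trans hβ) z hz hzE, fun h => hj ?_⟩⟩
  exact ((mem_cone_iff (h hx)).1 (h hyE)).2.2 j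
    ((Nat.lt_succ_self j).trans_le ((le_max_right _ _).trans hβ))

namespace Setting

variable {E : Set (ℕ → Γ.E)} {G : Subgroup (Equiv.Perm ↥E)} (S : Setting Γ E G)

theorem exists_path (v w : S.core) (k : ℕ) : ∃ α : Γ.FinPath, α.start = v ∧
    Γ.pathEnd α = w ∧ k ≤ α.edges.length := by
  induction k generalizing w with
  | zero =>
    obtain ⟨α, h, h', -⟩ := S.irr.1 v v.2 w w.2
    exact ⟨α, h, h', Nat.zero_le _⟩
  | succ k ih =>
    obtain ⟨α, h1, h2, h3⟩ := ih v
    obtain ⟨β, h4, h5, h6, -⟩ := S.irr.1 v v.2 w w.2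
    obtain ⟨γ, h7, h8, h9, -⟩ := exists_append S.cones (h2.trans h4.symm)
    have := List.length_pos_iff.2 h6
    exact ⟨γ, h8.trans h1, h9.trans h5, by omega⟩

variable {S} {x : Option S.core}

theorem exists_path_of_reach {k : ℕ} : ∀ {φ χ : S.data.Chart x}, reach k φ χ →
    ∃ α : Γ.FinPath, α.edges.length = k ∧ Γ.pathEnd α = χ.ty.1 ∧
      ∃ h : Γ.cone α ⊆ S.node (some φ.ty), ∀ z : S.node (some χ.ty), ∃ h',
        χ.fn z = φ.fn ⟨Γ.catPath α z.1, h h'⟩ := by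
  induction k with
  | zero =>
    rintro _ χ rfl
    refine ⟨Γ.trivPath χ.ty.1, rfl, rfl, subset_rfl, fun z => ⟨?_, ?_⟩⟩
    · rw [catPath_trivPath]
      exact z.2
    · congr 1
  | succ k ih =>
    rintro φ χ ⟨e, h⟩
    obtain ⟨α, h1, h2, h3, h4⟩ := ih h
    have hst : Γ.pathEnd (edgePath e.1) = α.start := by
      obtain ⟨z, hz⟩ := S.cones α
      exact (mem_cone_trivPath.1 (h3 hz)).2.symm.trans hz.2.1
    obtain ⟨γ, h5, h6, h7, h8, h9⟩ := exists_append S.cones hst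
    refine ⟨γ, by rw [h5, h1, add_comm]; rfl, h7.trans h2,
      h8.trans (S.cone_edgePath_subset e), fun z => ⟨?_, ?_⟩⟩
    · refine catPath_mem S.cones ?_
      rw [h7, h2]
      exact z.2
    · obtain ⟨h', h10⟩ := h4 z
      rw [h10]
      change φ.fn _ = φ.fn _
      congr 1
      exact Subtype.ext (h9 _).symm

end Setting

end FinDigraph

namespace FinDigraph

open Topology Filter ChartData ChartData.Chart

variable {Γ : FinDigraph}

namespace Setting

variable {E : Set (ℕ → Γ.E)} {G : Subgroup (Equiv.Perm ↥E)} {S : Setting Γ E G}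
  {x x' : Option S.core}

theorem loc_of_isPart {P : Finset (S.data.Chart x)} (hP : IsPart P)
    {T : S.node x → S.node x'} (hT : ∀ φ ∈ P, S.Loc (x := some φ.ty) (y := x') (T ∘ φ.fn)) :
    S.Loc T :=
  Loc.of_partition (s := P) (f := fun φ => φ.fn) (fun φ _ => φ.mem.2) (fun φ _ => φ.mem.1) hT
    hP.cover hP.disj

theorem nocycle (n : ℕ) (v : S.data.W) : ¬ reach (n + 1) (one v) (one v) := by
  intro h
  obtain ⟨α, h1, -, h2, h3⟩ := exists_path_of_reach h
  have key : ∀ z ∈ Γ.cone (Γ.trivPath v.1), Γ.catPath α z = z := fun z hz => by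
    obtain ⟨h', h4⟩ := h3 ⟨z, hz⟩
    exact (congrArg Subtype.val h4).symm
  obtain ⟨z, hz⟩ := S.cones (Γ.trivPath v.1)
  obtain ⟨y, hy, hyz⟩ := exists_ne_of_mem S.iso hz
  refine hyz (funext fun i => ?_)
  induction i using Nat.strong_induction_on with
  | _ i ih =>
    rw [← key y hy, ← key z hz]
    by_cases hi : i < α.edges.length
    · rw [catPath_of_lt _ _ hi, catPath_of_lt _ _ hi]
    · obtain ⟨j, rfl⟩ := Nat.exists_eq_add_of_le' (not_lt.1 hi)
      rw [catPath_add, catPath_add, ih j (by omega)]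

theorem leb {B : Finset (S.data.Chart x)} (hB : IsPart B) (ψ : S.data.Chart x) :
    Bar (fun χ => ∃ φ ∈ B, χ.img ⊆ φ.img) ψ := by
  obtain ⟨n, hn⟩ := exists_uniform_cylinder (S := S.node (some ψ.ty))
    (Q := fun _ U => ∃ φ ∈ B, ∀ z ∈ U, ψ.fn z ∈ φ.img)
    (fun _ hU ⟨φ, hφ, h⟩ => ⟨φ, hφ, fun z hz => h z (hU hz)⟩) fun y => by
      obtain ⟨φ, hφ, h⟩ := hB.cover (ψ.fn y)
      refine ⟨0, _, ?_, φ, hφ, fun z hz => hz⟩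
      have hc := Loc.continuous (S := S) (x := some ψ.ty) (y := x) ψ.mem.2
      exact hc.continuousAt.preimage_mem_nhds
        (range_mem_nhds (s := B) (f := fun φ => φ.fn) (fun φ _ => φ.mem.2) hB.cover hB.disj hφ h)
  refine .of_reach (k := n) fun χ hχ => ?_
  obtain ⟨α, h1, -, h2, h3⟩ := exists_path_of_reach hχ
  obtain ⟨z₀⟩ := S.data.ne χ.ty
  obtain ⟨h4, -⟩ := h3 z₀
  obtain ⟨φ, hφ, h⟩ := hn ⟨_, h2 h4⟩
  refine ⟨φ, hφ, ?_⟩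
  rintro _ ⟨z, rfl⟩
  obtain ⟨h5, h6⟩ := h3 z
  rw [h6]
  refine h _ fun i hi => ?_
  rw [← h1] at hi
  exact (catPath_of_lt _ _ hi).trans (catPath_of_lt _ _ hi).symm

theorem mix (v w : S.data.W) : ∃ Q : Finset (S.data.Chart (some v)), IsPart Q ∧
    ∃ a ∈ Q, ∃ b ∈ Q, a ≠ b ∧ a.ty = w := by
  obtain ⟨z, hz⟩ := S.cones (Γ.trivPath v.1)
  obtain ⟨y, hy, hyz⟩ := exists_ne_of_mem S.iso hz
  obtain ⟨j, hj⟩ := Function.ne_iff.1 hyz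
  obtain ⟨α, h1, h2, h3⟩ := S.exists_path v w (j + 1)
  obtain ⟨u, hu⟩ := S.cones α
  obtain ⟨c, hc, hcu⟩ : ∃ c ∈ Γ.cone (Γ.trivPath v.1), c j ≠ u j := by
    by_cases h : z j = u j
    · exact ⟨y, hy, h ▸ hj⟩
    · exact ⟨z, hz, h⟩
  have hu' : u ∈ Γ.cone (Γ.trivPath v.1) := mem_cone_trivPath.2 ⟨hu.1, hu.2.1.trans h1⟩
  have hQ := isPart_reach (D := S.data) α.edges.length v
  obtain ⟨a, ha, hua⟩ := hQ.cover ⟨u, hu'⟩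
  obtain ⟨b, hb, hcb⟩ := hQ.cover ⟨c, hc⟩
  have hmem : ∀ a : S.data.Chart (some v), reach α.edges.length (one v) a →
      ∃ δ : Γ.FinPath, δ.edges.length = α.edges.length ∧ Γ.pathEnd δ = a.ty.1 ∧
        ∀ z : S.node (some v), z ∈ a.img → z.1 ∈ Γ.cone δ := by
    intro a ha
    obtain ⟨δ, h1, h2, h3, h4⟩ := exists_path_of_reach ha
    refine ⟨δ, h1, h2, ?_⟩
    rintro _ ⟨z, rfl⟩
    obtain ⟨h5, h6⟩ := h4 z
    rw [h6]
    exact h5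
  obtain ⟨δ, h4, h5, h6⟩ := hmem a ((Set.Finite.mem_toFinset _).1 ha)
  have hud : u ∈ Γ.cone δ := h6 _ hua
  refine ⟨_, hQ, a, ha, b, hb, ?_, ?_⟩
  · rintro rfl
    exact hcu (((mem_cone_iff hud).1 (h6 _ hcb)).2.2 j (by omega))
  · refine Subtype.ext ?_
    rw [← h5, pathEnd_eq hud, h4, ← pathEnd_eq hu, h2]

theorem base_isPart : ∃ B : Finset (S.data.Chart none), IsPart B := by
  obtain ⟨x, hx⟩ : E.Nonempty := by
    by_contra h
    refine S.irr.2 fun v hv => ?_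
    obtain ⟨z, hz⟩ := S.cones (S.base ⟨v, hv⟩)
    exact absurd ⟨z, (S.base_ssub _).1 hz⟩ h
  obtain ⟨K, hK⟩ := exists_cone_ssubset S.iso S.sub S.clopen ⟨x, hx⟩
  let R : Γ.FinPath → S.data.Chart none → Prop := fun α χ =>
    ∃ (hw : Γ.pathEnd α = χ.ty.1) (h : Γ.cone α ⊆ E), χ.fn = S.sim (x := none) α χ.ty hw h
  have hR : ∀ α χ χ', R α χ → R α χ' → χ = χ' := by
    rintro α ⟨w, f, hf⟩ ⟨w', f', hf'⟩ ⟨h1, h2, h3⟩ ⟨h1', h2', h3'⟩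
    obtain rfl : w = w' := Subtype.ext (h1.symm.trans h1')
    obtain rfl : f = f' := h3.trans h3'.symm
    rfl
  have hfin : {χ | ∃ α : Γ.FinPath, α.edges.length = max K S.N ∧ R α χ}.Finite := by
    refine ((finite_setOf_length (max K S.N)).biUnion (t := fun α => {χ | R α χ})
      fun α _ => Set.Subsingleton.finite fun χ h χ' h' => hR α χ χ' h h').subset ?_
    rintro χ ⟨α, h, h'⟩
    exact Set.mem_biUnion (x := α) h h'
  refine ⟨hfin.toFinset, fun p => ?_, fun φ hφ ψ hψ p hp hp' => ?_⟩
  · obtain ⟨α, hα, hp⟩ := exists_initial (S.sub p.2) (max K S.N)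
    have hα' := hK α (by omega) p.1 hp p.2
    let w : S.core := ⟨_, S.N_spec α (by omega)⟩
    refine ⟨⟨w, S.sim α w rfl hα'.1, S.sim_injective _ _ _ _, S.loc_sim_none rfl hα'⟩, ?_,
      ⟨dropSeq _ p.1, dropSeq_mem hp⟩, Subtype.ext (catPath_dropSeq hp)⟩
    exact (Set.Finite.mem_toFinset _).2 ⟨α, hα, rfl, hα'.1, rfl⟩
  · have hmem : ∀ α χ, R α χ → ∀ p : E, p ∈ χ.img → p.1 ∈ Γ.cone α := by
      rintro α χ ⟨h1, h2, h3⟩ _ ⟨z, rfl⟩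
      rw [h3]
      exact catPath_mem S.cones (by rw [h1]; exact z.2)
    obtain ⟨α, hα, h⟩ := (Set.Finite.mem_toFinset _).1 hφ
    obtain ⟨β, hβ, h'⟩ := (Set.Finite.mem_toFinset _).1 hψ
    obtain rfl := eq_of_mem_cone (hmem _ _ h p hp) (hmem _ _ h' p hp') (hα.trans hβ.symm)
    exact hR _ _ _ h h'

end Setting

end FinDigraph

namespace FinDigraph

open Topology Filter ChartData ChartData.Chart

variable {Γ : FinDigraph}

namespace Setting

variable {E : Set (ℕ → Γ.E)} {G : Subgroup (Equiv.Perm ↥E)} {S : Setting Γ E G}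

theorem exists_length_bound {f : (ℕ → Γ.E) → ℕ → Γ.E} {D : Set (ℕ → Γ.E)}
    (hf : Γ.RationalOn f D) : ∃ n, ∀ α : Γ.FinPath, Γ.cone α ⊆ D → n ≤ α.edges.length →
      Γ.localAction f α ∈ Γ.nucleusOf f D := by
  have hfin : {α : Γ.FinPath | Γ.cone α ⊆ D ∧
      Γ.localAction f α ∉ Γ.nucleusOf f D}.Finite := by
    refine ((hf.inter_of_left (Γ.nucleusOf f D)ᶜ).biUnion
      (t := fun p => {α | Γ.cone α ⊆ D ∧ Γ.localAction f α = p})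
      fun p hp => Set.not_infinite.1 hp.2).subset ?_
    rintro α ⟨h1, h2⟩
    exact Set.mem_biUnion ⟨⟨α, h1, rfl⟩, h2⟩ ⟨h1, rfl⟩
  obtain ⟨n, hn⟩ := (hfin.image fun α : Γ.FinPath => α.edges.length).bddAbove
  refine ⟨n + 1, fun α hα hlen => ?_⟩
  by_contra h
  have : α.edges.length ≤ n := hn ⟨α, ⟨hα, h⟩, rfl⟩
  omega

theorem permExt_of_mem (g : Equiv.Perm ↥E) {x : ℕ → Γ.E} (hx : x ∈ E) :
    Γ.permExt E g x = g ⟨x, hx⟩ := dif_pos hx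

theorem barLen_spec (hiso : Γ.NoIsolatedPoints) (hc : Γ.NoEmptyCones) (g : Equiv.Perm ↥E)
    {γ : Γ.FinPath} (hγ : Γ.cone γ ⊆ E) :
    (∀ x ∈ Γ.cone γ, ∀ y ∈ Γ.cone γ, ∀ i < Γ.barLen (Γ.permExt E g) γ,
      Γ.permExt E g x i = Γ.permExt E g y i) ∧
    ∀ n, (∀ x ∈ Γ.cone γ, ∀ y ∈ Γ.cone γ, ∀ i < n, Γ.permExt E g x i = Γ.permExt E g y i) →
      n ≤ Γ.barLen (Γ.permExt E g) γ := by
  have hbdd : BddAbove {n | ∀ x ∈ Γ.cone γ, ∀ y ∈ Γ.cone γ, ∀ i < n,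
      Γ.permExt E g x i = Γ.permExt E g y i} := by
    obtain ⟨x, hx⟩ := hc γ
    obtain ⟨y, hy, hyx⟩ := exists_ne_of_mem hiso hx
    have : Γ.permExt E g y ≠ Γ.permExt E g x := fun h => by
      rw [permExt_of_mem g (hγ hy), permExt_of_mem g (hγ hx)] at h
      exact hyx (congrArg Subtype.val (g.injective (Subtype.ext h)))
    obtain ⟨j, hj⟩ := Function.ne_iff.1 this
    exact ⟨j, fun n hn => not_lt.1 fun h => hj (hn y hy x hx j h)⟩
  refine ⟨?_, fun n hn => le_csSup hbdd hn⟩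
  exact Nat.sSup_mem (s := {n | ∀ x ∈ Γ.cone γ, ∀ y ∈ Γ.cone γ, ∀ i < n,
      Γ.permExt E g x i = Γ.permExt E g y i}) ⟨0, fun _ _ _ _ i hi => absurd hi (by omega)⟩ hbdd

/-- A chart of a node, recorded in the form in which local actions are recorded. -/
def code {v : S.core} (n : S.data.Chart (some v)) : Γ.V × ((ℕ → Γ.E) → ℕ → Γ.E) :=
  (n.ty.1, fun z => if h : z ∈ S.node (some n.ty) then
    (show S.node (some v) from n.fn ⟨z, h⟩).1 else z)

theorem code_injective (v : S.core) : Function.Injective (code (S := S) (v := v)) := by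
  rintro ⟨w, f, hf⟩ ⟨w', f', hf'⟩ h
  obtain rfl : w = w' := Subtype.ext (congrArg Prod.fst h)
  obtain rfl : f = f' := by
    funext z
    have := congrFun (congrArg Prod.snd h) z.1
    exact Subtype.ext (((dif_pos z.2).symm.trans this).trans (dif_pos z.2))
  rfl

theorem exists_uniform {v w : S.core} {f : S.node (some w) → S.node (some v)} (hf : S.Loc f) :
    ∃ n, ∀ y : S.node (some w), ∃ g ∈ G,
      (∀ z : S.node (some w), (∀ i < n, z.1 i = y.1 i) →
        Γ.catPath (S.base v) (f z).1 = g (S.emb (some w) z) ∧ (f z).1 0 = (f y).1 0) ∧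
      ∀ α : Γ.FinPath, Γ.cone α ⊆ E → n ≤ α.edges.length →
        Γ.localAction (Γ.permExt E g) α ∈ Γ.groupNucleus E G := by
  obtain ⟨n, hn⟩ := exists_uniform_cylinder (S := S.node (some w))
    (Q := fun n U => ∃ g ∈ G, (∀ z ∈ U, Γ.catPath (S.base v) (f z).1 = g (S.emb (some w) z)) ∧
      (∀ z ∈ U, ∀ z' ∈ U, (f z).1 0 = (f z').1 0) ∧
      ∀ α : Γ.FinPath, Γ.cone α ⊆ E → n ≤ α.edges.length →
        Γ.localAction (Γ.permExt E g) α ∈ Γ.groupNucleus E G)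
    (fun hmn hU ⟨g, hg, h1, h2, h3⟩ => ⟨g, hg, fun z hz => h1 z (hU hz),
      fun z hz z' hz' => h2 z (hU hz) z' (hU hz'), fun α hα h => h3 α hα (hmn.trans h)⟩)
    fun y => by
      obtain ⟨g, hg, h⟩ := hf y
      obtain ⟨n, hn⟩ := exists_length_bound (S.rsg.1 g hg).2.2
      have h0 : ∀ᶠ z in 𝓝 y, (f z).1 0 = (f y).1 0 := by
        have hc : Continuous fun z => (f z).1 0 :=
          (continuous_apply 0 : Continuous fun x : ℕ → Γ.E => x 0).comp
            (continuous_subtype_val.comp hf.continuous)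
        exact hc.continuousAt.preimage_mem_nhds ((isOpen_discrete {(f y).1 0}).mem_nhds rfl)
      refine ⟨n, _, h.and h0, g, hg, fun z hz => congrArg Subtype.val hz.1,
        fun z hz z' hz' => hz.2.trans hz'.2.symm, fun α hα hlen => ?_⟩
      exact Set.mem_biUnion hg (hn α hα hlen)
  refine ⟨n, fun y => ?_⟩
  obtain ⟨g, hg, h1, h2, h3⟩ := hn y
  exact ⟨g, hg, fun z hz => ⟨h1 z hz, h2 z hz y fun _ _ => rfl⟩, h3⟩

theorem contraction : ∃ N : ∀ v, Set (S.data.Chart (some v)), (∀ v, (N v).Finite) ∧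
    ∀ v (m : S.data.Chart (some v)), Bar (fun χ => ∃ k β, reach (k + 1) (one v) β ∧
      ∃ n ∈ N β.ty, χ = β.comp n) m := by
  refine ⟨fun v => {n | code n ∈ Γ.groupNucleus E G}, fun v =>
    S.finite_nucleus.preimage (code_injective v).injOn, fun v m => ?_⟩
  let mf : S.node (some m.ty) → S.node (some v) := m.fn
  obtain ⟨K, hK⟩ := exists_uniform (f := mf) m.mem.2
  refine .of_reach (k := K) fun χ hχ => ?_
  obtain ⟨α, hα, hαχ, hsub, hfn⟩ := exists_path_of_reach hχ
  obtain ⟨z₀⟩ := S.data.ne χ.ty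
  obtain ⟨h₀, h₀'⟩ := hfn z₀
  obtain ⟨g, hg, hloc, hnuc⟩ := hK ⟨_, hsub h₀⟩
  have hst : Γ.pathEnd (S.base m.ty) = α.start := by
    refine (S.base_end _).trans ?_
    exact (mem_cone_trivPath.1 (hsub h₀)).2.symm.trans h₀.2.1
  obtain ⟨γ, hγlen, -, hγend, hγsub, hγcat⟩ := exists_append S.cones hst
  have hγE : Γ.cone γ ⊆ E := hγsub.trans (S.base_ssub _).1
  let c : S.node (some χ.ty) → S.node (some v) := χ.fn
  let f := Γ.permExt E g
  let b := Γ.barLen f γ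
  let L := (S.base v).edges.length
  have hcatγ : ∀ z : S.node (some χ.ty), Γ.catPath γ z.1 ∈ Γ.cone γ := fun z =>
    catPath_mem S.cones (by rw [hγend, hαχ]; exact z.2)
  have hloc' : ∀ z : S.node (some χ.ty), f (Γ.catPath γ z.1) = Γ.catPath (S.base v) (c z).1 ∧
      (c z).1 0 = (c z₀).1 0 := by
    intro z
    obtain ⟨h, h'⟩ := hfn z
    obtain ⟨h1, h2⟩ := hloc ⟨_, hsub h⟩ fun i hi => by
      rw [← hα] at hi
      exact (catPath_of_lt _ _ hi).trans (catPath_of_lt _ _ hi).symm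
    have hcz : c z = mf ⟨_, hsub h⟩ := h'
    have hcz₀ : c z₀ = mf ⟨_, hsub h₀⟩ := h₀'
    refine ⟨?_, ?_⟩
    · rw [show f (Γ.catPath γ z.1) = g ⟨_, hγE (hcatγ z)⟩ from permExt_of_mem g _]
      have h3 : (⟨_, hγE (hcatγ z)⟩ : E) = S.emb (some m.ty) ⟨_, hsub h⟩ := Subtype.ext (hγcat _)
      rw [h3, hcz]
      exact h1.symm
    · rw [hcz, hcz₀]
      exact h2
  have hsurj : ∀ y ∈ Γ.cone γ, ∃ z : S.node (some χ.ty), y = Γ.catPath γ z.1 := fun y hy =>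
    ⟨⟨_, by have := dropSeq_mem hy; rwa [hγend, hαχ] at this⟩, (catPath_dropSeq hy).symm⟩
  obtain ⟨hb1, hb2⟩ := barLen_spec S.iso S.cones g hγE
  have hLb : L + 1 ≤ b := by
    refine hb2 _ fun y hy y' hy' i hi => ?_
    obtain ⟨z, rfl⟩ := hsurj y hy
    obtain ⟨z', rfl⟩ := hsurj y' hy'
    change f _ i = f _ i
    rw [(hloc' z).1, (hloc' z').1]
    rcases (Nat.lt_succ_iff.1 hi).lt_or_eq with hi | rfl
    · rw [catPath_of_lt _ _ hi, catPath_of_lt _ _ hi]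
    · have h := catPath_add (S.base v) (c z).1 0
      have h' := catPath_add (S.base v) (c z').1 0
      rw [zero_add] at h h'
      rw [h, h', (hloc' z).2, (hloc' z').2]
  obtain ⟨k, hk⟩ := Nat.exists_eq_add_of_le' hLb
  have hb : b = (k + 1) + L := by omega
  obtain ⟨β, hβ, hβ₀⟩ := exists_reach_mem (D := S.data) (k + 1) (φ := one v) ⟨c z₀, rfl⟩
  obtain ⟨δ, hδ, hδβ, hδsub, hδfn⟩ := exists_path_of_reach hβ
  have hβfn : ∀ z : S.node (some β.ty), (show S.node (some v) from β.fn z).1 =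
      Γ.catPath δ z.1 ∧ Γ.catPath δ z.1 ∈ Γ.cone δ := fun z => by
    obtain ⟨h, h'⟩ := hδfn z
    exact ⟨congrArg Subtype.val h', h⟩
  have hcδ : ∀ z, (c z).1 ∈ Γ.cone δ := by
    have h0 : (c z₀).1 ∈ Γ.cone δ := by
      obtain ⟨u, hu⟩ := hβ₀
      rw [show c z₀ = β.fn u from hu.symm, (hβfn u).1]
      exact (hβfn u).2
    intro z
    have hz := mem_cone_trivPath.1 (c z).2
    have hz₀ := mem_cone_trivPath.1 (c z₀).2
    refine (mem_cone_iff h0).2 ⟨hz.1, hz.2.trans (hz₀.2.symm.trans h0.2.1), fun i hi => ?_⟩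
    have := hb1 _ (hcatγ z) _ (hcatγ z₀) (i + L) (by change _ < b; omega)
    change f _ _ = f _ _ at this
    rwa [(hloc' z).1, (hloc' z₀).1, catPath_add, catPath_add] at this
  have himg : χ.img ⊆ β.img := by
    rintro _ ⟨z, rfl⟩
    have h := dropSeq_mem (hcδ z)
    rw [hδβ] at h
    refine ⟨⟨_, h⟩, Subtype.ext ?_⟩
    exact (hβfn ⟨_, h⟩).1.trans (catPath_dropSeq (hcδ z))
  obtain ⟨n, hn⟩ := exists_comp_of_img_subset himg
  refine ⟨k, β, hβ, n, ?_, hn⟩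
  have hty : χ.ty = n.ty := congrArg Chart.ty hn
  have hcode : code n = Γ.localAction f γ := by
    subst hn
    have hpe : Γ.pathEnd γ = n.ty.1 := hγend.trans hαχ
    refine Prod.ext hpe.symm (funext fun z => ?_)
    simp only [code, localAction]
    rw [hpe]
    split_ifs with h1 h2
    · funext i
      have h3 : f (Γ.catPath γ z) = Γ.catPath (S.base v) (c ⟨z, h1⟩).1 := (hloc' ⟨z, h1⟩).1
      have h4 : (c ⟨z, h1⟩).1 = Γ.catPath δ (n.fn ⟨z, h1⟩).1 := (hβfn (n.fn ⟨z, h1⟩)).1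
      change _ = f (Γ.catPath γ z) (i + b)
      rw [h3, h4, hb, ← add_assoc, catPath_add, ← hδ, catPath_add]
    · exact absurd h1 h2
    · exact absurd ‹_› h1
    · rfl
  have hmem := hnuc γ hγE (by omega)
  change Γ.localAction f γ ∈ _ at hmem
  rw [← hcode] at hmem
  exact hmem

theorem good : S.data.Good where
  nocycle := nocycle
  glue _ hT hP h χ := ⟨hT.comp χ.mem.1,
    Loc.comp (loc_of_isPart hP fun φ hφ => (h φ hφ).2) χ.mem.2⟩
  leb := leb
  contraction := contraction
  mix := mix
  base := base_isPart

theorem isFinitelyPresented (S : Setting Γ E G) : Group.IsFinitelyPresented G := by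
  refine S.good.isFinitelyPresented (G := G) (fun g hg φ => ⟨?_, ?_⟩) fun T P hP h => ?_
  · exact g.injective.comp φ.mem.1
  · have hgl : S.Loc (x := none) (y := none) g := fun p => ⟨g, hg, .of_forall fun _ => rfl⟩
    exact hgl.comp φ.mem.2
  · have hT : S.Loc (x := none) (y := none) T := loc_of_isPart hP fun φ hφ => (h φ hφ).2
    have : CompactSpace E := S.clopen.compactSpace S.sub
    have hsymm : ∀ T : Equiv.Perm E, Continuous T → Continuous T.symm := fun _ h =>
      h.continuous_symm_of_equiv_compact_to_t2
    refine S.full T hT.continuous (hsymm T hT.continuous) fun p => ?_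
    obtain ⟨g, hg, hp⟩ := hT p
    obtain ⟨U, hU, hUo, hpU⟩ := eventually_nhds_iff.1 hp
    exact ⟨U, hUo, hpU, g, hg, hU⟩

end Setting

theorem exists_setting (hiso : Γ.NoIsolatedPoints) (hcones : Γ.NoEmptyCones)
    {E : Set (ℕ → Γ.E)} (hEsub : E ⊆ Γ.shift) (hEne : E.Nonempty) (hEclopen : Γ.ClopenIn E)
    {G : Subgroup (Equiv.Perm ↥E)} (hRSG : Γ.IsRSG E G) (hContr : Γ.IsContracting E G)
    (hFull : Γ.IsFullOn E G) : Nonempty (Setting Γ E G) := by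
  obtain ⟨⟨core, hirr, -, N, hN⟩, hnuc⟩ := hContr
  have hN' : ∀ α : Γ.FinPath, N ≤ α.edges.length → Γ.pathEnd α ∈ core := by
    intro α hα
    obtain ⟨j, hj⟩ := Nat.exists_eq_add_of_le hα
    obtain ⟨x, hx⟩ := hcones α
    have hs : dropSeq j x ∈ Γ.shift := fun i => by
      have := hx.1 (i + j)
      rwa [add_right_comm] at this
    obtain ⟨β, hβ, hxβ⟩ := exists_initial hs N
    have := hN β hβ
    rw [pathEnd_eq hxβ, hβ] at this
    rw [pathEnd_eq hx, hj]
    exact this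
  have hlong : ∀ v ∈ core, ∀ k, ∃ α : Γ.FinPath, Γ.pathEnd α = v ∧ k ≤ α.edges.length := by
    intro v hv k
    induction k with
    | zero => exact ⟨Γ.trivPath v, rfl, Nat.zero_le _⟩
    | succ k ih =>
      obtain ⟨α, h2, h3⟩ := ih
      obtain ⟨β, h4, h5, h6, -⟩ := hirr.1 v hv v hv
      obtain ⟨γ, h7, -, h9, -⟩ := exists_append hcones (h2.trans h4.symm)
      have := List.length_pos_iff.2 h6
      exact ⟨γ, h9.trans h5, by omega⟩
  have hclosed : ∀ e, Γ.o e ∈ core → Γ.t e ∈ core := by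
    intro e he
    obtain ⟨α, h1, h2⟩ := hlong _ he N
    obtain ⟨γ, h3, -, h4, -⟩ := exists_append hcones (β := edgePath e) h1
    have := hN' γ (by omega)
    rw [h4] at this
    exact this
  obtain ⟨K, hK⟩ := exists_cone_ssubset hiso hEsub hEclopen hEne
  obtain ⟨x, hx⟩ := hEne
  obtain ⟨ε, hε, hxε⟩ := exists_initial (hEsub hx) (max K N)
  have hεcore := hN' ε (by omega)
  have hbase : ∀ v : core, ∃ γ : Γ.FinPath, Γ.pathEnd γ = v ∧ Γ.cone γ ⊂ E := by
    intro v
    obtain ⟨β, h4, h5, -⟩ := hirr.1 _ hεcore v v.2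
    obtain ⟨γ, -, -, h6, h7, -⟩ := exists_append hcones h4.symm
    exact ⟨γ, h6.trans h5, ssubset_of_subset_of_ssubset h7 (hK ε (by omega) x hxε hx)⟩
  choose base hbase using hbase
  exact ⟨⟨hiso, hcones, hEsub, hEclopen, hRSG, hFull, hnuc, core, hirr, N, hN', hclosed, base,
    fun v => (hbase v).1, fun v => (hbase v).2⟩⟩

end FinDigraph

/-- Every full, contracting rational similarity group is finitely presented. -/
theorem full_contracting_RSG_finitely_presented (Γ : FinDigraph)
    (hiso : Γ.NoIsolatedPoints) (hcones : Γ.NoEmptyCones)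
    (E : Set (ℕ → Γ.E)) (hEsub : E ⊆ Γ.shift) (hEne : E.Nonempty)
    (hEclopen : Γ.ClopenIn E)
    (G : Subgroup (Equiv.Perm ↥E)) (hRSG : Γ.IsRSG E G)
    (hContr : Γ.IsContracting E G) (hFull : Γ.IsFullOn E G) :
    FinitelyPresentedGroup ↥G := by
  obtain ⟨S⟩ := FinDigraph.exists_setting hiso hcones hEsub hEne hEclopen hRSG hContr hFull
  obtain ⟨n, φ, hφ, R, hR, h⟩ := S.isFinitelyPresented.out
  exact ⟨n, φ, hφ, R, hR, h.symm⟩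

end
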